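/- Let A, B ∈ SL(2,ℂ) generate a discrete subgroup, let A be elliptic of order n ≥ 3, and suppose the image in PSL(2,ℂ) of the subgroup generated by A and B·A·B⁻¹ is isomorphic to A₄, to S₄, or to A₅. Then either the image in PSL(2,ℂ) of the subgroup generated by A and B is itself isomorphic to A₄, S₄, or A₅, or for every C ∈ SL(2,ℂ), max{‖C·A·C⁻¹‖², ‖C·B·C⁻¹‖²} > 2·t(n). -/

import Mathlib

open Matrix Real

noncomputable section

abbrev SL2C := Matrix.SpecialLinearGroup (Fin 2) ℂ

/-- The Frobenius (Hilbert–Schmidt) norm of a 2×2 complex matrix. -/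
def fnorm (A : Matrix (Fin 2) (Fin 2) ℂ) : ℝ :=
  @norm _ Matrix.frobeniusSeminormedAddCommGroup.toNorm A

instance : TopologicalSpace SL2C :=
  TopologicalSpace.induced (fun g => (g : Matrix (Fin 2) (Fin 2) ℂ)) inferInstance

/-- A subgroup of `SL(2,ℂ)` is discrete if it is a discrete subspace of `SL(2,ℂ)`. -/
def IsDiscreteSubgroup (Γ : Subgroup SL2C) : Prop := DiscreteTopology Γ

/-- `A` is elliptic of order `n`: `A^n = ±1` but `A^k ≠ ±1` for `1 ≤ k < n`. -/
def IsEllipticOfOrder (A : SL2C) (n : ℕ) : Prop :=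
  (A ^ n = 1 ∨ A ^ n = -1) ∧ ∀ k : ℕ, 1 ≤ k → k < n → A ^ k ≠ 1 ∧ A ^ k ≠ -1

/-- `A` is parabolic: `A ≠ ±1` and `tr A = ±2`. -/
def IsParabolic (A : SL2C) : Prop :=
  A ≠ 1 ∧ A ≠ -1 ∧ (Matrix.trace (A : Matrix (Fin 2) (Fin 2) ℂ) = 2 ∨
    Matrix.trace (A : Matrix (Fin 2) (Fin 2) ℂ) = -2)

/-- `S` and `T` have a common eigenvector in `ℂ²`. -/
def HasCommonEigenvector (S T : SL2C) : Prop :=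
  ∃ v : Fin 2 → ℂ, v ≠ 0 ∧ (∃ a : ℂ, (S : Matrix (Fin 2) (Fin 2) ℂ).mulVec v = a • v) ∧
    (∃ b : ℂ, (T : Matrix (Fin 2) (Fin 2) ℂ).mulVec v = b • v)

/-- A subgroup of `SL(2,ℂ)` is nonelementary if it contains two elements `S`, `T`
with `S^k ≠ ±1 ≠ T^k` for all `k ≥ 1` having no common eigenvector in `ℂ²`. -/
def IsNonelementary (Γ : Subgroup SL2C) : Prop :=
  ∃ S ∈ Γ, ∃ T ∈ Γ, (∀ k : ℕ, 1 ≤ k → S ^ k ≠ 1 ∧ S ^ k ≠ -1) ∧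
    (∀ k : ℕ, 1 ≤ k → T ^ k ≠ 1 ∧ T ^ k ≠ -1) ∧ ¬ HasCommonEigenvector S T

/-- The trace parameter `β(A) = tr²(A) - 4`. -/
def βp (A : SL2C) : ℂ := (Matrix.trace (A : Matrix (Fin 2) (Fin 2) ℂ)) ^ 2 - 4

/-- The commutator parameter `γ(A,B) = tr [A,B] - 2`. -/
def γp (A B : SL2C) : ℂ :=
  Matrix.trace ((A * B * A⁻¹ * B⁻¹ : SL2C) : Matrix (Fin 2) (Fin 2) ℂ) - 2

/-- `PSL(2,ℂ)`, the quotient of `SL(2,ℂ)` by its center `{1, -1}`. -/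
abbrev PSL2C := SL2C ⧸ Subgroup.center SL2C

/-- The image in `PSL(2,ℂ)` of a subgroup of `SL(2,ℂ)`. -/
def pslImage (Γ : Subgroup SL2C) : Subgroup PSL2C :=
  Γ.map (QuotientGroup.mk' (Subgroup.center SL2C))

open Classical in
/-- `t5`: the unique real `t > 1` with
`t (t - cos²(π/5)) + (t-1) √((t+1)(t+1-2 cos²(π/5))) = 1/2`. -/
def t5 : ℝ :=
  if h : ∃ t : ℝ, 1 < t ∧
      t * (t - Real.cos (π / 5) ^ 2) +
        (t - 1) * Real.sqrt ((t + 1) * (t + 1 - 2 * Real.cos (π / 5) ^ 2)) = 1 / 2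
  then h.choose else 0

/-- The value `t n = cosh (c n)` where `c n` is the sharp displacement bound for
discrete nonelementary groups with an elliptic generator of order `n ≥ 3`. -/
def tOf : ℕ → ℝ
  | 3 => (2 * Real.sqrt (8 + 2 * Real.sqrt 5) - (1 + Real.sqrt 5)) / (6 - Real.sqrt 5)
  | 4 => (Real.sqrt (6 + 2 * Real.sqrt 3) - Real.sqrt 3) / (3 - Real.sqrt 3)
  | 5 => t5
  | 6 => 17 / 16
  | n => (5 - 2 * Real.sin (π / n) ^ 2) / (4 + 2 * Real.sin (π / n) ^ 2)
section
/-- Bounded subsets are finite. -/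
def DB (Γ : Subgroup SL2C) : Prop :=
  ∀ r : ℝ, {g : SL2C | g ∈ Γ ∧ ∀ i j, ‖g i j‖ ≤ r}.Finite

lemma db_of_discrete {Γ : Subgroup SL2C} (h : IsDiscreteSubgroup Γ) : DB Γ := by
  intro r
  by_contra hinf
  have hinf : {g : SL2C | g ∈ Γ ∧ ∀ i j, ‖g i j‖ ≤ r}.Infinite := hinf
  set S := {g : SL2C | g ∈ Γ ∧ ∀ i j, ‖g i j‖ ≤ r} with hS
  let f : SL2C → Matrix (Fin 2) (Fin 2) ℂ := fun g => (g : Matrix (Fin 2) (Fin 2) ℂ)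
  have hf : Function.Injective f := fun a b h => Subtype.ext h
  have hK : IsCompact {M : Matrix (Fin 2) (Fin 2) ℂ | ∀ i j, M i j ∈ Metric.closedBall (0:ℂ) r} :=
    IsCompact.matrix (isCompact_closedBall 0 r)
  have hsub : f '' S ⊆ {M : Matrix (Fin 2) (Fin 2) ℂ | ∀ i j, M i j ∈ Metric.closedBall (0:ℂ) r} := by
    rintro _ ⟨g, hg, rfl⟩ i j
    simpa using hg.2 i j
  obtain ⟨M0, -, hacc⟩ := (hinf.image hf.injOn).exists_accPt_of_subset_isCompact hK hsub
  have hdet : M0.det = 1 := by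
    have hc : IsClosed {M : Matrix (Fin 2) (Fin 2) ℂ | M.det = 1} :=
      isClosed_eq (continuous_id.matrix_det) continuous_const
    have : M0 ∈ closure (f '' S) := hacc.clusterPt.mem_closure
    refine (closure_minimal ?_ hc) this
    rintro _ ⟨g, hg, rfl⟩
    exact g.2
  -- discreteness at one
  have h1 : ∃ U : Set (Matrix (Fin 2) (Fin 2) ℂ), IsOpen U ∧ (1 : Matrix (Fin 2) (Fin 2) ℂ) ∈ U ∧
      ∀ g ∈ Γ, f g ∈ U → g = 1 := by
    have : DiscreteTopology Γ := h
    have ho : IsOpen ({1} : Set Γ) := isOpen_discrete _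
    rw [isOpen_induced_iff] at ho
    obtain ⟨V, hV, hV2⟩ := ho
    obtain ⟨U, hU, hUV⟩ := isOpen_induced_iff.1 hV
    refine ⟨U, hU, ?_, ?_⟩
    · have : (1 : Γ) ∈ (Subtype.val ⁻¹' V : Set Γ) := by rw [hV2]; rfl
      rw [← hUV] at this
      simpa using this
    · intro g hg hgU
      have : (⟨g, hg⟩ : Γ) ∈ (Subtype.val ⁻¹' V : Set Γ) := by
        rw [← hUV]; exact hgU
      rw [hV2] at this
      exact congrArg Subtype.val this
  obtain ⟨U, hU, hU1, hUΓ⟩ := h1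
  have hcont : Continuous (fun p : Matrix (Fin 2) (Fin 2) ℂ × Matrix (Fin 2) (Fin 2) ℂ =>
      p.1 * p.2.adjugate) := continuous_fst.mul (continuous_snd.matrix_adjugate)
  have hM : (fun p : Matrix (Fin 2) (Fin 2) ℂ × Matrix (Fin 2) (Fin 2) ℂ =>
      p.1 * p.2.adjugate) (M0, M0) ∈ U := by
    simp [Matrix.mul_adjugate, hdet, hU1]
  have hn := (hcont.continuousAt (x := (M0, M0))).preimage_mem_nhds (hU.mem_nhds hM)
  rw [nhds_prod_eq, Filter.mem_prod_same_iff] at hn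
  obtain ⟨V, hV, hVU⟩ := hn
  rw [accPt_iff_nhds] at hacc
  obtain ⟨x, ⟨hxV, hxS⟩, hx0⟩ := hacc V hV
  have hV' : V \ {x} ∈ nhds M0 := Filter.inter_mem hV (isOpen_compl_singleton.mem_nhds hx0.symm)
  obtain ⟨y, ⟨hyV, hyS⟩, hy0⟩ := hacc _ hV'
  obtain ⟨g, hg, rfl⟩ := hxS
  obtain ⟨k, hk, rfl⟩ := hyS
  have hgk : f (g * k⁻¹) ∈ U := by
    have := hVU (Set.mk_mem_prod hxV hyV.1)
    simpa [f, Matrix.SpecialLinearGroup.coe_inv] using this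
  have := hUΓ _ (Γ.mul_mem hg.1 (Γ.inv_mem hk.1)) hgk
  apply hyV.2
  rw [mul_inv_eq_one] at this
  rw [this]; rfl

end

section

/-- Build an element of SL2C from entries. -/
def mkSL (a b c d : ℂ) (h : a * d - b * c = 1) : SL2C := ⟨!![a, b; c, d], by simp [Matrix.det_fin_two, h]⟩

lemma sl_ext {X Y : SL2C} (h00 : X 0 0 = Y 0 0) (h01 : X 0 1 = Y 0 1) (h10 : X 1 0 = Y 1 0)
    (h11 : X 1 1 = Y 1 1) : X = Y := by
  apply Subtype.ext
  ext i j
  fin_cases i <;> fin_cases j <;> assumption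

lemma sl_det (X : SL2C) : X 0 0 * X 1 1 - X 0 1 * X 1 0 = 1 := by
  have := X.2
  rwa [Matrix.det_fin_two] at this

lemma sl_mul (X Y : SL2C) (i j : Fin 2) : (X * Y) i j = X i 0 * Y 0 j + X i 1 * Y 1 j := by
  simp [Matrix.mul_apply, Fin.sum_univ_two]

lemma sl_inv00 (X : SL2C) : X⁻¹ 0 0 = X 1 1 := by
  simp [Matrix.SpecialLinearGroup.coe_inv, Matrix.adjugate_fin_two]
lemma sl_inv01 (X : SL2C) : X⁻¹ 0 1 = - X 0 1 := by
  simp [Matrix.SpecialLinearGroup.coe_inv, Matrix.adjugate_fin_two]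
lemma sl_inv10 (X : SL2C) : X⁻¹ 1 0 = - X 1 0 := by
  simp [Matrix.SpecialLinearGroup.coe_inv, Matrix.adjugate_fin_two]
lemma sl_inv11 (X : SL2C) : X⁻¹ 1 1 = X 0 0 := by
  simp [Matrix.SpecialLinearGroup.coe_inv, Matrix.adjugate_fin_two]

/-- trace of an element -/
def str (X : SL2C) : ℂ := X 0 0 + X 1 1

lemma str_conj (P X : SL2C) : str (P * X * P⁻¹) = str X := by
  simp only [str, sl_mul, sl_inv00, sl_inv01, sl_inv10, sl_inv11]
  linear_combination (X 0 0 + X 1 1) * sl_det P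

lemma sl_inv_norm_le (X : SL2C) {r : ℝ} (h : ∀ i j, ‖X i j‖ ≤ r) : ∀ i j, ‖X⁻¹ i j‖ ≤ r := by
  intro i j
  fin_cases i <;> fin_cases j
  · have := h 1 1; simpa [sl_inv00] using this
  · have := h 0 1; simpa [sl_inv01] using this
  · have := h 1 0; simpa [sl_inv10] using this
  · have := h 0 0; simpa [sl_inv11] using this

lemma sl_mul_norm_le (X Y : SL2C) {r s : ℝ} (hX : ∀ i j, ‖X i j‖ ≤ r) (hY : ∀ i j, ‖Y i j‖ ≤ s) :
    ∀ i j, ‖(X * Y) i j‖ ≤ 2 * r * s := by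
  intro i j
  rw [sl_mul]
  have hr : 0 ≤ r := (norm_nonneg _).trans (hX 0 0)
  calc ‖X i 0 * Y 0 j + X i 1 * Y 1 j‖ ≤ ‖X i 0 * Y 0 j‖ + ‖X i 1 * Y 1 j‖ := norm_add_le _ _
    _ = ‖X i 0‖ * ‖Y 0 j‖ + ‖X i 1‖ * ‖Y 1 j‖ := by simp
    _ ≤ r * s + r * s := by
      gcongr
      · exact hX _ _
      · exact hY _ _
      · exact hX _ _
      · exact hY _ _
    _ = _ := by ring

lemma sl_exists_norm (X : SL2C) : ∃ r : ℝ, ∀ i j, ‖X i j‖ ≤ r := by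
  refine ⟨‖X 0 0‖ + ‖X 0 1‖ + ‖X 1 0‖ + ‖X 1 1‖, ?_⟩
  have h0 := norm_nonneg (X 0 0)
  have h1 := norm_nonneg (X 0 1)
  have h2 := norm_nonneg (X 1 0)
  have h3 := norm_nonneg (X 1 1)
  intro i j
  fin_cases i <;> fin_cases j
  · change ‖X 0 0‖ ≤ _; linarith
  · change ‖X 0 1‖ ≤ _; linarith
  · change ‖X 1 0‖ ≤ _; linarith
  · change ‖X 1 1‖ ≤ _; linarith

/-- conjugate subgroup -/
def cj (P : SL2C) (Γ : Subgroup SL2C) : Subgroup SL2C := Γ.map (MulAut.conj P).toMonoidHom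

lemma mem_cj {P X : SL2C} {Γ : Subgroup SL2C} (h : X ∈ Γ) : P * X * P⁻¹ ∈ cj P Γ :=
  ⟨X, h, rfl⟩

lemma cj_closure (P X Y : SL2C) :
    cj P (Subgroup.closure {X, Y}) = Subgroup.closure {P * X * P⁻¹, P * Y * P⁻¹} := by
  rw [cj, MonoidHom.map_closure]
  simp [Set.image_pair]

lemma DB.mono {Γ Δ : Subgroup SL2C} (h : DB Γ) (hl : Δ ≤ Γ) : DB Δ := fun r =>
  (h r).subset fun _ hg => ⟨hl hg.1, hg.2⟩

lemma DB.cj {Γ : Subgroup SL2C} (h : DB Γ) (P : SL2C) : DB (cj P Γ) := by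
  intro r
  obtain ⟨s, hs⟩ := sl_exists_norm P
  refine ((h (2 * s * (2 * r * s))).image (fun g => P * g * P⁻¹)).subset ?_
  rintro _ ⟨⟨g, hg, rfl⟩, hb⟩
  refine ⟨g, ⟨hg, ?_⟩, rfl⟩
  have e : g = P⁻¹ * ((P * g * P⁻¹) * P) := by group
  rw [e]
  exact sl_mul_norm_le _ _ (sl_inv_norm_le _ hs) (sl_mul_norm_le _ _ hb hs)

lemma exists_diag (M : SL2C) (lam : ℂ) (hl : lam ≠ 0) (htr : lam + lam⁻¹ = str M) (hne : lam ≠ lam⁻¹) :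
    ∃ P : SL2C, (P * M * P⁻¹) 0 0 = lam ∧ (P * M * P⁻¹) 1 1 = lam⁻¹ ∧ (P * M * P⁻¹) 0 1 = 0 ∧
      (P * M * P⁻¹) 1 0 = 0 := by
  have key : ∃ Q : SL2C, ∃ D : SL2C, D 0 0 = lam ∧ D 1 1 = lam⁻¹ ∧ D 0 1 = 0 ∧ D 1 0 = 0 ∧
      M * Q = Q * D := by
    have hd := sl_det M
    unfold str at htr
    set a := M 0 0 with ha
    set b := M 0 1 with hb
    set c := M 1 0 with hc
    set d := M 1 1 with hdd
    have hmu : lam * lam⁻¹ = 1 := mul_inv_cancel₀ hl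
    set mu := lam⁻¹ with hmu'
    have hne' : lam - mu ≠ 0 := sub_ne_zero.2 hne
    let D := mkSL lam 0 0 mu (by simp [hmu])
    by_cases hc0 : c = 0
    · rw [hc0] at hd
      have hroot : (lam - a) * (lam - d) = 0 := by
        linear_combination lam * htr + hd - hmu
      rcases mul_eq_zero.1 hroot with h | h
      · have hla : lam = a := sub_eq_zero.1 h
        have hmd : mu = d := by linear_combination htr - hla
        have hda : d - a ≠ 0 := by rw [← hla, ← hmd]; intro h; apply hne'; linear_combination -h
        refine ⟨mkSL 1 (b / (d - a)) 0 1 (by simp), D, rfl, rfl, rfl, rfl, ?_⟩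
        apply sl_ext <;> simp only [sl_mul] <;> simp [mkSL, D, ← ha, ← hb, ← hc, ← hdd, hc0, hla, hmd]
        field_simp
        ring
      · have hla : lam = d := sub_eq_zero.1 h
        have hmd : mu = a := by linear_combination htr - hla
        have hda : d - a ≠ 0 := by rw [← hla, ← hmd]; exact hne'
        refine ⟨mkSL (b / (d - a)) (-1) 1 0 (by simp), D, rfl, rfl, rfl, rfl, ?_⟩
        apply sl_ext <;> simp only [sl_mul] <;> simp [mkSL, D, ← ha, ← hb, ← hc, ← hdd, hc0, hla, hmd]
        field_simp
        ring
    · refine ⟨mkSL ((lam - d) / (c * (lam - mu))) (mu - d) (1 / (lam - mu)) c (by field_simp; ring), D, rfl, rfl, rfl, rfl, ?_⟩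
      have e1 : a = lam + mu - d := by linear_combination -htr
      apply sl_ext <;> simp only [sl_mul] <;> simp [mkSL, D, ← ha, ← hb, ← hc, ← hdd]
      · field_simp
        rw [e1] at hd ⊢
        linear_combination -hd + hmu
      · rw [e1] at hd ⊢
        linear_combination -hd + hmu
      · field_simp; ring
      · ring
  obtain ⟨Q, D, h0, h1, h2, h3, h4⟩ := key
  refine ⟨Q⁻¹, ?_⟩
  have : Q⁻¹ * M * Q⁻¹⁻¹ = D := by rw [inv_inv, mul_assoc, h4]; group
  rw [this]
  exact ⟨h0, h1, h2, h3⟩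

end

section

/-- iteration step -/
def stepSL (f g : SL2C) : SL2C := f * g * f * g⁻¹ * f⁻¹

lemma step_entries (f g : SL2C) (lam : ℂ) (hl : lam ≠ 0) (h00 : f 0 0 = lam) (h11 : f 1 1 = lam⁻¹)
    (h01 : f 0 1 = 0) (h10 : f 1 0 = 0) :
    stepSL f g 0 0 = g 0 0 * g 1 1 * lam - g 0 1 * g 1 0 * lam⁻¹ ∧
    stepSL f g 0 1 = lam ^ 2 * (lam⁻¹ - lam) * g 0 0 * g 0 1 ∧
    stepSL f g 1 0 = lam⁻¹ ^ 2 * (lam - lam⁻¹) * g 1 1 * g 1 0 ∧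
    stepSL f g 1 1 = g 0 0 * g 1 1 * lam⁻¹ - g 0 1 * g 1 0 * lam := by
  unfold stepSL
  refine ⟨?_, ?_, ?_, ?_⟩ <;>
  · simp only [sl_mul, sl_inv00, sl_inv01, sl_inv10, sl_inv11, h00, h11, h01, h10]
    field_simp
    try ring

lemma crit_diag {Γ : Subgroup SL2C} (hΓ : DB Γ) (f g : SL2C) (hf : f ∈ Γ) (hg : g ∈ Γ)
    (lam : ℂ) (hl : lam ≠ 0) (h00 : f 0 0 = lam) (h11 : f 1 1 = lam⁻¹)
    (h01 : f 0 1 = 0) (h10 : f 1 0 = 0) (β ε η : ℂ) (hβ : β = (lam - lam⁻¹) ^ 2) (hβ0 : β ≠ 0)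
    (hη : η = β + 2)
    (hε : ε = -β * (g 0 1 * g 1 0) - 1 - β) (hε0 : ε ≠ 0) (h1 : ‖ε‖ + ‖η‖ < 1)
    (h2 : ‖ε‖ < ‖η‖ ∨ η = 0) : False := by
  obtain ⟨G, G0, GS⟩ : ∃ G : ℕ → SL2C, G 0 = g ∧ ∀ k, G (k + 1) = stepSL f (G k) :=
    ⟨fun k => Nat.rec g (fun _ x => stepSL f x) k, rfl, fun k => rfl⟩
  have hGΓ : ∀ k, G k ∈ Γ := by
    intro k
    induction k with
    | zero => rw [G0]; exact hg
    | succ k ih =>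
      rw [GS]; unfold stepSL
      exact Γ.mul_mem (Γ.mul_mem (Γ.mul_mem (Γ.mul_mem hf ih) hf) (Γ.inv_mem ih)) (Γ.inv_mem hf)
  have hE := fun k => step_entries f (G k) lam hl h00 h11 h01 h10
  have hdet := fun k => sl_det (G k)
  obtain ⟨e, he⟩ : ∃ e : ℕ → ℂ, ∀ k, e k = -β * (G k 0 1 * G k 1 0) - 1 - β := ⟨_, fun k => rfl⟩
  have he0 : e 0 = ε := by rw [hε, he, G0]
  have hll : lam * lam⁻¹ = 1 := mul_inv_cancel₀ hl
  have heS : ∀ k, e (k + 1) = e k * (e k + η) := by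
    intro k
    obtain ⟨E0, E1, E2, E3⟩ := hE k
    have hd := hdet k
    rw [he, he, GS]
    rw [E1, E2, hη, hβ]
    have had : G k 0 0 * G k 1 1 = 1 + G k 0 1 * G k 1 0 := by linear_combination hd
    have : lam ^ 2 * (lam⁻¹ - lam) * G k 0 0 * G k 0 1 * (lam⁻¹ ^ 2 * (lam - lam⁻¹) * G k 1 1 * G k 1 0)
      = - (lam - lam⁻¹) ^ 2 * (1 + G k 0 1 * G k 1 0) * (G k 0 1 * G k 1 0) := by
      rw [← had]
      have : lam ^ 2 * lam⁻¹ ^ 2 = 1 := by rw [← mul_pow, hll, one_pow]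
      linear_combination (-(lam - lam⁻¹) ^ 2 * G k 0 0 * G k 0 1 * G k 1 1 * G k 1 0) * this
    rw [this]
    ring
  set q := ‖ε‖ + ‖η‖ with hq
  have hq0 : 0 ≤ q := by positivity
  have hb : ∀ k, e k ≠ 0 ∧ ‖e k‖ ≤ ‖ε‖ * q ^ k := by
    intro k
    induction k with
    | zero => simp [he0, hε0]
    | succ k ih =>
      have hle : ‖e k‖ ≤ ‖ε‖ := ih.2.trans (mul_le_of_le_one_right (norm_nonneg _) (pow_le_one₀ hq0 h1.le))
      rw [heS]
      constructor
      · apply mul_ne_zero ih.1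
        rcases h2 with h2 | h2
        · intro h
          have : ‖e k‖ = ‖η‖ := by rw [eq_neg_of_add_eq_zero_left h, norm_neg]
          linarith
        · rw [h2, add_zero]; exact ih.1
      · rw [norm_mul, pow_succ, ← mul_assoc]
        apply mul_le_mul ih.2 _ (norm_nonneg _) (by positivity)
        exact (norm_add_le _ _).trans (by linarith)
  have hstrict : ∀ k, ‖e (k + 1)‖ < ‖e k‖ := by
    intro k
    have hle : ‖e k‖ ≤ ‖ε‖ := (hb k).2.trans (mul_le_of_le_one_right (norm_nonneg _) (pow_le_one₀ hq0 h1.le))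
    rw [heS, norm_mul]
    apply mul_lt_of_lt_one_right (norm_pos_iff.2 (hb k).1)
    exact (norm_add_le _ _).trans_lt (by linarith)
  have hanti : StrictAnti (fun k => ‖e k‖) := strictAnti_nat_of_succ_lt hstrict
  have hinj : Function.Injective G := by
    intro i j hij
    apply hanti.injective
    simp only [he, hij]
  have hεle : ∀ k, ‖e k‖ ≤ 1 := by
    intro k
    have : ‖e k‖ ≤ ‖e 0‖ := hanti.antitone (Nat.zero_le k)
    rw [he0] at this
    linarith [norm_nonneg η]
  -- recursion for off-diagonal entries
  have hβ1 : (lam - lam⁻¹) ≠ 0 := by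
    intro h; apply hβ0; rw [hβ, h]; simp
  have hbrec : ∀ k, G (k + 2) 0 1 = G (k + 1) 0 1 * (1 + lam ^ 2 * e k) := by
    intro k
    obtain ⟨E0, E1, E2, E3⟩ := hE k
    obtain ⟨F0, F1, F2, F3⟩ := hE (k + 1)
    rw [GS (k+1), F1, GS k, E0]
    have had : G k 0 0 * G k 1 1 = 1 + G k 0 1 * G k 1 0 := by linear_combination hdet k
    rw [had]
    rw [he, hβ]
    field_simp
    ring
  have hcrec : ∀ k, G (k + 2) 1 0 = G (k + 1) 1 0 * (1 + lam⁻¹ ^ 2 * e k) := by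
    intro k
    obtain ⟨E0, E1, E2, E3⟩ := hE k
    obtain ⟨F0, F1, F2, F3⟩ := hE (k + 1)
    rw [GS (k+1), F2, GS k, E3]
    have had : G k 0 0 * G k 1 1 = 1 + G k 0 1 * G k 1 0 := by linear_combination hdet k
    rw [had]
    rw [he, hβ]
    field_simp
    ring
  have hbound : ∀ (u : ℕ → ℂ) (m : ℂ), (∀ k, u (k + 1) = u k * (1 + m * e k)) →
      ∃ R : ℝ, ∀ k, ‖u k‖ ≤ R := by
    intro u m hu
    set M := ‖m‖ * ‖ε‖ with hM
    have hM0 : 0 ≤ M := by positivity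
    have hA : ∀ k, ‖u k‖ ≤ ‖u 0‖ * Real.exp (M * ∑ i ∈ Finset.range k, q ^ i) := by
      intro k
      induction k with
      | zero => simp
      | succ k ih =>
        rw [hu, norm_mul, Finset.sum_range_succ, mul_add, Real.exp_add, ← mul_assoc]
        apply mul_le_mul ih _ (norm_nonneg _) (by positivity)
        calc ‖1 + m * e k‖ ≤ 1 + ‖m‖ * ‖e k‖ := by
              refine (norm_add_le _ _).trans ?_; simp
          _ ≤ 1 + ‖m‖ * (‖ε‖ * q ^ k) := by gcongr; exact (hb k).2
          _ = M * q ^ k + 1 := by rw [hM]; ring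
          _ ≤ _ := Real.add_one_le_exp _
    refine ⟨‖u 0‖ * Real.exp (M * (1 - q)⁻¹), fun k => (hA k).trans ?_⟩
    have : ∑ i ∈ Finset.range k, q ^ i ≤ (1 - q)⁻¹ := by
      have hs := hasSum_geometric_of_lt_one hq0 h1
      rw [← hs.tsum_eq]
      exact hs.summable.sum_le_tsum _ (fun i _ => by positivity)
    gcongr
  obtain ⟨R1, hR1⟩ := hbound (fun k => G (k + 1) 0 1) (lam ^ 2) (fun k => hbrec k)
  obtain ⟨R2, hR2⟩ := hbound (fun k => G (k + 1) 1 0) (lam⁻¹ ^ 2) (fun k => hcrec k)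
  -- product bounded
  have hy : ∀ k, ‖G k 0 1 * G k 1 0‖ ≤ (2 + ‖β‖) / ‖β‖ := by
    intro k
    have hbp : 0 < ‖β‖ := norm_pos_iff.2 hβ0
    rw [le_div_iff₀ hbp]
    have : G k 0 1 * G k 1 0 * β = -(e k + 1 + β) := by rw [he]; ring
    rw [← norm_mul, this, norm_neg]
    calc ‖e k + 1 + β‖ ≤ ‖e k + 1‖ + ‖β‖ := norm_add_le _ _
      _ ≤ ‖e k‖ + 1 + ‖β‖ := by
        have := norm_add_le (e k) 1
        simp at this; linarith
      _ ≤ _ := by linarith [hεle k]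
  set Y := (2 + ‖β‖) / ‖β‖ with hY
  have hY0 : 0 ≤ Y := by positivity
  have hdiag : ∀ k (m m' : ℂ), ‖G k 0 0 * G k 1 1 * m - G k 0 1 * G k 1 0 * m'‖ ≤ (1 + Y) * ‖m‖ + Y * ‖m'‖ := by
    intro k m m'
    have had : G k 0 0 * G k 1 1 = 1 + G k 0 1 * G k 1 0 := by linear_combination hdet k
    rw [had]
    refine (norm_sub_le _ _).trans ?_
    rw [norm_mul, norm_mul _ m']
    gcongr
    · refine (norm_add_le _ _).trans ?_
      simp only [norm_one]
      have := hy k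
      linarith
    · exact hy k
  set R := |R1| + |R2| + ((1 + Y) * ‖lam‖ + Y * ‖lam⁻¹‖) + ((1 + Y) * ‖lam⁻¹‖ + Y * ‖lam‖) with hR
  have p1 : 0 ≤ (1 + Y) * ‖lam‖ + Y * ‖lam⁻¹‖ := by positivity
  have p2 : 0 ≤ (1 + Y) * ‖lam⁻¹‖ + Y * ‖lam‖ := by positivity
  have p3 := abs_nonneg R1
  have p4 := abs_nonneg R2
  have hfin := hΓ R
  have hinf : (Set.range (fun k => G (k + 1))).Infinite :=
    Set.infinite_range_of_injective (fun i j hij => Nat.succ_injective (hinj hij))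
  apply hinf
  apply hfin.subset
  rintro _ ⟨k, rfl⟩
  refine ⟨hGΓ _, ?_⟩
  obtain ⟨E0, E1, E2, E3⟩ := hE k
  intro i j
  fin_cases i <;> fin_cases j
  · change ‖G (k + 1) 0 0‖ ≤ R
    rw [GS, E0]; have := hdiag k lam lam⁻¹; linarith
  · change ‖G (k + 1) 0 1‖ ≤ R
    have := hR1 k; have := le_abs_self R1; linarith
  · change ‖G (k + 1) 1 0‖ ≤ R
    have := hR2 k; have := le_abs_self R2; linarith
  · change ‖G (k + 1) 1 1‖ ≤ R
    rw [GS, E3]; have := hdiag k lam⁻¹ lam; linarith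

lemma exists_eig (x : ℂ) : ∃ lam : ℂ, lam ≠ 0 ∧ lam + lam⁻¹ = x := by
  obtain ⟨z, hz⟩ := IsAlgClosed.exists_pow_nat_eq (x ^ 2 - 4) (n := 2) (by norm_num)
  have h0 : (x + z) / 2 ≠ 0 := by
    intro h
    have : (x + z) * (x - z) = 4 := by linear_combination -hz
    rw [show x + z = 0 by linear_combination 2 * h] at this
    norm_num at this
  refine ⟨(x + z) / 2, h0, ?_⟩
  have h0' : x + z ≠ 0 := by intro h; apply h0; rw [h]; simp
  field_simp
  linear_combination hz

/-- The criterion. -/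
lemma crit {Γ : Subgroup SL2C} (hΓ : DB Γ) (f g : SL2C) (hf : f ∈ Γ) (hg : g ∈ Γ)
    (β γ ε η : ℂ) (hβ : β = str f ^ 2 - 4) (hγ : γ = str (f * g * f⁻¹ * g⁻¹) - 2)
    (hβ0 : β ≠ 0) (hη : η = β + 2) (hε : ε = γ - 1 - β) (hε0 : ε ≠ 0) (h1 : ‖ε‖ + ‖η‖ < 1)
    (h2 : ‖ε‖ < ‖η‖ ∨ η = 0) : False := by
  obtain ⟨lam, hl, hx⟩ := exists_eig (str f)
  have hll : lam * lam⁻¹ = 1 := mul_inv_cancel₀ hl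
  have hβ' : β = (lam - lam⁻¹) ^ 2 := by rw [hβ, ← hx]; linear_combination 4 * hll
  have hne : lam ≠ lam⁻¹ := by intro h; apply hβ0; rw [hβ', sub_eq_zero.2 h]; simp
  obtain ⟨P, p00, p11, p01, p10⟩ := exists_diag f lam hl hx hne
  refine crit_diag (hΓ.cj P) (P * f * P⁻¹) (P * g * P⁻¹) (mem_cj hf) (mem_cj hg) lam hl p00 p11 p01 p10
    β ε η hβ' hβ0 hη ?_ hε0 h1 h2
  rw [hε, hγ, ← str_conj P]
  have : P * (f * g * f⁻¹ * g⁻¹) * P⁻¹ = (P * f * P⁻¹) * (P * g * P⁻¹) * (P * f * P⁻¹)⁻¹ * (P * g * P⁻¹)⁻¹ := by group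
  rw [this]
  set F := P * f * P⁻¹
  set H := P * g * P⁻¹
  have hd := sl_det H
  simp only [str, sl_mul, sl_inv00, sl_inv01, sl_inv10, sl_inv11, p00, p11, p01, p10, hβ']
  linear_combination 2 * hd + (2 * H 0 0 * H 1 1 - 2 * H 0 1 * H 1 0) * hll + (0) * hll

end

section

lemma nsq (z : ℂ) : ‖z‖ ^ 2 = z.re ^ 2 + z.im ^ 2 := by
  rw [← Complex.normSq_eq_norm_sq, Complex.normSq_apply]; ring

lemma cross_amgm (a1 a2 a3 b1 b2 b3 : ℂ) (μ : ℝ) (hμ : 0 < μ) :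
    ‖a1 * b1 + a2 * b2 + a3 * b3‖ ^ 2 +
      ‖(a1 ^ 2 + a2 ^ 2 + a3 ^ 2) * (b1 ^ 2 + b2 ^ 2 + b3 ^ 2) - (a1 * b1 + a2 * b2 + a3 * b3) ^ 2‖ ≤
    (‖a1‖ ^ 2 + ‖a2‖ ^ 2 + ‖a3‖ ^ 2) * (‖b1‖ ^ 2 + ‖b2‖ ^ 2 + ‖b3‖ ^ 2) +
      μ / 2 * ((‖a1‖ ^ 2 + ‖a2‖ ^ 2 + ‖a3‖ ^ 2) ^ 2 - ‖a1 ^ 2 + a2 ^ 2 + a3 ^ 2‖ ^ 2) +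
      1 / (2 * μ) * ((‖b1‖ ^ 2 + ‖b2‖ ^ 2 + ‖b3‖ ^ 2) ^ 2 - ‖b1 ^ 2 + b2 ^ 2 + b3 ^ 2‖ ^ 2) := by
  have h1 : ‖(a1 ^ 2 + a2 ^ 2 + a3 ^ 2) * (b1 ^ 2 + b2 ^ 2 + b3 ^ 2) - (a1 * b1 + a2 * b2 + a3 * b3) ^ 2‖
      ≤ ‖a1 * b2 - a2 * b1‖ ^ 2 + ‖a2 * b3 - a3 * b2‖ ^ 2 + ‖a3 * b1 - a1 * b3‖ ^ 2 := by
    have : (a1 ^ 2 + a2 ^ 2 + a3 ^ 2) * (b1 ^ 2 + b2 ^ 2 + b3 ^ 2) - (a1 * b1 + a2 * b2 + a3 * b3) ^ 2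
      = (a1 * b2 - a2 * b1) ^ 2 + (a2 * b3 - a3 * b2) ^ 2 + (a3 * b1 - a1 * b3) ^ 2 := by ring
    rw [this]
    refine (norm_add_le _ _).trans ?_
    have := norm_add_le ((a1 * b2 - a2 * b1) ^ 2) ((a2 * b3 - a3 * b2) ^ 2)
    simp only [norm_pow] at *
    linarith
  have hA : (‖a1‖ ^ 2 + ‖a2‖ ^ 2 + ‖a3‖ ^ 2) ^ 2 - ‖a1 ^ 2 + a2 ^ 2 + a3 ^ 2‖ ^ 2 =
      4 * ((a1.re * a2.im - a2.re * a1.im) ^ 2 + (a2.re * a3.im - a3.re * a2.im) ^ 2 +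
        (a3.re * a1.im - a1.re * a3.im) ^ 2) := by
    rw [nsq, nsq, nsq, nsq]
    simp only [pow_two, Complex.add_re, Complex.mul_re, Complex.add_im, Complex.mul_im]
    ring
  have hB : (‖b1‖ ^ 2 + ‖b2‖ ^ 2 + ‖b3‖ ^ 2) ^ 2 - ‖b1 ^ 2 + b2 ^ 2 + b3 ^ 2‖ ^ 2 =
      4 * ((b1.re * b2.im - b2.re * b1.im) ^ 2 + (b2.re * b3.im - b3.re * b2.im) ^ 2 +
        (b3.re * b1.im - b1.re * b3.im) ^ 2) := by
    rw [nsq, nsq, nsq, nsq]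
    simp only [pow_two, Complex.add_re, Complex.mul_re, Complex.add_im, Complex.mul_im]
    ring
  have hC : ‖a1 * b1 + a2 * b2 + a3 * b3‖ ^ 2 +
      (‖a1 * b2 - a2 * b1‖ ^ 2 + ‖a2 * b3 - a3 * b2‖ ^ 2 + ‖a3 * b1 - a1 * b3‖ ^ 2) =
      (‖a1‖ ^ 2 + ‖a2‖ ^ 2 + ‖a3‖ ^ 2) * (‖b1‖ ^ 2 + ‖b2‖ ^ 2 + ‖b3‖ ^ 2) -
      4 * ((a1.re * a2.im - a2.re * a1.im) * (b1.re * b2.im - b2.re * b1.im) +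
        (a2.re * a3.im - a3.re * a2.im) * (b2.re * b3.im - b3.re * b2.im) +
        (a3.re * a1.im - a1.re * a3.im) * (b3.re * b1.im - b1.re * b3.im)) := by
    simp only [nsq, Complex.add_re, Complex.mul_re, Complex.add_im, Complex.mul_im,
      Complex.sub_re, Complex.sub_im]
    ring
  rw [hA, hB]
  have key : ∀ u v : ℝ, -(4 * (u * v)) ≤ μ / 2 * (4 * u ^ 2) + 1 / (2 * μ) * (4 * v ^ 2) := by
    intro u v
    have : μ / 2 * (4 * u ^ 2) + 1 / (2 * μ) * (4 * v ^ 2) + 4 * (u * v) = 2 / μ * (μ * u + v) ^ 2 := by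
      field_simp; ring
    have : 0 ≤ 2 / μ * (μ * u + v) ^ 2 := by positivity
    linarith
  have k1 := key (a1.re * a2.im - a2.re * a1.im) (b1.re * b2.im - b2.re * b1.im)
  have k2 := key (a2.re * a3.im - a3.re * a2.im) (b2.re * b3.im - b3.re * b2.im)
  have k3 := key (a3.re * a1.im - a1.re * a3.im) (b3.re * b1.im - b1.re * b3.im)
  linarith

/-- squared Frobenius norm -/
def fsq (X : SL2C) : ℝ := ‖X 0 0‖ ^ 2 + ‖X 0 1‖ ^ 2 + ‖X 1 0‖ ^ 2 + ‖X 1 1‖ ^ 2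

lemma fnorm_sq (X : SL2C) : fnorm (X : Matrix (Fin 2) (Fin 2) ℂ) ^ 2 = fsq X := by
  unfold fnorm fsq
  have := Matrix.frobenius_norm_def (X : Matrix (Fin 2) (Fin 2) ℂ)
  have h2 : @norm _ Matrix.frobeniusSeminormedAddCommGroup.toNorm (X : Matrix (Fin 2) (Fin 2) ℂ) =
    (∑ i, ∑ j, ‖X i j‖ ^ (2 : ℝ)) ^ (1 / 2 : ℝ) := this
  rw [h2, ← Real.rpow_natCast, ← Real.rpow_mul (by positivity)]
  simp [Fin.sum_univ_two]
  ring

lemma region_traces (X Y : SL2C) (t x2 μ : ℝ) (hμ : 0 < μ) (hx : ‖str X‖ ^ 2 = x2)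
    (hX : fsq X ≤ 2 * t) (hY : fsq Y ≤ 2 * t) :
    ‖2 * str (X * Y) - str X * str Y‖ ^ 2 +
      ‖(str X ^ 2 - 4) * (str Y ^ 2 - 4) - (2 * str (X * Y) - str X * str Y) ^ 2‖ ≤
    (4 * t - x2) * (4 * t - ‖str Y‖ ^ 2) +
      μ / 2 * ((4 * t - x2) ^ 2 - ‖str X ^ 2 - 4‖ ^ 2) +
      1 / (2 * μ) * ((4 * t - ‖str Y‖ ^ 2) ^ 2 - ‖str Y ^ 2 - 4‖ ^ 2) := by
  have h := cross_amgm (X 0 0 - X 1 1) (X 0 1 + X 1 0) (Complex.I * (X 0 1 - X 1 0))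
    (Y 0 0 - Y 1 1) (Y 0 1 + Y 1 0) (Complex.I * (Y 0 1 - Y 1 0)) μ hμ
  have hn : ∀ Z : SL2C, ‖Z 0 0 - Z 1 1‖ ^ 2 + ‖Z 0 1 + Z 1 0‖ ^ 2 + ‖Complex.I * (Z 0 1 - Z 1 0)‖ ^ 2
      = 2 * fsq Z - ‖str Z‖ ^ 2 := by
    intro Z
    rw [norm_mul, Complex.norm_I, one_mul]
    simp only [nsq, fsq, str, Complex.add_re, Complex.add_im, Complex.sub_re, Complex.sub_im]
    ring
  have hb : ∀ Z : SL2C, (Z 0 0 - Z 1 1) ^ 2 + (Z 0 1 + Z 1 0) ^ 2 + (Complex.I * (Z 0 1 - Z 1 0)) ^ 2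
      = str Z ^ 2 - 4 := by
    intro Z
    have := sl_det Z
    simp only [str]
    linear_combination (Z 0 1 - Z 1 0) ^ 2 * Complex.I_sq - 4 * this
  have hc : (X 0 0 - X 1 1) * (Y 0 0 - Y 1 1) + (X 0 1 + X 1 0) * (Y 0 1 + Y 1 0) +
      (Complex.I * (X 0 1 - X 1 0)) * (Complex.I * (Y 0 1 - Y 1 0)) =
      2 * str (X * Y) - str X * str Y := by
    simp only [str, sl_mul]
    linear_combination (X 0 1 - X 1 0) * (Y 0 1 - Y 1 0) * Complex.I_sq
  rw [hn, hn, hb, hb, hc, hx] at h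
  refine h.trans ?_
  have u0 : 0 ≤ 2 * fsq X - x2 := by rw [← hx, ← hn]; positivity
  have v0 : 0 ≤ 2 * fsq Y - ‖str Y‖ ^ 2 := by rw [← hn]; positivity
  have u1 : 2 * fsq X - x2 ≤ 4 * t - x2 := by linarith
  have v1 : 2 * fsq Y - ‖str Y‖ ^ 2 ≤ 4 * t - ‖str Y‖ ^ 2 := by linarith
  gcongr
  linarith

/-- cosh of the translation part -/
def Cw (w : ℂ) : ℝ := (‖w‖ + ‖w‖⁻¹) / 2
/-- cosine of the twist part -/
def cw (w : ℂ) : ℝ := w.re / ‖w‖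

lemma Cw_ge {w : ℂ} (hw : w ≠ 0) : 1 ≤ Cw w := by
  have : 0 < ‖w‖ := norm_pos_iff.2 hw
  unfold Cw
  have h : (‖w‖ + ‖w‖⁻¹) / 2 - 1 = (‖w‖ - 1) ^ 2 / (2 * ‖w‖) := by field_simp; ring
  have : 0 ≤ (‖w‖ - 1) ^ 2 / (2 * ‖w‖) := by positivity
  linarith

lemma cw_abs {w : ℂ} (hw : w ≠ 0) : |cw w| ≤ 1 := by
  unfold cw
  rw [abs_div, abs_norm]
  exact div_le_one_of_le₀ (Complex.abs_re_le_norm w) (norm_nonneg _)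

lemma cw_le {w : ℂ} (hw : w ≠ 0) : cw w ≤ 1 := (abs_le.1 (cw_abs hw)).2
lemma cw_ge {w : ℂ} (hw : w ≠ 0) : -1 ≤ cw w := (abs_le.1 (cw_abs hw)).1

lemma Cw_mul {w e : ℂ} (he : ‖e‖ = 1) : Cw (w * e) = Cw w := by
  unfold Cw; rw [norm_mul, he, mul_one]

lemma re_add_inv {w : ℂ} (hw : w ≠ 0) : (w + w⁻¹).re = 2 * Cw w * cw w := by
  have : ‖w‖ ≠ 0 := norm_ne_zero_iff.2 hw
  simp only [Complex.add_re, Complex.inv_re, Complex.normSq_eq_norm_sq, Cw, cw]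
  field_simp

lemma nsq_add_inv {w : ℂ} (hw : w ≠ 0) (r : ℝ) :
    ‖w + w⁻¹ - r‖ ^ 2 = 4 * (Cw w ^ 2 + cw w ^ 2 - 1) - 4 * r * Cw w * cw w + r ^ 2 := by
  have h0 : ‖w‖ ≠ 0 := norm_ne_zero_iff.2 hw
  have h1 : ‖w‖ ^ 2 = w.re ^ 2 + w.im ^ 2 := nsq w
  have e1 : ‖w + w⁻¹ - r‖ ^ 2 = ‖w‖ ^ 2 + (‖w‖ ^ 2)⁻¹ + 2 * (w.re ^ 2 - w.im ^ 2) / ‖w‖ ^ 2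
      - 2 * r * (w + w⁻¹).re + r ^ 2 := by
    rw [nsq]
    simp only [Complex.add_re, Complex.add_im, Complex.sub_re, Complex.sub_im, Complex.inv_re, Complex.inv_im,
      Complex.normSq_eq_norm_sq, Complex.ofReal_re, Complex.ofReal_im]
    have h2 : w.im ^ 2 = ‖w‖ ^ 2 - w.re ^ 2 := by linarith
    field_simp
    ring_nf
    have h4 : w.im ^ 4 = (‖w‖ ^ 2 - w.re ^ 2) ^ 2 := by rw [← h2]; ring
    simp only [h2]
    ring
  rw [e1, re_add_inv hw]
  have h2 : w.im ^ 2 = ‖w‖ ^ 2 - w.re ^ 2 := by linarith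
  rw [h2]
  unfold Cw cw
  field_simp
  ring

/-- region inequality in the diagonal frame -/
lemma region (P A B : SL2C) (t x2 μ k2 : ℝ) (hμ : 0 < μ) (lam : ℂ) (hl : lam ≠ 0)
    (h00 : A 0 0 = lam) (h11 : A 1 1 = lam⁻¹) (h01 : A 0 1 = 0) (h10 : A 1 0 = 0)
    (hx : str A ^ 2 = x2) (hx0 : 0 ≤ x2) (hx4 : x2 ≤ 4) (hk0 : 0 < k2) (hk1 : k2 ≤ 1)
    (hk : B 0 0 * B 1 1 = k2)
    (hX : fsq (P * A * P⁻¹) ≤ 2 * t) (hY : fsq (P * B * P⁻¹) ≤ 2 * t)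
    (C c : ℝ) (hC : C = Cw (B 0 0 / B 1 1)) (hc : c = cw (B 0 0 / B 1 1)) :
    (4 - x2) * (2 * k2 * (C - c) + 4 * (1 - k2)) ≤
      (4 * t - x2) * (4 * t - 2 * k2 * (C + c)) + μ / 2 * (16 * (t - 1) * (t + 1 - x2 / 2)) +
        1 / (2 * μ) * (16 * ((1 - k2) * (t ^ 2 - 1) - k2 * (C - t) * (t - c))) := by
  have hk2 : (k2 : ℂ) ≠ 0 := by exact_mod_cast hk0.ne'
  have ha : B 0 0 ≠ 0 := by intro h; rw [h] at hk; simp at hk; exact hk2 hk.symm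
  have hd : B 1 1 ≠ 0 := by intro h; rw [h] at hk; simp at hk; exact hk2 hk.symm
  set w := B 0 0 / B 1 1 with hw
  have hw0 : w ≠ 0 := div_ne_zero ha hd
  have hr0 : ‖w‖ ≠ 0 := norm_ne_zero_iff.2 hw0
  have hsum : (B 0 0 + B 1 1) ^ 2 = k2 * (w + w⁻¹ - ((-2 : ℝ) : ℂ)) := by
    rw [hw, ← hk]; push_cast; field_simp; ring
  have hdif : (B 0 0 - B 1 1) ^ 2 = k2 * (w + w⁻¹ - ((2 : ℝ) : ℂ)) := by
    rw [hw, ← hk]; push_cast; field_simp; ring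
  have hCge : 1 ≤ C := hC ▸ Cw_ge hw0
  have hcle : c ≤ 1 := hc ▸ cw_le hw0
  have hcge : -1 ≤ c := hc ▸ cw_ge hw0
  have nsum : ‖B 0 0 + B 1 1‖ ^ 2 = 2 * k2 * (C + c) := by
    rw [← norm_pow, hsum, norm_mul]
    have : ‖w + w⁻¹ - ((-2 : ℝ) : ℂ)‖ = 2 * (C + c) := by
      rw [← abs_of_nonneg (norm_nonneg _), ← abs_of_nonneg (show 0 ≤ 2 * (C + c) by linarith), ← sq_eq_sq_iff_abs_eq_abs,
        nsq_add_inv hw0, ← hC, ← hc]; ring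
    rw [this, Complex.norm_real, Real.norm_of_nonneg hk0.le]; ring
  have ndif : ‖B 0 0 - B 1 1‖ ^ 2 = 2 * k2 * (C - c) := by
    rw [← norm_pow, hdif, norm_mul]
    have : ‖w + w⁻¹ - ((2 : ℝ) : ℂ)‖ = 2 * (C - c) := by
      rw [← abs_of_nonneg (norm_nonneg _), ← abs_of_nonneg (show 0 ≤ 2 * (C - c) by linarith), ← sq_eq_sq_iff_abs_eq_abs,
        nsq_add_inv hw0, ← hC, ← hc]; ring
    rw [this, Complex.norm_real, Real.norm_of_nonneg hk0.le]; ring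
  have nsum4 : ‖(B 0 0 + B 1 1) ^ 2 - 4‖ ^ 2 = (2 * k2 * (C + c)) ^ 2 - 8 * (k2 * (2 * C * c + 2)) + 16 := by
    have hre : ((B 0 0 + B 1 1) ^ 2).re = k2 * (2 * C * c + 2) := by
      rw [hsum, Complex.re_ofReal_mul, Complex.sub_re, re_add_inv hw0, ← hC, ← hc]; simp
    have hnn : ∀ z : ℂ, ‖z - 4‖ ^ 2 = ‖z‖ ^ 2 - 8 * z.re + 16 := by
      intro z
      rw [nsq, nsq]; simp; ring
    rw [hnn, hre, norm_pow, nsum]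
  have hll : lam * lam⁻¹ = 1 := mul_inv_cancel₀ hl
  have h := region_traces (P * A * P⁻¹) (P * B * P⁻¹) t x2 μ hμ (by
    rw [str_conj, ← norm_pow, hx, Complex.norm_real, Real.norm_of_nonneg hx0]) hX hY
  have e : P * A * P⁻¹ * (P * B * P⁻¹) = P * (A * B) * P⁻¹ := by group
  rw [e, str_conj, str_conj, str_conj] at h
  have s1 : 2 * str (A * B) - str A * str B = (lam - lam⁻¹) * (B 0 0 - B 1 1) := by
    simp only [str, sl_mul, h00, h11, h01, h10]; ring
  have s2 : str A ^ 2 - 4 = (lam - lam⁻¹) ^ 2 := by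
    simp only [str, h00, h11]; linear_combination 4 * hll
  have s2' : (lam - lam⁻¹) ^ 2 = ((x2 - 4 : ℝ) : ℂ) := by rw [← s2, hx]; push_cast; ring
  have s3 : (str A ^ 2 - 4) * (str B ^ 2 - 4) - (2 * str (A * B) - str A * str B) ^ 2 =
      ((x2 - 4 : ℝ) : ℂ) * ((4 * (k2 - 1) : ℝ) : ℂ) := by
    rw [s1, s2, mul_pow, s2']; simp only [str]; push_cast
    linear_combination (4 * ((x2 : ℂ) - 4)) * hk
  rw [s3, s1, norm_mul, mul_pow, ← norm_pow, s2', s2, s2', ← Complex.ofReal_mul, Complex.norm_real, Complex.norm_real, ndif] at h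
  have e1 : str B = B 0 0 + B 1 1 := rfl
  rw [e1, nsum, nsum4, Real.norm_eq_abs, Real.norm_eq_abs, abs_of_nonpos (by linarith : x2 - 4 ≤ 0),
    abs_of_nonneg (by nlinarith : 0 ≤ (x2 - 4) * (4 * (k2 - 1)))] at h
  refine le_trans (le_of_eq ?_) (h.trans (le_of_eq ?_))
  · ring
  · field_simp; ring

end

section

lemma quad_le {a b e x x0 x1 M : ℝ} (ha : 0 ≤ a) (h0 : x0 ≤ x) (h1 : x ≤ x1)
    (m0 : a * x0 ^ 2 + b * x0 + e ≤ M) (m1 : a * x1 ^ 2 + b * x1 + e ≤ M) :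
    a * x ^ 2 + b * x + e ≤ M := by
  rcases eq_or_lt_of_le (h0.trans h1) with h | h
  · have : x = x0 := le_antisymm (by linarith) h0
    rw [this]; exact m0
  · have k1 := mul_le_mul_of_nonneg_left m0 (by linarith : 0 ≤ x1 - x)
    have k2 := mul_le_mul_of_nonneg_left m1 (by linarith : 0 ≤ x - x0)
    have k3 : 0 ≤ a * ((x - x0) * (x1 - x)) * (x1 - x0) := by
      have := mul_nonneg (by linarith : 0 ≤ x - x0) (by linarith : 0 ≤ x1 - x)
      have := mul_nonneg ha this
      exact mul_nonneg this (by linarith)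
    have k4 : (x1 - x0) * (a * x ^ 2 + b * x + e) ≤ (x1 - x0) * M := by linarith
    exact le_of_mul_le_mul_left k4 (by linarith)

/-- squared modulus of `w + w⁻¹ - r` -/
def Nf (r C c : ℝ) : ℝ := 4 * (C ^ 2 + c ^ 2 - 1) - 4 * r * C * c + r ^ 2

lemma Nf_nonneg {w : ℂ} (hw : w ≠ 0) (r : ℝ) : 0 ≤ Nf r (Cw w) (cw w) := by
  unfold Nf; rw [← nsq_add_inv hw]; positivity

lemma norm_add_inv {w : ℂ} (hw : w ≠ 0) (r : ℝ) : ‖w + w⁻¹ - r‖ ^ 2 = Nf r (Cw w) (cw w) :=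
  nsq_add_inv hw r

lemma Nf_box {r C c r0 r1 C0 C1 c0 c1 M : ℝ} (hr0 : r0 ≤ r) (hr1 : r ≤ r1) (hC0 : C0 ≤ C) (hC1 : C ≤ C1)
    (hc0 : c0 ≤ c) (hc1 : c ≤ c1)
    (h1 : Nf r0 C0 c0 ≤ M) (h2 : Nf r0 C0 c1 ≤ M) (h3 : Nf r0 C1 c0 ≤ M) (h4 : Nf r0 C1 c1 ≤ M)
    (h5 : Nf r1 C0 c0 ≤ M) (h6 : Nf r1 C0 c1 ≤ M) (h7 : Nf r1 C1 c0 ≤ M) (h8 : Nf r1 C1 c1 ≤ M) :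
    Nf r C c ≤ M := by
  have s1 : ∀ r' c', Nf r' C0 c' ≤ M → Nf r' C1 c' ≤ M → Nf r' C c' ≤ M := by
    intro r' c' a b
    have := quad_le (a := 4) (b := -4 * r' * c') (e := 4 * c' ^ 2 - 4 + r' ^ 2) (M := M) (by norm_num) hC0 hC1
      (by unfold Nf at a; linarith) (by unfold Nf at b; linarith)
    unfold Nf; linarith
  have s2 : ∀ r', Nf r' C c0 ≤ M → Nf r' C c1 ≤ M → Nf r' C c ≤ M := by
    intro r' a b
    have := quad_le (a := 4) (b := -4 * r' * C) (e := 4 * C ^ 2 - 4 + r' ^ 2) (M := M) (by norm_num) hc0 hc1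
      (by unfold Nf at a; linarith) (by unfold Nf at b; linarith)
    unfold Nf; linarith
  have a0 := s2 r0 (s1 _ _ h1 h3) (s1 _ _ h2 h4)
  have a1 := s2 r1 (s1 _ _ h5 h7) (s1 _ _ h6 h8)
  have := quad_le (a := 1) (b := -4 * C * c) (e := 4 * (C ^ 2 + c ^ 2 - 1)) (M := M) (by norm_num) hr0 hr1
      (by unfold Nf at a0; linarith) (by unfold Nf at a1; linarith)
  unfold Nf; linarith

lemma cw_neg (w : ℂ) : cw (-w) = - cw w := by unfold cw; simp [neg_div]
lemma Cw_neg (w : ℂ) : Cw (-w) = Cw w := by unfold Cw; simp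

lemma exists_rot {w : ℂ} (hw : w ≠ 0) (m : ℕ) (hm : 1 ≤ m) :
    ∃ j : ℤ, Real.cos (π / m) ≤ cw (w * Complex.exp (2 * π / m * Complex.I) ^ j) := by
  have hm0 : (0 : ℝ) < m := by exact_mod_cast hm
  refine ⟨-round (Complex.arg w * m / (2 * π)), ?_⟩
  set k := round (Complex.arg w * m / (2 * π)) with hk
  have h1 : w * Complex.exp (2 * π / m * Complex.I) ^ (-k) =
      ‖w‖ * Complex.exp (((Complex.arg w - 2 * π / m * k : ℝ) : ℂ) * Complex.I) := by
    rw [← Complex.exp_int_mul]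
    conv_lhs => rw [← Complex.norm_mul_exp_arg_mul_I w]
    rw [mul_assoc, ← Complex.exp_add]
    congr 2
    push_cast; ring
  have hn : ‖w‖ ≠ 0 := norm_ne_zero_iff.2 hw
  have h2 : cw (w * Complex.exp (2 * π / m * Complex.I) ^ (-k)) = Real.cos (Complex.arg w - 2 * π / m * k) := by
    rw [h1]
    unfold cw
    rw [Complex.re_ofReal_mul, Complex.exp_ofReal_mul_I_re, norm_mul, Complex.norm_exp_ofReal_mul_I]
    simp [hn]
  rw [h2]
  have h3 := abs_sub_round (Complex.arg w * m / (2 * π))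
  rw [← hk] at h3
  rw [← Real.cos_abs (Complex.arg w - _)]
  have h4 : Complex.arg w - 2 * π / m * k = (2 * π / m) * (Complex.arg w * m / (2 * π) - k) := by
    field_simp
  have hp := Real.pi_pos
  have h5 : |Complex.arg w - 2 * π / m * k| ≤ π / m := by
    rw [h4, abs_mul, abs_of_pos (by positivity)]
    calc 2 * π / m * |Complex.arg w * m / (2 * π) - k| ≤ 2 * π / m * (1 / 2) := by gcongr
      _ = π / m := by ring
  refine Real.cos_le_cos_of_nonneg_of_le_pi (abs_nonneg _) ?_ h5
  rw [div_le_iff₀ hm0]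
  have : (1 : ℝ) ≤ m := by exact_mod_cast hm
  nlinarith

/-- Data of a pair in the diagonal frame. -/
structure Frame (Γ : Subgroup SL2C) (A B : SL2C) (lam : ℂ) (k2 : ℝ) : Prop where
  db : DB Γ
  hA : A ∈ Γ
  hB : B ∈ Γ
  hl : lam ≠ 0
  h00 : A 0 0 = lam
  h11 : A 1 1 = lam⁻¹
  h01 : A 0 1 = 0
  h10 : A 1 0 = 0
  k0 : 0 < k2
  hk : B 0 0 * B 1 1 = k2

/-- ratio of diagonal entries -/
def rw' (B : SL2C) : ℂ := B 0 0 / B 1 1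

lemma diag_zpow {A : SL2C} {lam : ℂ} (hl : lam ≠ 0) (h00 : A 0 0 = lam) (h11 : A 1 1 = lam⁻¹)
    (h01 : A 0 1 = 0) (h10 : A 1 0 = 0) (j : ℤ) :
    (A ^ j) 0 0 = lam ^ j ∧ (A ^ j) 1 1 = lam ^ (-j) ∧ (A ^ j) 0 1 = 0 ∧ (A ^ j) 1 0 = 0 := by
  induction j using Int.induction_on with
  | zero => simp
  | succ n ih =>
    obtain ⟨a, b, c, d⟩ := ih
    rw [_root_.zpow_add_one]
    refine ⟨?_, ?_, ?_, ?_⟩ <;> simp only [sl_mul, a, b, c, d, h00, h11, h01, h10]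
    · rw [zpow_add_one₀ hl]; ring
    · rw [neg_add, zpow_add₀ hl]; simp
    · ring
    · ring
  | pred n ih =>
    obtain ⟨a, b, c, d⟩ := ih
    rw [_root_.zpow_sub_one]
    refine ⟨?_, ?_, ?_, ?_⟩ <;> simp only [sl_mul, a, b, c, d, sl_inv00, sl_inv01, sl_inv10, sl_inv11, h00, h11, h01, h10]
    · rw [zpow_sub_one₀ hl]; ring
    · rw [neg_sub', sub_neg_eq_add, zpow_add_one₀ hl]; ring
    · ring
    · ring

namespace Frame
variable {Γ : Subgroup SL2C} {A B : SL2C} {lam : ℂ} {k2 : ℝ}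

lemma a0 (F : Frame Γ A B lam k2) : B 0 0 ≠ 0 := by
  intro h; have := F.hk; rw [h] at this; simp at this; exact F.k0.ne' (by exact_mod_cast this.symm)
lemma d0 (F : Frame Γ A B lam k2) : B 1 1 ≠ 0 := by
  intro h; have := F.hk; rw [h] at this; simp at this; exact F.k0.ne' (by exact_mod_cast this.symm)
lemma w0 (F : Frame Γ A B lam k2) : rw' B ≠ 0 := div_ne_zero F.a0 F.d0
lemma hbc (F : Frame Γ A B lam k2) : B 0 1 * B 1 0 = k2 - 1 := by
  have := sl_det B; rw [F.hk] at this; linear_combination -this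

lemma rot (F : Frame Γ A B lam k2) (j : ℤ) : Frame Γ A (B * A ^ j) lam k2 := by
  obtain ⟨a, b, c, d⟩ := diag_zpow F.hl F.h00 F.h11 F.h01 F.h10 j
  refine ⟨F.db, F.hA, Γ.mul_mem F.hB (Γ.zpow_mem F.hA j), F.hl, F.h00, F.h11, F.h01, F.h10, F.k0, ?_⟩
  simp only [sl_mul, a, b, c, d, ← F.hk]
  have : lam ^ j * lam ^ (-j) = 1 := by rw [← zpow_add₀ F.hl]; simp
  linear_combination B 0 0 * B 1 1 * this

lemma rot_w (F : Frame Γ A B lam k2) (j : ℤ) : rw' (B * A ^ j) = rw' B * (lam ^ 2) ^ j := by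
  obtain ⟨a, b, c, d⟩ := diag_zpow F.hl F.h00 F.h11 F.h01 F.h10 j
  unfold rw'
  simp only [sl_mul, a, b, c, d]
  have := F.d0
  have hz : lam ^ j ≠ 0 := zpow_ne_zero _ F.hl
  have e : (lam ^ 2) ^ j = lam ^ j * lam ^ j := by rw [pow_two, mul_zpow]
  rw [e, _root_.zpow_neg]
  generalize lam ^ j = z at *
  generalize B 1 1 = y at *
  rw [mul_zero, mul_zero, add_zero, zero_add]
  field_simp

end Frame

/-- Membership up to sign. -/
def PM (G : Subgroup SL2C) (X : SL2C) : Prop := X ∈ G ∨ -X ∈ G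

lemma PM.rot {A B : SL2C} (j : ℤ) (h : PM (Subgroup.closure {A, (B * A ^ j) * A * (B * A ^ j)⁻¹}) (B * A ^ j)) :
    PM (Subgroup.closure {A, B * A * B⁻¹}) B := by
  have e : (B * A ^ j) * A * (B * A ^ j)⁻¹ = B * A * B⁻¹ := by group
  rw [e] at h
  have hA : A ∈ Subgroup.closure {A, B * A * B⁻¹} := Subgroup.subset_closure (by simp)
  have hA' := Subgroup.zpow_mem _ hA (-j)
  rcases h with h | h
  · left
    have := Subgroup.mul_mem _ h hA'
    simpa using this
  · right
    have := Subgroup.mul_mem _ h hA'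
    simpa using this

end

section

/-- difference of the two sides of the region inequality -/
def Rg (t x2 μ k2 C c : ℝ) : ℝ :=
  (4 - x2) * (2 * k2 * (C - c) + 4 * (1 - k2)) -
      ((4 * t - x2) * (4 * t - 2 * k2 * (C + c)) + μ / 2 * (16 * (t - 1) * (t + 1 - x2 / 2)) +
        1 / (2 * μ) * (16 * ((1 - k2) * (t ^ 2 - 1) - k2 * (C - t) * (t - c))))

lemma Cbound {t x2 μ k2 C c K c1 : ℝ} (h : Rg t x2 μ k2 C c ≤ 0) (hμ : 0 < μ) (ht : 1 ≤ t) (hx4 : x2 ≤ 4)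
    (hk0 : 0 < k2) (hc : -1 ≤ c) (hc' : c ≤ 1) (hc1 : c ≤ c1)
    (e0 : 0 < Rg t x2 μ k2 K (-1)) (e1 : 0 < Rg t x2 μ k2 K c1) : C ≤ K := by
  by_contra hK
  push Not at hK
  have h1 : Rg t x2 μ k2 K c ≤ 0 := by
    refine le_trans ?_ h
    have : Rg t x2 μ k2 C c - Rg t x2 μ k2 K c =
        (C - K) * (2 * k2 * (4 - x2) + 2 * k2 * (4 * t - x2) + 8 / μ * (k2 * (t - c))) := by
      unfold Rg; field_simp; ring
    have h2 : 0 ≤ (C - K) * (2 * k2 * (4 - x2) + 2 * k2 * (4 * t - x2) + 8 / μ * (k2 * (t - c))) := by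
      have a1 : 0 ≤ k2 * (4 - x2) := mul_nonneg hk0.le (by linarith)
      have a2 : 0 ≤ k2 * (4 * t - x2) := mul_nonneg hk0.le (by linarith)
      have a3 : 0 ≤ 8 / μ * (k2 * (t - c)) := mul_nonneg (by positivity) (mul_nonneg hk0.le (by linarith))
      exact mul_nonneg (by linarith) (by linarith)
    linarith
  obtain ⟨u, v, huv⟩ : ∃ u v : ℝ, ∀ c, Rg t x2 μ k2 K c = u + v * c :=
    ⟨Rg t x2 μ k2 K 0, Rg t x2 μ k2 K 1 - Rg t x2 μ k2 K 0, by intro c; unfold Rg; field_simp; ring⟩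
  rw [huv] at e0 e1 h1
  rcases le_total 0 v with hv | hv
  · nlinarith
  · nlinarith

lemma Frame.Rg {Γ : Subgroup SL2C} {A B : SL2C} {lam : ℂ} {k2 : ℝ} (F : Frame Γ A B lam k2) (hk1 : k2 ≤ 1)
    (P : SL2C) (t x2 μ : ℝ) (hμ : 0 < μ) (hx : str A ^ 2 = x2) (hx0 : 0 ≤ x2) (hx4 : x2 ≤ 4)
    (hX : fsq (P * A * P⁻¹) ≤ 2 * t) (hY : fsq (P * B * P⁻¹) ≤ 2 * t) :
    Rg t x2 μ k2 (Cw (rw' B)) (cw (rw' B)) ≤ 0 := by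
  have := region P A B t x2 μ k2 hμ lam F.hl F.h00 F.h11 F.h01 F.h10 hx hx0 hx4 F.k0 hk1 F.hk hX hY _ _ rfl rfl
  unfold _root_.Rg rw'
  linarith

lemma q5 : (2.236 : ℝ) < √5 ∧ √5 < (2.2361 : ℝ) ∧ √5 ^ 2 = 5 := by
  refine ⟨?_, ?_, Real.sq_sqrt (by norm_num)⟩
  · rw [Real.lt_sqrt (by norm_num)]; norm_num
  · rw [Real.sqrt_lt' (by norm_num)]; norm_num

section
variable {Γ : Subgroup SL2C} {A B P : SL2C} {lam : ℂ} {k2 : ℝ}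

lemma Frame.bound (F : Frame Γ A B lam k2) (hk1 : k2 ≤ 1) {t x2 : ℝ} (ht : 1 ≤ t)
    (hx : str A ^ 2 = x2) (hx0 : 0 ≤ x2) (hx4 : x2 ≤ 4)
    (hX : fsq (P * A * P⁻¹) ≤ 2 * t) (hY : fsq (P * B * P⁻¹) ≤ 2 * t) (μ c1 K : ℝ) (hμ : 0 < μ)
    (hc : cw (rw' B) ≤ c1)
    (e0 : 0 < _root_.Rg t x2 μ k2 K (-1)) (e1 : 0 < _root_.Rg t x2 μ k2 K c1) : Cw (rw' B) ≤ K :=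
  Cbound (F.Rg hk1 P t x2 μ hμ hx hx0 hx4 hX hY) hμ ht hx4 F.k0 (cw_ge F.w0) (cw_le F.w0) hc e0 e1

lemma cb_3aII (F : Frame Γ A B lam (2 / 3)) (hx : str A ^ 2 = (1 : ℝ))
    (hX : fsq (P * A * P⁻¹) ≤ 2 * 1.0168) (hY : fsq (P * B * P⁻¹) ≤ 2 * 1.0168) :
    (cw (rw' B) ≤ 0.6 → Cw (rw' B) ≤ 1.053) ∧ (cw (rw' B) ≤ 0.8 → Cw (rw' B) ≤ 1.0612) ∧
      Cw (rw' B) ≤ 1.0694 := by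
  refine ⟨fun h => ?_, fun h => ?_, ?_⟩
  · exact F.bound (by norm_num) (by norm_num) hx (by norm_num) (by norm_num) hX hY 0.23 _ _ (by norm_num) h
      (by unfold Rg; norm_num) (by unfold Rg; norm_num)
  · exact F.bound (by norm_num) (by norm_num) hx (by norm_num) (by norm_num) hX hY 0.44 _ _ (by norm_num) h
      (by unfold Rg; norm_num) (by unfold Rg; norm_num)
  · exact F.bound (by norm_num) (by norm_num) hx (by norm_num) (by norm_num) hX hY 0.64 _ _ (by norm_num) (cw_le F.w0)
      (by unfold Rg; norm_num) (by unfold Rg; norm_num)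

lemma cb_3aI (F : Frame Γ A B lam (1 / 3)) (hx : str A ^ 2 = (1 : ℝ))
    (hX : fsq (P * A * P⁻¹) ≤ 2 * 1.0168) (hY : fsq (P * B * P⁻¹) ≤ 2 * 1.0168) :
      Cw (rw' B) ≤ 1.189 :=
  F.bound (by norm_num) (by norm_num) hx (by norm_num) (by norm_num) hX hY 0.92 _ _ (by norm_num) (cw_le F.w0)
      (by unfold Rg; norm_num) (by unfold Rg; norm_num)

lemma cb_4 (F : Frame Γ A B lam (1 / 2)) (hx : str A ^ 2 = (2 : ℝ))
    (hX : fsq (P * A * P⁻¹) ≤ 2 * 1.0603) (hY : fsq (P * B * P⁻¹) ≤ 2 * 1.0603) :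
    (cw (rw' B) ≤ 0.8 → Cw (rw' B) ≤ 1.388) ∧ (cw (rw' B) ≤ 0.9 → Cw (rw' B) ≤ 1.422) ∧
      Cw (rw' B) ≤ 1.456 := by
  refine ⟨fun h => ?_, fun h => ?_, ?_⟩
  · exact F.bound (by norm_num) (by norm_num) hx (by norm_num) (by norm_num) hX hY 0.62 _ _ (by norm_num) h
      (by unfold Rg; norm_num) (by unfold Rg; norm_num)
  · exact F.bound (by norm_num) (by norm_num) hx (by norm_num) (by norm_num) hX hY 0.75 _ _ (by norm_num) h
      (by unfold Rg; norm_num) (by unfold Rg; norm_num)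
  · exact F.bound (by norm_num) (by norm_num) hx (by norm_num) (by norm_num) hX hY 0.89 _ _ (by norm_num) (cw_le F.w0)
      (by unfold Rg; norm_num) (by unfold Rg; norm_num)

lemma cb_3b1 (F : Frame Γ A B lam ((3 + √5) / 6)) (hx : str A ^ 2 = (1 : ℝ))
    (hX : fsq (P * A * P⁻¹) ≤ 2 * 1.0168) (hY : fsq (P * B * P⁻¹) ≤ 2 * 1.0168) :
      Cw (rw' B) ≤ 1.0384 := by
  obtain ⟨h1, h2, h3⟩ := q5
  refine F.bound (by linarith) (by norm_num) hx (by norm_num) (by norm_num) hX hY 0.4 _ _ (by norm_num) (cw_le F.w0)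
      ?_ ?_ <;> unfold Rg <;> nlinarith

lemma cb_3b2 (F : Frame Γ A B lam ((3 - √5) / 6)) (hx : str A ^ 2 = (1 : ℝ))
    (hX : fsq (P * A * P⁻¹) ≤ 2 * 1.0168) (hY : fsq (P * B * P⁻¹) ≤ 2 * 1.0168) :
      Cw (rw' B) ≤ 1.565 := by
  obtain ⟨h1, h2, h3⟩ := q5
  refine F.bound (by linarith) (by norm_num) hx (by norm_num) (by norm_num) hX hY 1.06 _ _ (by norm_num) (cw_le F.w0)
      ?_ ?_ <;> unfold Rg <;> nlinarith

lemma cb_5a (F : Frame Γ A B lam ((5 + √5) / 10)) (hx : str A ^ 2 = ((3 + √5) / 2 : ℝ))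
    (hX : fsq (P * A * P⁻¹) ≤ 2 * 1.0584) (hY : fsq (P * B * P⁻¹) ≤ 2 * 1.0584) :
      Cw (rw' B) ≤ 1.268 := by
  obtain ⟨h1, h2, h3⟩ := q5
  refine F.bound (by linarith) (by norm_num) hx (by linarith) (by linarith) hX hY 0.75 _ _ (by norm_num) (cw_le F.w0)
      ?_ ?_ <;> unfold Rg <;> nlinarith

lemma cb_5b (F : Frame Γ A B lam ((5 - √5) / 10)) (hx : str A ^ 2 = ((3 + √5) / 2 : ℝ))
    (hX : fsq (P * A * P⁻¹) ≤ 2 * 1.0584) (hY : fsq (P * B * P⁻¹) ≤ 2 * 1.0584) :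
    (cw (rw' B) ≤ 0.8091 → Cw (rw' B) ≤ 2.01) ∧ Cw (rw' B) ≤ 2.168 := by
  obtain ⟨h1, h2, h3⟩ := q5
  refine ⟨fun h => ?_, ?_⟩
  · refine F.bound (by linarith) (by norm_num) hx (by linarith) (by linarith) hX hY 1.26 _ _ (by norm_num) h
      ?_ ?_ <;> unfold Rg <;> nlinarith
  · refine F.bound (by linarith) (by norm_num) hx (by linarith) (by linarith) hX hY 1.26 _ _ (by norm_num) (cw_le F.w0)
      ?_ ?_ <;> unfold Rg <;> nlinarith
end

end

section

/-- one-step iterate in the diagonal frame -/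
lemma crit_diag_it {Γ : Subgroup SL2C} (hΓ : DB Γ) (f g : SL2C) (hf : f ∈ Γ) (hg : g ∈ Γ)
    (lam : ℂ) (hl : lam ≠ 0) (h00 : f 0 0 = lam) (h11 : f 1 1 = lam⁻¹)
    (h01 : f 0 1 = 0) (h10 : f 1 0 = 0) (β ε η : ℂ) (hβ : β = (lam - lam⁻¹) ^ 2) (hβ0 : β ≠ 0)
    (hη : η = β + 2)
    (hε : ε = -β * (g 0 1 * g 1 0) - 1 - β) (hε0 : ε * (ε + η) ≠ 0) (h1 : ‖ε * (ε + η)‖ + ‖η‖ < 1)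
    (h2 : ‖ε * (ε + η)‖ < ‖η‖ ∨ η = 0) : False := by
  refine crit_diag hΓ f (g * f * g⁻¹) hf (Γ.mul_mem (Γ.mul_mem hg hf) (Γ.inv_mem hg)) lam hl h00 h11 h01 h10
    β (ε * (ε + η)) η hβ hβ0 hη ?_ hε0 h1 h2
  have hd := sl_det g
  simp only [sl_mul, sl_inv00, sl_inv01, sl_inv10, sl_inv11, h00, h11, h01, h10]
  rw [hε, hη]
  generalize lam⁻¹ = mu at *
  generalize g 0 0 = a at *
  generalize g 0 1 = b at *
  generalize g 1 0 = c at *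
  generalize g 1 1 = d at *
  have hX : a * d = 1 + b * c := by linear_combination hd
  linear_combination (b * c * β * (a * d)) * hβ - β ^ 2 * (b * c) * hX

lemma crit_it {Γ : Subgroup SL2C} (hΓ : DB Γ) (f g : SL2C) (hf : f ∈ Γ) (hg : g ∈ Γ)
    (β γ ε η : ℂ) (hβ : β = str f ^ 2 - 4) (hγ : γ = str (f * g * f⁻¹ * g⁻¹) - 2)
    (hβ0 : β ≠ 0) (hη : η = β + 2) (hε : ε = γ - 1 - β) (hε0 : ε * (ε + η) ≠ 0)
    (h1 : ‖ε * (ε + η)‖ + ‖η‖ < 1)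
    (h2 : ‖ε * (ε + η)‖ < ‖η‖ ∨ η = 0) : False := by
  obtain ⟨lam, hl, hx⟩ := exists_eig (str f)
  have hll : lam * lam⁻¹ = 1 := mul_inv_cancel₀ hl
  have hβ' : β = (lam - lam⁻¹) ^ 2 := by rw [hβ, ← hx]; linear_combination 4 * hll
  have hne : lam ≠ lam⁻¹ := by intro h; apply hβ0; rw [hβ', sub_eq_zero.2 h]; simp
  obtain ⟨P, p00, p11, p01, p10⟩ := exists_diag f lam hl hx hne
  refine crit_diag_it (hΓ.cj P) (P * f * P⁻¹) (P * g * P⁻¹) (mem_cj hf) (mem_cj hg) lam hl p00 p11 p01 p10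
    β ε η hβ' hβ0 hη ?_ hε0 h1 h2
  rw [hε, hγ, ← str_conj P]
  have : P * (f * g * f⁻¹ * g⁻¹) * P⁻¹ = (P * f * P⁻¹) * (P * g * P⁻¹) * (P * f * P⁻¹)⁻¹ * (P * g * P⁻¹)⁻¹ := by group
  rw [this]
  set F := P * f * P⁻¹
  set H := P * g * P⁻¹
  have hd := sl_det H
  simp only [str, sl_mul, sl_inv00, sl_inv01, sl_inv10, sl_inv11, p00, p11, p01, p10]
  rw [hβ']
  generalize lam⁻¹ = mu at *
  generalize H 0 0 = a at *
  generalize H 0 1 = b at *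
  generalize H 1 0 = c at *
  generalize H 1 1 = d at *
  linear_combination 2 * lam * mu * hd + 2 * hll

namespace Frame
variable {Γ : Subgroup SL2C} {A B : SL2C} {lam : ℂ} {k2 : ℝ}

lemma it (F : Frame Γ A B lam k2) (g : SL2C) (hg : g ∈ Γ) (β η m M1 M2 : ℝ)
    (hβ : (lam - lam⁻¹) ^ 2 = β) (hβ0 : β ≠ 0) (hη : η = β + 2) (hη0 : 0 < η) (E1 E2 : ℂ)
    (hE1 : E1 = -β * (g 0 1 * g 1 0) - 1 - β) (hE2 : E2 = E1 + η) (h1 : E1 ≠ 0) (h2 : E2 ≠ 0)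
    (hm1 : m ≤ η) (hm2 : m ≤ 1 - η) (hm0 : 0 ≤ m)
    (b1 : ‖E1‖ ^ 2 ≤ M1) (b2 : ‖E2‖ ^ 2 ≤ M2) (hM : M1 * M2 < m ^ 2) : False := by
  have hb : ‖E1 * E2‖ < m := by
    have : ‖E1 * E2‖ ^ 2 < m ^ 2 := by
      rw [norm_mul, mul_pow]
      refine lt_of_le_of_lt ?_ hM
      have := sq_nonneg ‖E1‖
      have := sq_nonneg ‖E2‖
      gcongr
      linarith
    exact lt_of_pow_lt_pow_left₀ 2 hm0 this
  have hn : ‖(η : ℂ)‖ = η := by rw [Complex.norm_real, Real.norm_of_nonneg hη0.le]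
  refine crit_diag_it F.db A g F.hA hg lam F.hl F.h00 F.h11 F.h01 F.h10 (β : ℂ) E1 (η : ℂ) hβ.symm
    (by exact_mod_cast hβ0) (by rw [hη]; push_cast; ring) hE1 ?_ ?_ (Or.inl ?_)
  · rw [← hE2]; exact mul_ne_zero h1 h2
  · rw [← hE2, hn]; linarith
  · rw [← hE2, hn]; linarith
end Frame

end

section

lemma norm_zm2 {w : ℂ} (hw : w ≠ 0) : ‖w + w⁻¹ - 2‖ = 2 * (Cw w - cw w) := by
  have h := norm_add_inv hw 2
  have : 0 ≤ Cw w - cw w := by linarith [Cw_ge hw, cw_le hw]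
  have h2 : ‖w + w⁻¹ - 2‖ ^ 2 = (2 * (Cw w - cw w)) ^ 2 := by
    push_cast at h; rw [h]; unfold Nf; ring
  exact (sq_eq_sq₀ (norm_nonneg _) (by linarith)).1 h2

lemma norm_zp2 {w : ℂ} (hw : w ≠ 0) : ‖w + w⁻¹ + 2‖ = 2 * (Cw w + cw w) := by
  have h := norm_add_inv hw (-2)
  have : 0 ≤ Cw w + cw w := by linarith [Cw_ge hw, cw_ge hw]
  have h2 : ‖w + w⁻¹ + 2‖ ^ 2 = (2 * (Cw w + cw w)) ^ 2 := by
    push_cast at h; rw [sub_neg_eq_add] at h; rw [h]; unfold Nf; ring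
  exact (sq_eq_sq₀ (norm_nonneg _) (by linarith)).1 h2

lemma id4 (a b c d l m i : ℂ) (ha : a * d = 1 / 2) (hb : b * c = -1 / 2) (hm : l * m = 1) (hl : l ^ 2 = i) (hi : i ^ 2 = -1)
   (p q : ℂ) (hp : p = ((a+d)^2-1) * (b * m * d + a * l * b) - (a + d) * l * b )
   (hq : q = ((a+d)^2-1) * (c * l * a + d * m * c) - (a + d) * m * c ) :
   2 * (p * q) + 1 = -i * ((a-d)^3 * (a+d) * (a^2+d^2)) := by
  subst hp hq
  grind

lemma B3_eq (B g : SL2C) : (B * B * B * g) 0 0 = ((B 0 0 + B 1 1) ^ 2 - 1) * (B * g) 0 0 - (B 0 0 + B 1 1) * g 0 0 ∧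
   (B * B * B * g) 0 1 = ((B 0 0 + B 1 1) ^ 2 - 1) * (B * g) 0 1 - (B 0 0 + B 1 1) * g 0 1 ∧
   (B * B * B * g) 1 0 = ((B 0 0 + B 1 1) ^ 2 - 1) * (B * g) 1 0 - (B 0 0 + B 1 1) * g 1 0 ∧
   (B * B * B * g) 1 1 = ((B 0 0 + B 1 1) ^ 2 - 1) * (B * g) 1 1 - (B 0 0 + B 1 1) * g 1 1 := by
  have := sl_det B
  simp only [sl_mul]
  grind

lemma pm_of_eq {G : Subgroup SL2C} {X W : SL2C} (hW : W ∈ G) (s : ℂ) (hs : s ^ 2 = 1)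
    (h00 : X 0 0 = s * W 0 0) (h01 : X 0 1 = s * W 0 1) (h10 : X 1 0 = s * W 1 0)
    (h11 : X 1 1 = s * W 1 1) : PM G X := by
  rcases (mul_self_eq_one_iff (a := s)).1 (by rw [← pow_two]; exact hs) with h | h
  · left
    have : X = W := sl_ext (by rw [h00, h, one_mul]) (by rw [h01, h, one_mul]) (by rw [h10, h, one_mul]) (by rw [h11, h, one_mul])
    rw [this]; exact hW
  · right
    have : -X = W := by
      apply sl_ext <;> simp only [Matrix.SpecialLinearGroup.coe_neg, Matrix.neg_apply, h00, h01, h10, h11, h] <;> ring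
    rw [this]; exact hW

namespace Frame
variable {Γ : Subgroup SL2C} {A B : SL2C} {lam : ℂ} {k2 : ℝ}

lemma mA (_ : Frame Γ A B lam k2) : A ∈ Subgroup.closure {A, B * A * B⁻¹} := Subgroup.subset_closure (by simp)
lemma mA' (_ : Frame Γ A B lam k2) : B * A * B⁻¹ ∈ Subgroup.closure {A, B * A * B⁻¹} := Subgroup.subset_closure (by simp)

lemma w_eq_one (F : Frame Γ A B lam k2) (h : rw' B = 1) : B 0 0 = B 1 1 := by
  unfold rw' at h
  rwa [div_eq_one_iff_eq F.d0] at h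

lemma case4 (F : Frame Γ A B lam (1 / 2)) (hlam : lam ^ 2 = Complex.I)
    (hwin : (0.7071 ≤ cw (rw' B) ∧ Cw (rw' B) ≤ 1.388) ∨ (0.8 ≤ cw (rw' B) ∧ Cw (rw' B) ≤ 1.422) ∨
      (0.9 ≤ cw (rw' B) ∧ Cw (rw' B) ≤ 1.456)) :
    PM (Subgroup.closure {A, B * A * B⁻¹}) B := by
  have hI := Complex.I_sq
  have hlm : lam * lam⁻¹ = 1 := mul_inv_cancel₀ F.hl
  have hk := F.hk
  have hbc := F.hbc
  push_cast at hk hbc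
  have w0 := F.w0
  have hC := Cw_ge w0
  have hc := cw_le w0
  set w := rw' B with hw
  by_cases h1 : w = 1
  · have had := F.w_eq_one h1
    rw [← had] at hk
    refine pm_of_eq (W := A * (B * A * B⁻¹) * A⁻¹) (Subgroup.mul_mem _ (Subgroup.mul_mem _ F.mA F.mA') (Subgroup.inv_mem _ F.mA))
      (B 0 0 * (lam + lam⁻¹)) ?_ ?_ ?_ ?_ ?_ <;>
    (try simp only [sl_mul, sl_inv00, sl_inv01, sl_inv10, sl_inv11, F.h00, F.h11, F.h01, F.h10, ← had]) <;>
    generalize B 0 0 = a at * <;> generalize B 0 1 = b at * <;> generalize B 1 0 = c at * <;>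
    generalize lam⁻¹ = m at * <;> generalize Complex.I = i at * <;> clear had hw h1 w0 hC hc hwin F <;> grind
  exfalso
  set C := Cw w
  set c := cw w
  have hcpos : 0.7 ≤ c := by rcases hwin with h | h | h <;> linarith [h.1]
  have hβ : (lam - lam⁻¹) ^ 2 = -2 := by
    generalize lam⁻¹ = m at *; generalize Complex.I = i at *; clear hw h1 w0 hC hc hwin F hk hbc; grind
  set g := B * B * B * (A * B) with hg
  have hgm : g ∈ Γ := Γ.mul_mem (Γ.mul_mem (Γ.mul_mem F.hB F.hB) F.hB) (Γ.mul_mem F.hA F.hB)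
  have hX : 2 * (g 0 1 * g 1 0) + 1 = -Complex.I * ((B 0 0 - B 1 1) ^ 3 * (B 0 0 + B 1 1) * (B 0 0 ^ 2 + B 1 1 ^ 2)) := by
    obtain ⟨-, e1, e2, -⟩ := B3_eq B (A * B)
    refine id4 (B 0 0) (B 0 1) (B 1 0) (B 1 1) lam lam⁻¹ Complex.I hk (by rw [hbc]; ring) hlm hlam hI _ _ ?_ ?_
    · rw [hg, e1]; simp only [sl_mul, F.h00, F.h11, F.h01, F.h10]; ring
    · rw [hg, e2]; simp only [sl_mul, F.h00, F.h11, F.h01, F.h10]; ring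
  have hX2 : (B 0 0 - B 1 1) ^ 3 * (B 0 0 + B 1 1) * (B 0 0 ^ 2 + B 1 1 ^ 2) =
      1 / 8 * ((w + w⁻¹ - 2) * (w - w⁻¹) * (w + w⁻¹)) := by
    have a0 := F.a0
    have d0 := F.d0
    have e : (w + w⁻¹ - 2) * (w - w⁻¹) * (w + w⁻¹) = (B 0 0 - B 1 1) ^ 3 * (B 0 0 + B 1 1) * (B 0 0 ^ 2 + B 1 1 ^ 2)
       / (B 0 0 * B 1 1) ^ 3 := by
      rw [hw]; unfold rw'
      generalize B 0 0 = a at *; generalize B 1 1 = d at *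
      field_simp
      ring
    rw [e, hk]; ring
  set ε := 2 * (g 0 1 * g 1 0) + 1 with hε
  rw [hX2] at hX
  have n1 := norm_zm2 w0
  have n2 := norm_zp2 w0
  have n0 : ‖w + w⁻¹‖ ^ 2 = 4 * (C ^ 2 + c ^ 2 - 1) := by
    have := norm_add_inv w0 0
    simp only [Complex.ofReal_zero, sub_zero] at this
    rw [this]; unfold Nf; ring
  have nu : ‖w - w⁻¹‖ ^ 2 = 4 * ((C - c) * (C + c)) := by
    have e : (w - w⁻¹) ^ 2 = (w + w⁻¹ - 2) * (w + w⁻¹ + 2) := by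
      have := mul_inv_cancel₀ w0; linear_combination -4 * this
    rw [← norm_pow, e, norm_mul, n1, n2]; ring
  have nε : ‖ε‖ ^ 2 = (C - c) ^ 2 * (C ^ 2 * (C ^ 2 - 1) + c ^ 2 * (1 - c ^ 2)) := by
    rw [hX]
    simp only [norm_mul, mul_pow, norm_neg, Complex.norm_I, n1, n0, nu]
    norm_num
    ring
  have hlt : ‖ε‖ < 1 := by
    have hq : c ^ 2 * (1 - c ^ 2) ≤ 1 / 4 := by nlinarith [sq_nonneg (c ^ 2 - 1 / 2)]
    have key : ∀ K c0 : ℝ, c0 ≤ c → C ≤ K → (K - c0) ^ 2 * (K ^ 2 * (K ^ 2 - 1) + 1 / 4) < 1 → ‖ε‖ ^ 2 < 1 := by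
      intro K c0 k1 k2 k3
      refine lt_of_le_of_lt ?_ k3
      rw [nε]
      have : 0 ≤ C - c := by linarith
      have : C ^ 2 ≤ K ^ 2 := by gcongr
      have : 1 ≤ C ^ 2 := by nlinarith
      have h5 : 0 ≤ c ^ 2 * (1 - c ^ 2) := mul_nonneg (sq_nonneg _) (by nlinarith)
      gcongr
    have : ‖ε‖ ^ 2 < 1 := by
      rcases hwin with h | h | h
      · exact key _ _ h.1 h.2 (by norm_num)
      · exact key _ _ h.1 h.2 (by norm_num)
      · exact key _ _ h.1 h.2 (by norm_num)
    nlinarith [norm_nonneg ε]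
  have hne : ε ≠ 0 := by
    intro h0
    rw [h0] at hX
    have hz : (w + w⁻¹ - 2) * (w - w⁻¹) * (w + w⁻¹) = 0 := by
      have := hX.symm
      simpa using this
    rcases mul_eq_zero.1 hz with hz | hz
    · rcases mul_eq_zero.1 hz with hz | hz
      · apply h1
        have : (w - 1) ^ 2 = 0 := by
          have := mul_inv_cancel₀ w0; linear_combination w * hz - this
        have := pow_eq_zero_iff (two_ne_zero) |>.1 this
        linear_combination this
      · rw [hz] at nu
        simp at nu
        rcases nu with h | h
        · have hz2 : w + w⁻¹ - 2 = 0 := by rw [← norm_eq_zero, n1]; change 2 * (C - c) = 0; linarith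
          apply h1
          have h3 : (w - 1) ^ 2 = 0 := by
            have := mul_inv_cancel₀ w0; linear_combination w * hz2 - this
          have := pow_eq_zero_iff (two_ne_zero) |>.1 h3
          linear_combination this
        · linarith
    · rw [hz] at n0; simp at n0; nlinarith
  refine crit_diag F.db A g F.hA hgm lam F.hl F.h00 F.h11 F.h01 F.h10 (-2) ε 0 hβ.symm (by norm_num)
    (by norm_num) ?_ hne (by simpa using hlt) (Or.inr rfl)
  rw [hε]; ring
end Frame

end

section

lemma pm_of_scalar {G : Subgroup SL2C} {X W : SL2C} (hW : W ∈ G)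
    (h01 : X 0 1 * W 0 0 = X 0 0 * W 0 1) (h10 : X 1 0 * W 1 1 = X 1 1 * W 1 0)
    (h11 : X 0 0 * W 1 1 - X 0 1 * W 1 0 = X 1 1 * W 0 0 - X 1 0 * W 0 1) : PM G X := by
  set s := X 0 0 * W 1 1 - X 0 1 * W 1 0 with hs
  have hX := sl_det X
  have hWd := sl_det W
  have hs2 : s ^ 2 = 1 := by
    have : s ^ 2 = s * (X 1 1 * W 0 0 - X 1 0 * W 0 1) := by rw [← h11]; ring
    rw [this, hs]
    clear h11 hs this
    generalize X 0 0 = a at *; generalize X 0 1 = b at *; generalize X 1 0 = c at *; generalize X 1 1 = d at *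
    generalize W 0 0 = a' at *; generalize W 0 1 = b' at *; generalize W 1 0 = c' at *; generalize W 1 1 = d' at *
    grind
  refine pm_of_eq hW s hs2 ?_ ?_ ?_ ?_
  · linear_combination -(X 0 0) * hWd + W 0 0 * hs.symm + W 1 0 * h01
  · linear_combination -(X 0 1) * hWd + W 0 1 * hs.symm + W 1 1 * h01
  · rw [h11]; linear_combination -(X 1 0) * hWd + W 0 0 * h10
  · rw [h11]; linear_combination -(X 1 1) * hWd + W 0 1 * h10

/-- real and imaginary constraints: `w+w⁻¹ = r` real with `r<0` is impossible in the right half plane -/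
lemma zeta_re {w : ℂ} (hw : w ≠ 0) {r : ℝ} (h : w + w⁻¹ - r = 0) : r = 2 * Cw w * cw w := by
  rw [← re_add_inv hw, sub_eq_zero.1 h, Complex.ofReal_re]

lemma norm_lin {w : ℂ} (hw : w ≠ 0) (κ r : ℝ) : ‖(κ : ℂ) * (w + w⁻¹ - r)‖ ^ 2 = κ ^ 2 * Nf r (Cw w) (cw w) := by
  rw [norm_mul, mul_pow, norm_add_inv hw, Complex.norm_real, Real.norm_eq_abs, sq_abs]

lemma norm_lin_le {w : ℂ} (hw : w ≠ 0) (κ r : ℝ) {K M : ℝ} (hK : κ ^ 2 ≤ K) (hM : Nf r (Cw w) (cw w) ≤ M) :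
    ‖(κ : ℂ) * (w + w⁻¹ - r)‖ ^ 2 ≤ K * M := by
  rw [norm_lin hw]
  have := Nf_nonneg hw r
  have := sq_nonneg κ
  gcongr
  linarith

namespace Frame
variable {Γ : Subgroup SL2C} {A B : SL2C} {lam : ℂ} {k2 : ℝ}

lemma b01 (F : Frame Γ A B lam k2) : B 0 0 = rw' B * B 1 1 := by
  unfold rw'
  have := F.d0
  generalize B 1 1 = y at *
  field_simp

lemma s2 (F : Frame Γ A B lam k2) : (B 0 0 + B 1 1) ^ 2 = k2 * (rw' B + (rw' B)⁻¹ + 2) := by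
  have a0 := F.a0
  have d0 := F.d0
  rw [← F.hk]; unfold rw'
  generalize B 0 0 = a at *; generalize B 1 1 = d at *
  field_simp; ring

lemma beta5 (F : Frame Γ A B lam k2) (hx : str A ^ 2 = ((3 + √5) / 2 : ℝ)) :
    (lam - lam⁻¹) ^ 2 = (((√5 - 5) / 2 : ℝ) : ℂ) := by
  have hlm : lam * lam⁻¹ = 1 := mul_inv_cancel₀ F.hl
  simp only [str, F.h00, F.h11] at hx
  push_cast at hx ⊢
  linear_combination hx - 4 * hlm

lemma case5a (F : Frame Γ A B lam ((5 + √5) / 10)) (hx : str A ^ 2 = ((3 + √5) / 2 : ℝ))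
    (hc : 0.809 ≤ cw (rw' B)) (hC : Cw (rw' B) ≤ 1.268) :
    PM (Subgroup.closure {A, B * A * B⁻¹}) B := by
  obtain ⟨q1, q2, q3⟩ := q5
  have q3' : (√5 : ℂ) ^ 2 = 5 := by exact_mod_cast q3
  have hlm : lam * lam⁻¹ = 1 := mul_inv_cancel₀ F.hl
  have hk := F.hk
  have hbc := F.hbc
  have hs := F.s2
  have hβ := F.beta5 hx
  have w0 := F.w0
  have hC1 := Cw_ge w0
  have hc1 := cw_le w0
  have hb := F.b01
  by_cases h1 : rw' B + (rw' B)⁻¹ - ((1 + √5) / 2 : ℝ) = 0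
  · have hw : rw' B * (rw' B)⁻¹ = 1 := mul_inv_cancel₀ w0
    have hxx : (lam + lam⁻¹) ^ 2 = (rw' B + (rw' B)⁻¹) ^ 2 := by
      simp only [str, F.h00, F.h11] at hx
      rw [hx, sub_eq_zero.1 h1]
      push_cast
      linear_combination (- 1 / 4 : ℂ) * q3'
    have hcase : (rw' B ^ 2 - lam ^ 2) * (rw' B ^ 2 - lam⁻¹ ^ 2) = 0 := by
      generalize rw' B = w at *; generalize w⁻¹ = v at *; generalize lam⁻¹ = m at *
      clear hk hbc hs hb F h1 hβ hx hc hC w0 hC1 hc1 q3'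
      grind
    rw [sub_eq_zero] at h1
    push_cast at h1 hk hbc
    have hA := F.mA
    have hA' := F.mA'
    rcases mul_eq_zero.1 hcase with hc | hc
    · refine pm_of_scalar (W := A * (B * A * B⁻¹) * A⁻¹) (Subgroup.mul_mem _ (Subgroup.mul_mem _ hA hA') (Subgroup.inv_mem _ hA)) ?_ ?_ ?_ <;>
      (simp only [sl_mul, sl_inv00, sl_inv01, sl_inv10, sl_inv11, F.h00, F.h11, F.h01, F.h10]) <;>
      clear F hs hβ hx hC w0 hC1 hc1 q1 q2 q3 hxx hcase hA hA' <;>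
      generalize rw' B = w at * <;> generalize w⁻¹ = v at * <;> generalize lam⁻¹ = m at * <;>
      generalize (√5 : ℂ) = q at * <;> generalize B 0 0 = a at * <;> generalize B 0 1 = b at * <;>
      generalize B 1 0 = c at * <;> generalize B 1 1 = d at * <;> subst hb
      · have h2 : d ^ 2 = (5 + q) / 10 * v := by grind
        grind
      · grind
      · grind
    · refine pm_of_scalar (W := A⁻¹ * (B * A * B⁻¹)⁻¹ * A) (Subgroup.mul_mem _ (Subgroup.mul_mem _ (Subgroup.inv_mem _ hA) (Subgroup.inv_mem _ hA')) hA) ?_ ?_ ?_ <;>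
      (simp only [sl_mul, sl_inv00, sl_inv01, sl_inv10, sl_inv11, F.h00, F.h11, F.h01, F.h10]) <;>
      clear F hs hβ hx hC w0 hC1 hc1 q1 q2 q3 hxx hcase hA hA' <;>
      generalize rw' B = w at * <;> generalize w⁻¹ = v at * <;> generalize lam⁻¹ = m at * <;>
      generalize (√5 : ℂ) = q at * <;> generalize B 0 0 = a at * <;> generalize B 0 1 = b at * <;>
      generalize B 1 0 = c at * <;> generalize B 1 1 = d at * <;> subst hb
      · grind
      · grind
      · grind
  exfalso
  have hg1 : (B * B) 0 1 * (B * B) 1 0 = ((((5 + √5) / 10 : ℝ) : ℂ) - 1) * ((((5 + √5) / 10 : ℝ) : ℂ) * (rw' B + (rw' B)⁻¹ + 2)) := by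
    rw [← hs, ← hbc]; simp only [sl_mul]; ring
  have κ2 : ((√5 - 5) / 10) ^ 2 ≤ 0.0764 := by nlinarith
  have κ0 : (((√5 - 5) / 10 : ℝ) : ℂ) ≠ 0 := by
    rw [Complex.ofReal_ne_zero]; intro h; linarith
  refine F.it (B * B) (Γ.mul_mem F.hB F.hB) ((√5 - 5) / 2) ((√5 - 1) / 2) 0.3819 (0.0764 * 10) (0.0764 * 1.1) hβ
    (by intro h; linarith) (by ring) (by linarith)
    ((((√5 - 5) / 10 : ℝ) : ℂ) * (rw' B + (rw' B)⁻¹ - ((1 - √5) / 2 : ℝ)))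
    ((((√5 - 5) / 10 : ℝ) : ℂ) * (rw' B + (rw' B)⁻¹ - ((1 + √5) / 2 : ℝ))) ?_ ?_ ?_ ?_ (by linarith) (by linarith) (by norm_num)
    (norm_lin_le w0 _ _ κ2 ?_) (norm_lin_le w0 _ _ κ2 ?_) (by norm_num)
  · rw [hg1]
    push_cast
    generalize rw' B + (rw' B)⁻¹ = z
    generalize (√5 : ℂ) = q at *
    clear hbc hs hβ hx hb hg1 κ0
    grind
  · push_cast
    generalize rw' B + (rw' B)⁻¹ = z
    generalize (√5 : ℂ) = q at *
    clear hbc hs hβ hx hb hg1 κ0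
    grind
  · refine mul_ne_zero κ0 fun h => ?_
    have := zeta_re w0 h
    have : 0 ≤ Cw (rw' B) * cw (rw' B) := by apply mul_nonneg <;> linarith
    linarith
  · exact mul_ne_zero κ0 h1
  · refine Nf_box (r0 := -0.6181) (r1 := -0.618) (C0 := 1) (C1 := 1.268) (c0 := 0.809) (c1 := 1) (by linarith) (by linarith) hC1 hC hc hc1 ?_ ?_ ?_ ?_ ?_ ?_ ?_ ?_ <;> norm_num [Nf]
  · refine Nf_box (r0 := 1.618) (r1 := 1.6181) (C0 := 1) (C1 := 1.268) (c0 := 0.809) (c1 := 1) (by linarith) (by linarith) hC1 hC hc hc1 ?_ ?_ ?_ ?_ ?_ ?_ ?_ ?_ <;> norm_num [Nf]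
end Frame

end

section

lemma id5b (a b c d l m q w v μ n : ℂ) (hb : a = w * d) (hk : a*d = (5-q)/10) (hbc : b*c=(5-q)/10-1) (hw : w*v=1)
    (hlm : l*m=1) (hq : q^2=5) (hμ : μ^2=l^2) (hμn : μ*n=1) (hs : μ+n=(1+q)/2) (g01 g10 Z: ℂ)
    (h1 : g01 = a*(a*m*b+b*l*d)+b*(c*m*b+d*l*d)) (h2 : g10 = c*(a*m*a+b*l*c)+d*(c*m*a+d*l*c)) (hZ : Z = w*n+v*μ) :
    -((q-5)/2)*(g01*g10)-1-((q-5)/2) = -((5-q)/10)^2*((Z-2)*(Z-(q-1)/2)) := by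
  subst hb
  have hm : m = n^2 * l := by
    linear_combination (-(μ*n) - 1) * m * hμn + n^2 * l * hlm + m * n ^ 2 * hμ
  have hd : d^2 = (5-q)/10*v := by linear_combination (-d^2) * hw + v * hk
  have e1 : g01 = b * (((w^2*m + w*l)*d^2)+((5-q)/10-1)*m+l*d^2) := by linear_combination h1 + b * m * hbc
  have e2 : g10 = c * (((w^2*m + w*m)*d^2)+((5-q)/10-1)*l+l*d^2) := by linear_combination h2 + c * l * hbc
  have e3 : ((w^2*m + w*l)*d^2)+((5-q)/10-1)*m+l*d^2 = l*n*((5-q)/10*(Z+μ)+((5-q)/10-1)*n) := by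
    rw [hd, hm, hZ]
    linear_combination (5-q)/10 * (w * n^2 * l + l) * hw - (5-q)/10 * (l * v + l) * hμn
  have e4 : ((w^2*m + w*m)*d^2)+((5-q)/10-1)*l+l*d^2 = l*n*((5-q)/10*(Z+n)+((5-q)/10-1)*μ) := by
    rw [hd, hm, hZ]
    linear_combination (5-q)/10 * (w * n^2 * l + n^2 * l) * hw - ((5-q)/10 * l * v + ((5-q)/10-1) * l) * hμn
  have e5 : l*n*(l*n) = 1 := by linear_combination -n^2 * hμ + (μ * n + 1) * hμn
  have e6 : g01*g10 = ((5-q)/10-1) * (((5-q)/10*(Z+μ)+((5-q)/10-1)*n)*((5-q)/10*(Z+n)+((5-q)/10-1)*μ)) := by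
    rw [e1, e2, e3, e4, ← hbc]
    linear_combination (b * c * (((5-q)/10*(Z+μ)+(b*c)*n)*((5-q)/10*(Z+n)+(b*c)*μ))) * e5
  have e8 : ∀ k : ℂ, (k*(Z+μ)+(k-1)*n)*(k*(Z+n)+(k-1)*μ) = k^2*Z^2+k*Z*(2*k-1)*((1+q)/2)+(k^2+(k-1)^2)+k*(k-1)*(((1+q)/2)^2-2) := by
    intro k
    rw [← hs]
    linear_combination (k^2+(k-1)^2-2*k*(k-1)) * hμn
  rw [e6, e8]
  clear e1 e2 e3 e4 e5 e6 h1 h2 hm hd hw hk hbc hZ hlm hμ e8 hs hμn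
  grind

lemma lem5 {r C c : ℝ} (hr : 1.618 ≤ r) (hr' : r ≤ 1.6181) (hC : 1 ≤ C) (hC' : C ≤ 1.596) (hc : 0.9563 ≤ c) (hc' : c ≤ 1) :
    0.0764 * Nf r C c ^ 2 + 2 * 0.3819 * Nf r C c < 4 * 0.3819 * (2 * C * c - r) ^ 2 := by
  have key : ∀ C0 C1 M : ℝ, 1 ≤ C0 → C0 ≤ C → C ≤ C1 → 
     Nf 1.618 C0 0.9563 ≤ M ∧ Nf 1.618 C0 1 ≤ M ∧ Nf 1.618 C1 0.9563 ≤ M ∧ Nf 1.618 C1 1 ≤ M ∧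
     Nf 1.6181 C0 0.9563 ≤ M ∧ Nf 1.6181 C0 1 ≤ M ∧ Nf 1.6181 C1 0.9563 ≤ M ∧ Nf 1.6181 C1 1 ≤ M ∧ 
     0.0764 * M ^ 2 + 2 * 0.3819 * M < 4 * 0.3819 * (2 * C0 * 0.9563 - 1.6181) ^ 2 → 
     0.0764 * Nf r C c ^ 2 + 2 * 0.3819 * Nf r C c < 4 * 0.3819 * (2 * C * c - r) ^ 2 := by
    rintro C0 C1 M k0 k1 k2 ⟨h1, h2, h3, h4, h5, h6, h7, h8, h9⟩
    have hN := Nf_box hr hr' k1 k2 hc hc' h1 h2 h3 h4 h5 h6 h7 h8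
    have hN0 : 0 ≤ Nf r C c := by
      have : Nf r C c = (2 * C * c - r) ^ 2 + 4 * ((C ^ 2 - 1) * (1 - c ^ 2)) := by unfold Nf; ring
      rw [this]
      have : 0 ≤ (C ^ 2 - 1) * (1 - c ^ 2) := mul_nonneg (by nlinarith) (by nlinarith)
      positivity
    have hx : 2 * C0 * 0.9563 - 1.6181 ≤ 2 * C * c - r := by nlinarith
    have hx0 : 0 ≤ 2 * C0 * 0.9563 - 1.6181 := by nlinarith
    refine lt_of_lt_of_le (lt_of_le_of_lt ?_ h9) ?_
    · gcongr
    · gcongr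
  rcases le_total C 1.014 with h | h
  · exact key 1 1.014 0.1682 (by norm_num) hC h (by norm_num [Nf])
  rcases le_total C 1.033 with h' | h'
  · exact key 1.014 1.033 0.201 (by norm_num) h h' (by norm_num [Nf])
  rcases le_total C 1.057 with h | h
  · exact key 1.033 1.057 0.248 (by norm_num) h' h (by norm_num [Nf])
  rcases le_total C 1.087 with h' | h'
  · exact key 1.057 1.087 0.31 (by norm_num) h h' (by norm_num [Nf])
  rcases le_total C 1.128 with h | h
  · exact key 1.087 1.128 0.4073 (by norm_num) h' h (by norm_num [Nf])
  rcases le_total C 1.178 with h' | h'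
  · exact key 1.128 1.178 0.545 (by norm_num) h h' (by norm_num [Nf])
  rcases le_total C 1.234 with h | h
  · exact key 1.178 1.234 0.73 (by norm_num) h' h (by norm_num [Nf])
  rcases le_total C 1.296 with h' | h'
  · exact key 1.234 1.296 0.974 (by norm_num) h h' (by norm_num [Nf])
  rcases le_total C 1.365 with h | h
  · exact key 1.296 1.365 1.281 (by norm_num) h' h (by norm_num [Nf])
  rcases le_total C 1.442 with h' | h'
  · exact key 1.365 1.442 1.669 (by norm_num) h h' (by norm_num [Nf])
  rcases le_total C 1.519 with h | h
  · exact key 1.442 1.519 2.105 (by norm_num) h' h (by norm_num [Nf])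
  · exact key 1.519 1.596 2.588 (by norm_num) h hC' (by norm_num [Nf])

lemma norm_quad_le {w : ℂ} (hw : w ≠ 0) (κ r s : ℝ) {K M N : ℝ} (hK : κ ^ 2 ≤ K) (hM : Nf r (Cw w) (cw w) ≤ M)
    (hN : Nf s (Cw w) (cw w) ≤ N) :
    ‖(κ : ℂ) * ((w + w⁻¹ - r) * (w + w⁻¹ - s))‖ ^ 2 ≤ K * (M * N) := by
  rw [← mul_assoc, norm_mul, mul_pow, norm_lin hw, norm_add_inv hw, mul_assoc]
  have := Nf_nonneg hw r
  have := Nf_nonneg hw s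
  have := sq_nonneg κ
  gcongr
  · linarith
  · linarith

lemma B7_eq (B : SL2C) : (B ^ 7) 0 1 = B 0 1 * (((B 0 0 + B 1 1) ^ 2) ^ 3 - 5 * ((B 0 0 + B 1 1) ^ 2) ^ 2 + 6 * (B 0 0 + B 1 1) ^ 2 - 1) ∧
    (B ^ 7) 1 0 = B 1 0 * (((B 0 0 + B 1 1) ^ 2) ^ 3 - 5 * ((B 0 0 + B 1 1) ^ 2) ^ 2 + 6 * (B 0 0 + B 1 1) ^ 2 - 1) := by
  have e : B ^ 7 = B * B * B * (B * B * B * B) := by simp only [pow_succ, pow_zero, one_mul, mul_assoc]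
  have hd := sl_det B
  obtain ⟨h1, h2, h3, h4⟩ := B3_eq B (B * B * B * B)
  obtain ⟨k1, k2, k3, k4⟩ := B3_eq B B
  rw [e, h2, h3]
  simp only [sl_mul B (B * B * B * B), k1, k2, k3, k4]
  simp only [sl_mul]
  clear e h1 h2 h3 h4 k1 k2 k3 k4
  generalize B 0 0 = a at *; generalize B 0 1 = b at *; generalize B 1 0 = c at *; generalize B 1 1 = d at *
  have hbc : b * c = a * d - 1 := by linear_combination -hd
  constructor <;> grind

lemma Nf_cor {r C c r0 r1 C0 C1 c0 M : ℝ} (hr0 : r0 ≤ r) (hr1 : r ≤ r1) (hC0 : C0 ≤ C) (hC1 : C ≤ C1)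
    (hc0 : c0 ≤ c) (hc1 : c ≤ 1)
    (h : (Nf r0 C0 c0 ≤ M ∧ Nf r0 C0 1 ≤ M ∧ Nf r0 C1 c0 ≤ M ∧ Nf r0 C1 1 ≤ M) ∧
     Nf r1 C0 c0 ≤ M ∧ Nf r1 C0 1 ≤ M ∧ Nf r1 C1 c0 ≤ M ∧ Nf r1 C1 1 ≤ M) : Nf r C c ≤ M :=
  Nf_box hr0 hr1 hC0 hC1 hc0 hc1 h.1.1 h.1.2.1 h.1.2.2.1 h.1.2.2.2 h.2.1 h.2.2.1 h.2.2.2.1 h.2.2.2.2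

lemma boxes5ii {r1 r2 r4 C c : ℝ} (a1 : 3.854 ≤ r1) (b1 : r1 ≤ 3.8542) (a2 : -0.6181 ≤ r2) (b2 : r2 ≤ -0.618)
    (a4 : 5.236 ≤ r4) (b4 : r4 ≤ 5.2361) (hC : 1.596 ≤ C) (hC' : C ≤ 2.168) (hc : 0.9563 ≤ c) (hc' : c ≤ 1) :
    ∃ M1 M2 M3 M4 : ℝ, Nf r1 C c ≤ M1 ∧ Nf r2 C c ≤ M2 ∧ Nf (-2) C c ≤ M3 ∧ Nf r4 C c ≤ M4 ∧
      0.005837 * (M1 * M2) * (0.005837 * (M3 * M4)) < 0.3819 ^ 2 := by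
  rcases le_total C 1.876 with h | h
  · exact ⟨1.172, 19.1, 33.1, 5.3, Nf_cor a1 b1 hC h hc hc' (by norm_num [Nf]), Nf_cor a2 b2 hC h hc hc' (by norm_num [Nf]),
      Nf_cor le_rfl le_rfl hC h hc hc' (by norm_num [Nf]), Nf_cor a4 b4 hC h hc hc' (by norm_num [Nf]), by norm_num⟩
  rcases le_total C 2.022 with h' | h'
  · exact ⟨1.06, 21.8, 36.6, 3.6, Nf_cor a1 b1 h h' hc hc' (by norm_num [Nf]), Nf_cor a2 b2 h h' hc hc' (by norm_num [Nf]),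
      Nf_cor le_rfl le_rfl h h' hc hc' (by norm_num [Nf]), Nf_cor a4 b4 h h' hc hc' (by norm_num [Nf]), by norm_num⟩
  · exact ⟨1.351, 24.6, 40.2, 2.93, Nf_cor a1 b1 h' hC' hc hc' (by norm_num [Nf]), Nf_cor a2 b2 h' hC' hc hc' (by norm_num [Nf]),
      Nf_cor le_rfl le_rfl h' hC' hc hc' (by norm_num [Nf]), Nf_cor a4 b4 h' hC' hc hc' (by norm_num [Nf]), by norm_num⟩

lemma boxes5i {r2 r3 r4 C c : ℝ} (a2 : 0.618 ≤ r2) (b2 : r2 ≤ 0.6181) (a3 : 4.236 ≤ r3) (b3 : r3 ≤ 4.2361)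
    (a4 : -1.6181 ≤ r4) (b4 : r4 ≤ -1.618) (hC : 1 ≤ C) (hC' : C ≤ 2.13) (hc : 0.945 ≤ c) (hc' : c ≤ 1) :
    ∃ M1 M2 M3 M4 : ℝ, Nf 2 C c ≤ M1 ∧ Nf r2 C c ≤ M2 ∧ Nf r3 C c ≤ M3 ∧ Nf r4 C c ≤ M4 ∧
      0.005837 * (M1 * M2) * (0.005837 * (M3 * M4)) < 0.3819 ^ 2 := by
  rcases le_total C 1.723 with h | h
  · exact ⟨2.43, 8, 5.51, 25.7, Nf_cor le_rfl le_rfl hC h hc hc' (by norm_num [Nf]), Nf_cor a2 b2 hC h hc hc' (by norm_num [Nf]),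
      Nf_cor a3 b3 hC h hc hc' (by norm_num [Nf]), Nf_cor a4 b4 hC h hc hc' (by norm_num [Nf]), by norm_num⟩
  rcases le_total C 2.04 with h' | h'
  · exact ⟨4.8, 12, 1.81, 32.5, Nf_cor le_rfl le_rfl h h' hc hc' (by norm_num [Nf]), Nf_cor a2 b2 h h' hc hc' (by norm_num [Nf]),
      Nf_cor a3 b3 h h' hc hc' (by norm_num [Nf]), Nf_cor a4 b4 h h' hc hc' (by norm_num [Nf]), by norm_num⟩
  · exact ⟨5.62, 13.3, 1.56, 34.6, Nf_cor le_rfl le_rfl h' hC' hc hc' (by norm_num [Nf]), Nf_cor a2 b2 h' hC' hc hc' (by norm_num [Nf]),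
      Nf_cor a3 b3 h' hC' hc hc' (by norm_num [Nf]), Nf_cor a4 b4 h' hC' hc hc' (by norm_num [Nf]), by norm_num⟩

namespace Frame
variable {Γ : Subgroup SL2C} {A B : SL2C} {lam : ℂ} {k2 : ℝ}

set_option maxHeartbeats 2000000 in
lemma case5b_ii (F : Frame Γ A B lam ((5 - √5) / 10)) (hx : str A ^ 2 = ((3 + √5) / 2 : ℝ))
    (hc : 0.9563 ≤ cw (rw' B)) (hC : Cw (rw' B) ≤ 2.168) : False := by
  obtain ⟨q1, q2, q3⟩ := q5
  have q3' : (√5 : ℂ) ^ 2 = 5 := by exact_mod_cast q3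
  have hbc := F.hbc
  have hs := F.s2
  have hβ := F.beta5 hx
  have w0 := F.w0
  have hC1 := Cw_ge w0
  have hc1 := cw_le w0
  by_cases h1 : rw' B + (rw' B)⁻¹ - ((1 + 3 * √5) / 2 : ℝ) = 0
  · obtain ⟨e1, e2⟩ := B7_eq B
    have hξ : (B 0 0 + B 1 1) ^ 2 = (1 + √5) / 2 := by
      rw [hs, sub_eq_zero.1 h1]; push_cast
      linear_combination (-3 / 20 : ℂ) * q3'
    rw [hξ] at e1 e2
    refine crit_diag F.db A (B ^ 7) F.hA (Γ.pow_mem F.hB 7) lam F.hl F.h00 F.h11 F.h01 F.h10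
      (((√5 - 5) / 2 : ℝ) : ℂ) (((((3 - √5) / 2) - ((√5 - 3) / 2) ^ 4) : ℝ) : ℂ) ((((√5 - 1) / 2) : ℝ) : ℂ)
      hβ.symm ?_ ?_ ?_ ?_ ?_ ?_
    · rw [Complex.ofReal_ne_zero]; intro h; linarith
    · push_cast; ring
    · rw [e1, e2]
      push_cast at hbc ⊢
      clear e1 e2 hs hβ hξ h1 F
      generalize (√5 : ℂ) = q at *
      generalize B 0 1 = b at *; generalize B 1 0 = c at *
      have : ∀ u : ℂ, b * u * (c * u) = ((5 - q) / 10 - 1) * u ^ 2 := by intro u; rw [← hbc]; ring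
      rw [this]
      grind
    · rw [Complex.ofReal_ne_zero]; intro h
      have : ((√5 - 3) / 2) ^ 2 < 0.2 := by nlinarith
      nlinarith
    · have : ((√5 - 3) / 2) ^ 2 < 0.2 := by nlinarith
      have : 0.1 < ((√5 - 3) / 2) ^ 2 := by nlinarith
      rw [Complex.norm_real, Complex.norm_real, Real.norm_of_nonneg, Real.norm_of_nonneg] <;> nlinarith
    · left
      have : ((√5 - 3) / 2) ^ 2 < 0.2 := by nlinarith
      rw [Complex.norm_real, Complex.norm_real, Real.norm_of_nonneg, Real.norm_of_nonneg] <;> nlinarith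
  have hg : B * B * B ∈ Γ := Γ.mul_mem (Γ.mul_mem F.hB F.hB) F.hB
  have hCc : 1.9 ≤ 2 * Cw (rw' B) * cw (rw' B) := by nlinarith
  have hCc' : 2 * Cw (rw' B) * cw (rw' B) ≤ 4.4 := by nlinarith
  obtain ⟨-, e1, e2, -⟩ := B3_eq B 1
  have hξ := hs
  simp only [mul_one] at e1 e2
  have g01 : (B * B * B) 0 1 = B 0 1 * ((B 0 0 + B 1 1) ^ 2 - 1) := by rw [e1]; simp; ring
  have g10 : (B * B * B) 1 0 = B 1 0 * ((B 0 0 + B 1 1) ^ 2 - 1) := by rw [e2]; simp; ring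
  rw [hs] at g01 g10
  set κ : ℝ := -((3 - √5) / 10) with hκ
  have κ2 : κ ^ 2 ≤ 0.005837 := by rw [hκ]; nlinarith
  have κ0 : (κ : ℂ) ≠ 0 := by rw [Complex.ofReal_ne_zero, hκ]; intro h; linarith
  set E1 : ℂ := κ * ((rw' B + (rw' B)⁻¹ - ((1 + 3 * √5) / 2 : ℝ)) * (rw' B + (rw' B)⁻¹ - ((1 - √5) / 2 : ℝ))) with hE1
  set E2 : ℂ := κ * ((rw' B + (rw' B)⁻¹ - ((-2 : ℝ) : ℂ)) * (rw' B + (rw' B)⁻¹ - ((3 + √5) : ℝ))) with hE2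
  have E10 : E1 ≠ 0 := by
    refine mul_ne_zero κ0 (mul_ne_zero h1 fun h => ?_)
    have := zeta_re w0 h
    linarith
  have E20 : E2 ≠ 0 := by
    refine mul_ne_zero κ0 (mul_ne_zero (fun h => ?_) fun h => ?_) <;>
    have := zeta_re w0 h <;> linarith
  have hh1 : E1 = -(((√5 - 5) / 2 : ℝ) : ℂ) * ((B * B * B) 0 1 * (B * B * B) 1 0) - 1 - (((√5 - 5) / 2 : ℝ) : ℂ) := by
    rw [hE1, g01, g10, hκ]
    push_cast at hbc ⊢
    clear e1 e2 hs hβ hξ h1 F g01 g10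
    generalize (√5 : ℂ) = q at *
    generalize rw' B + (rw' B)⁻¹ = z at *
    generalize B 0 1 = b at *; generalize B 1 0 = c at *
    have : ∀ u : ℂ, b * u * (c * u) = ((5 - q) / 10 - 1) * u ^ 2 := by intro u; rw [← hbc]; ring
    rw [this]
    grind
  have hh2 : E2 = E1 + (((√5 - 1) / 2 : ℝ) : ℂ) := by
    rw [hE1, hE2, hκ]
    push_cast at hbc ⊢
    clear e1 e2 hs hβ hξ h1 F g01 g10
    generalize (√5 : ℂ) = q at *
    generalize rw' B + (rw' B)⁻¹ = z at *
    grind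
  have fin : ∀ M1 M2 : ℝ, ‖E1‖ ^ 2 ≤ M1 → ‖E2‖ ^ 2 ≤ M2 → M1 * M2 < ((3 - √5) / 2) ^ 2 → False := by
    intro M1 M2 b1 b2 hM
    exact F.it (B * B * B) hg ((√5 - 5) / 2) ((√5 - 1) / 2) ((3 - √5) / 2) M1 M2 hβ
      (by intro h; linarith) (by ring) (by linarith) E1 E2 hh1 hh2 E10 E20 (by linarith) (by linarith) (by linarith) b1 b2 hM
  have hm : (0.3819 : ℝ) ^ 2 ≤ ((3 - √5) / 2) ^ 2 := by
    have : (0.3819 : ℝ) ≤ (3 - √5) / 2 := by linarith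
    gcongr
  rcases le_total (Cw (rw' B)) 1.596 with h | h
  · have L := lem5 (r := (1 + √5) / 2) (by linarith) (by linarith) hC1 h hc hc1
    set N := Nf ((1 + √5) / 2) (Cw (rw' B)) (cw (rw' B)) with hN
    set X := 2 * Cw (rw' B) * cw (rw' B) - (1 + √5) / 2 with hX
    set K : ℝ := (3 - √5) / 10 with hK
    set a : ℝ := (3 - √5) / 2 with ha
    have e2' : ‖E2‖ ^ 2 = 1 - 2 * (K * (2 * X ^ 2 - N)) + (K * N) ^ 2 := by
      rw [hE2, ← mul_assoc, norm_mul, mul_pow, norm_lin w0, norm_add_inv w0, hN, hX, hK, hκ]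
      unfold Nf
      generalize Cw (rw' B) = C at *; generalize cw (rw' B) = c at *
      clear e1 e2 hs hβ hξ h1 F g01 g10 fin hh1 hh2 E10 E20
      generalize √5 = q at *
      grind
    have e1' : ‖E1‖ ^ 2 = a ^ 2 - 2 * a * (K * (2 * X ^ 2 - N)) + (K * N) ^ 2 := by
      rw [hE1, ← mul_assoc, norm_mul, mul_pow, norm_lin w0, norm_add_inv w0, hN, hX, hK, ha, hκ]
      unfold Nf
      generalize Cw (rw' B) = C at *; generalize cw (rw' B) = c at *
      clear e1 e2 hs hβ hξ h1 F g01 g10 fin hh1 hh2 E10 E20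
      generalize √5 = q at *
      grind
    refine fin _ _ le_rfl le_rfl ?_
    have hN0 : 0 ≤ N := Nf_nonneg w0 _
    have K0 : 0 < K := by rw [hK]; linarith
    have K1 : K ≤ 0.0764 := by rw [hK]; linarith
    have a1 : 0.3819 ≤ a := by rw [ha]; linarith
    have a2 : a ≤ 1 := by rw [ha]; linarith
    have P0 : 0 ≤ 2 * X ^ 2 - N := by
      have : 0 ≤ 0.0764 * N ^ 2 := by positivity
      nlinarith
    have L2 : K * N ^ 2 < 2 * a * (2 * X ^ 2 - N) := by
      have : K * N ^ 2 ≤ 0.0764 * N ^ 2 := by gcongr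
      have : 2 * 0.3819 * (2 * X ^ 2 - N) ≤ 2 * a * (2 * X ^ 2 - N) := by gcongr
      linarith
    have L3 : 0 < 2 * a * (K * (2 * X ^ 2 - N)) - (K * N) ^ 2 := by
      have := mul_pos K0 (sub_pos.2 L2)
      nlinarith
    have L4 : 0 < 2 * (K * (2 * X ^ 2 - N)) - (K * N) ^ 2 := by
      have : 0 ≤ (1 - a) * (K * (2 * X ^ 2 - N)) := mul_nonneg (by linarith) (mul_nonneg K0.le P0)
      linarith
    have n1 := sq_nonneg ‖E1‖
    have n2 := sq_nonneg ‖E2‖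
    have g1 : ‖E1‖ ^ 2 < a ^ 2 := by rw [e1']; linarith
    have g2 : ‖E2‖ ^ 2 < 1 := by rw [e2']; linarith
    nlinarith
  · obtain ⟨M1, M2, M3, M4, h1, h2, h3, h4, h5⟩ := boxes5ii (r1 := (1 + 3 * √5) / 2) (r2 := (1 - √5) / 2) (r4 := 3 + √5)
      (by linarith) (by linarith) (by linarith) (by linarith) (by linarith) (by linarith) h hC hc hc1
    exact fin _ _ (norm_quad_le w0 κ _ _ κ2 h1 h2) (norm_quad_le w0 κ _ _ κ2 h3 h4) (h5.trans_le hm)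
end Frame

end

section

lemma PM.inv {A B : SL2C} (h : PM (Subgroup.closure {A⁻¹, B * A⁻¹ * B⁻¹}) B) :
    PM (Subgroup.closure {A, B * A * B⁻¹}) B := by
  have : Subgroup.closure {A⁻¹, B * A⁻¹ * B⁻¹} ≤ Subgroup.closure {A, B * A * B⁻¹} := by
    rw [Subgroup.closure_le]
    rintro x (rfl | rfl)
    · exact Subgroup.inv_mem _ (Subgroup.subset_closure (by simp))
    · have : B * A⁻¹ * B⁻¹ = (B * A * B⁻¹)⁻¹ := by group
      rw [this]
      exact Subgroup.inv_mem _ (Subgroup.subset_closure (by simp))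
  rcases h with h | h
  · exact Or.inl (this h)
  · exact Or.inr (this h)

lemma Cw_mul_unit (w : ℂ) {μ : ℂ} (hμ : ‖μ‖ = 1) : Cw (w * μ) = Cw w := by
  unfold Cw; rw [norm_mul, hμ, mul_one]

namespace Frame
variable {Γ : Subgroup SL2C} {A B : SL2C} {lam : ℂ} {k2 : ℝ}

lemma inv (F : Frame Γ A B lam k2) : Frame Γ A⁻¹ B lam⁻¹ k2 where
  db := F.db
  hA := Γ.inv_mem F.hA
  hB := F.hB
  hl := inv_ne_zero F.hl
  h00 := by rw [sl_inv00, F.h11]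
  h11 := by rw [sl_inv11, F.h00, inv_inv]
  h01 := by rw [sl_inv01, F.h01, neg_zero]
  h10 := by rw [sl_inv10, F.h10, neg_zero]
  k0 := F.k0
  hk := F.hk

lemma str_inv (A : SL2C) : str A⁻¹ = str A := by
  unfold str; rw [sl_inv00, sl_inv11]; ring

set_option maxHeartbeats 1000000 in
lemma case5b_i (F : Frame Γ A B lam ((5 - √5) / 10)) (hx : str A ^ 2 = ((3 + √5) / 2 : ℝ)) (μ : ℂ)
    (hμ : μ ^ 2 = lam ^ 2) (hμ1 : ‖μ‖ = 1) (hμs : μ + μ⁻¹ = ((1 + √5) / 2 : ℝ)) 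
    (hc : 0.945 ≤ cw (rw' B * μ⁻¹)) (hC : Cw (rw' B) ≤ 2.13) (hd : Cw (rw' B) ≤ 2.01 ∨ 0.8091 < cw (rw' B)) :
    PM (Subgroup.closure {A, B * A * B⁻¹}) B := by
  obtain ⟨q1, q2, q3⟩ := q5
  have q3' : (√5 : ℂ) ^ 2 = 5 := by exact_mod_cast q3
  have hlm : lam * lam⁻¹ = 1 := mul_inv_cancel₀ F.hl
  have hk := F.hk
  have hbc := F.hbc
  have hβ := F.beta5 hx
  have w0 := F.w0
  have hμ0 : μ ≠ 0 := by intro h; rw [h] at hμ1; simp at hμ1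
  have hμn : μ * μ⁻¹ = 1 := mul_inv_cancel₀ hμ0
  have hw : rw' B * (rw' B)⁻¹ = 1 := mul_inv_cancel₀ w0
  have hb := F.b01
  set y := rw' B * μ⁻¹ with hy
  have y0 : y ≠ 0 := mul_ne_zero w0 (inv_ne_zero hμ0)
  have hyi : y⁻¹ = (rw' B)⁻¹ * μ := by rw [hy, mul_inv, inv_inv]
  have hCy : Cw y = Cw (rw' B) := Cw_mul_unit _ (by rw [norm_inv, hμ1, inv_one])
  rw [← hCy] at hC hd
  have hC1 := Cw_ge y0
  have hc1 := cw_le y0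
  have hA := F.mA
  have hA' := F.mA'
  by_cases h1 : y + y⁻¹ - 2 = 0
  · have hy1 : y = 1 := by
      have h3 : (y - 1) ^ 2 = 0 := by
        have := mul_inv_cancel₀ y0; linear_combination y * h1 - this
      have := pow_eq_zero_iff (two_ne_zero) |>.1 h3
      linear_combination this
    have hwμ : rw' B = μ := by rw [hy] at hy1; exact (mul_inv_eq_one₀ hμ0).1 hy1
    rw [hwμ] at hb
    refine pm_of_scalar (W := A * A * ((B * A * B⁻¹) * (B * A * B⁻¹))) (Subgroup.mul_mem _ (Subgroup.mul_mem _ hA hA) (Subgroup.mul_mem _ hA' hA')) ?_ ?_ ?_ <;>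
    (simp only [sl_mul, sl_inv00, sl_inv01, sl_inv10, sl_inv11, F.h00, F.h11, F.h01, F.h10]) <;>
    push_cast at hk hbc hμs <;>
    clear F hβ hx hC w0 hC1 hc1 q1 q2 q3 hA hA' hc hd hyi hCy hy1 hwμ h1 hw <;>
    generalize μ⁻¹ = n at * <;> generalize lam⁻¹ = m at * <;>
    generalize (√5 : ℂ) = q at * <;> generalize B 0 0 = a at * <;> generalize B 0 1 = b at * <;>
    generalize B 1 0 = c at * <;> generalize B 1 1 = d at * <;> subst hb
    · grind
    · grind
    · grind
  exfalso
  have hg : B * B * A⁻¹ * B ∈ Γ := Γ.mul_mem (Γ.mul_mem (Γ.mul_mem F.hB F.hB) (Γ.inv_mem F.hA)) F.hB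
  have hCc : 1.8 ≤ 2 * Cw y * cw y := by nlinarith
  set κ : ℝ := -((3 - √5) / 10) with hκ
  have κ2 : κ ^ 2 ≤ 0.005837 := by rw [hκ]; nlinarith
  have κ0 : (κ : ℂ) ≠ 0 := by rw [Complex.ofReal_ne_zero, hκ]; intro h; linarith
  set E1 : ℂ := κ * ((y + y⁻¹ - (2 : ℝ)) * (y + y⁻¹ - ((√5 - 1) / 2 : ℝ))) with hE1
  set E2 : ℂ := κ * ((y + y⁻¹ - ((2 + √5 : ℝ) : ℂ)) * (y + y⁻¹ - (-((1 + √5) / 2) : ℝ))) with hE2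
  have E10 : E1 ≠ 0 := by
    refine mul_ne_zero κ0 (mul_ne_zero (by push_cast; exact h1) fun h => ?_)
    have := zeta_re y0 h
    linarith
  have E20 : E2 ≠ 0 := by
    refine mul_ne_zero κ0 (mul_ne_zero (fun h => ?_) fun h => ?_)
    · have e := zeta_re y0 h
      have hN := norm_add_inv y0 (2 + √5)
      rw [h] at hN
      rcases hd with hd | hd
      · nlinarith
      have hCC : (Cw y ^ 2 - 1) * (1 - cw y ^ 2) = 0 := by
        unfold Nf at hN
        simp at hN
        rw [e] at hN
        linear_combination (-1 / 4 : ℝ) * hN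
      have hC2 : Cw y ^ 2 - 1 ≠ 0 := by intro h0; nlinarith
      have hc2 : cw y = 1 := by
        have := (mul_eq_zero.1 hCC).resolve_left hC2
        nlinarith
      have hre : rw' B = y * μ := by rw [hy, mul_assoc, inv_mul_cancel₀ hμ0, mul_one]
      have hyn : 0 < ‖y‖ := norm_pos_iff.2 y0
      have hyre : y.re = ‖y‖ := by unfold cw at hc2; rwa [div_eq_one_iff_eq hyn.ne'] at hc2
      have hyim : y.im = 0 := by
        have := Complex.sq_norm y
        rw [Complex.normSq_apply, ← hyre] at this
        nlinarith
      have hcμ : cw (rw' B) = μ.re := by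
        rw [hre]; unfold cw
        rw [norm_mul, hμ1, mul_one, Complex.mul_re, hyim, hyre, zero_mul, sub_zero, mul_div_cancel_left₀ _ hyn.ne']
      have h2 := re_add_inv hμ0
      rw [hμs, Complex.ofReal_re] at h2
      unfold Cw cw at h2
      rw [hμ1] at h2
      norm_num at h2
      rw [hcμ] at hd
      linarith
    · have := zeta_re y0 h
      linarith
  have hh1 : E1 = -(((√5 - 5) / 2 : ℝ) : ℂ) * ((B * B * A⁻¹ * B) 0 1 * (B * B * A⁻¹ * B) 1 0) - 1 - (((√5 - 5) / 2 : ℝ) : ℂ) := by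
    push_cast at hk hbc hμs
    have := id5b (B 0 0) (B 0 1) (B 1 0) (B 1 1) lam lam⁻¹ √5 (rw' B) (rw' B)⁻¹ μ μ⁻¹ hb hk hbc hw hlm q3' hμ hμn hμs
      ((B * B * A⁻¹ * B) 0 1) ((B * B * A⁻¹ * B) 1 0) (y + y⁻¹) 
      (by simp only [sl_mul, sl_inv00, sl_inv01, sl_inv10, sl_inv11, F.h00, F.h11, F.h01, F.h10]; ring)
      (by simp only [sl_mul, sl_inv00, sl_inv01, sl_inv10, sl_inv11, F.h00, F.h11, F.h01, F.h10]; ring)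
      (by rw [hyi])
    push_cast
    rw [this, hE1, hκ]
    push_cast
    linear_combination (y + y⁻¹ - 2) * (y + y⁻¹ - (√5 - 1) / 2) * (1 / 100) * q3'
  have hh2 : E2 = E1 + (((√5 - 1) / 2 : ℝ) : ℂ) := by
    rw [hE1, hE2, hκ]
    push_cast
    clear hh1 E10 E20 hE1 hE2 h1 hC hc hd hc1 hC1 hCc hyi hy
    generalize (√5 : ℂ) = q at *
    generalize y + y⁻¹ = z at *
    clear hβ hb hw hx hbc hk hμs F
    grind
  have hm : (0.3819 : ℝ) ^ 2 ≤ ((3 - √5) / 2) ^ 2 := by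
    have : (0.3819 : ℝ) ≤ (3 - √5) / 2 := by linarith
    gcongr
  obtain ⟨M1, M2, M3, M4, b1, b2, b3, b4, b5⟩ := boxes5i (r2 := (√5 - 1) / 2) (r3 := 2 + √5) (r4 := -((1 + √5) / 2))
    (by linarith) (by linarith) (by linarith) (by linarith) (by linarith) (by linarith) hC1 hC hc hc1
  exact F.it (B * B * A⁻¹ * B) hg ((√5 - 5) / 2) ((√5 - 1) / 2) ((3 - √5) / 2) _ _ hβ
      (by intro h; linarith) (by ring) (by linarith) E1 E2 hh1 hh2 E10 E20 (by linarith) (by linarith) (by linarith)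
      (norm_quad_le y0 κ _ _ κ2 b1 b2) (norm_quad_le y0 κ _ _ κ2 b3 b4) (b5.trans_le hm)
end Frame

end

section

/-- The primitive rotation `exp (2πi/m)`. -/
def rt (m : ℕ) : ℂ := Complex.exp (2 * π / m * Complex.I)

lemma norm_rt (m : ℕ) : ‖rt m‖ = 1 := by
  have : (2 * π / m * Complex.I : ℂ) = ((2 * π / m : ℝ) : ℂ) * Complex.I := by push_cast; ring
  unfold rt; rw [this, Complex.norm_exp_ofReal_mul_I]

lemma norm_rt_zpow (m : ℕ) (j : ℤ) : ‖rt m ^ j‖ = 1 := by rw [norm_zpow, norm_rt, _root_.one_zpow]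

lemma rt_four : rt 4 = Complex.I := by
  unfold rt
  have : (2 * π / (4 : ℕ) * Complex.I : ℂ) = π / 2 * Complex.I := by push_cast; ring
  rw [this, Complex.exp_pi_div_two_mul_I]

namespace Frame
variable {Γ : Subgroup SL2C} {A B P : SL2C} {lam : ℂ} {k2 : ℝ}

lemma rotate (F : Frame Γ A B lam k2) {m : ℕ} (hm : 1 ≤ m) (hlam : lam ^ 2 = rt m) :
    ∃ j : ℤ, Real.cos (π / m) ≤ cw (rw' (B * A ^ j)) ∧ Cw (rw' (B * A ^ j)) = Cw (rw' B) := by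
  obtain ⟨j, hj⟩ := exists_rot F.w0 m hm
  refine ⟨j, ?_, ?_⟩
  · rw [F.rot_w, hlam]; exact hj
  · rw [F.rot_w, hlam, Cw_mul_unit _ (norm_rt_zpow m j)]

lemma fin4 (F : Frame Γ A B lam (1 / 2)) (hlam : lam ^ 2 = rt 4) (hx : str A ^ 2 = (2 : ℝ))
    (hX : fsq (P * A * P⁻¹) ≤ 2 * 1.0603) (hY : fsq (P * B * P⁻¹) ≤ 2 * 1.0603) :
    PM (Subgroup.closure {A, B * A * B⁻¹}) B := by
  obtain ⟨h1, h2, h3⟩ := cb_4 F hx hX hY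
  have hl : lam ^ 2 = Complex.I := by rw [hlam, rt_four]
  rcases le_total (cw (rw' B)) 0.8 with h | h
  · obtain ⟨j, j1, j2⟩ := F.rotate (by norm_num) hlam
    refine PM.rot j ((F.rot j).case4 hl (Or.inl ⟨le_trans ?_ j1, ?_⟩))
    · have : Real.cos (π / (4 : ℕ)) = √2 / 2 := by push_cast; exact Real.cos_pi_div_four
      rw [this]
      have : (1.4142 : ℝ) ≤ √2 := Real.le_sqrt_of_sq_le (by norm_num)
      linarith
    · rw [j2]; exact h1 h
  · rcases le_total (cw (rw' B)) 0.9 with h' | h'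
    · exact F.case4 hl (Or.inr (Or.inl ⟨h, h2 h'⟩))
    · exact F.case4 hl (Or.inr (Or.inr ⟨h', h3⟩))

lemma cos5 : Real.cos (π / (5 : ℕ)) = (1 + √5) / 4 := by push_cast; exact Real.cos_pi_div_five

lemma fin5a (F : Frame Γ A B lam ((5 + √5) / 10)) (hlam : lam ^ 2 = rt 5) (hx : str A ^ 2 = ((3 + √5) / 2 : ℝ))
    (hX : fsq (P * A * P⁻¹) ≤ 2 * 1.0584) (hY : fsq (P * B * P⁻¹) ≤ 2 * 1.0584) :
    PM (Subgroup.closure {A, B * A * B⁻¹}) B := by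
  have h1 := cb_5a F hx hX hY
  obtain ⟨j, j1, j2⟩ := F.rotate (by norm_num) hlam
  rw [cos5] at j1
  refine PM.rot j ((F.rot j).case5a hx ?_ ?_)
  · linarith [q5.1]
  · rw [j2]; exact h1

lemma cw_im {w : ℂ} (hw : w ≠ 0) : cw w ^ 2 + (w.im / ‖w‖) ^ 2 = 1 := by
  have h : ‖w‖ ≠ 0 := norm_ne_zero_iff.2 hw
  unfold cw
  rw [div_pow, div_pow, ← add_div, div_eq_one_iff_eq (by positivity), Complex.sq_norm, Complex.normSq_apply]
  ring

lemma chord {c s : ℝ} (h : c ^ 2 + s ^ 2 = 1) (hs : 0 ≤ s) (h0 : (1 + √5) / 4 ≤ c) (h1 : c ≤ 0.9563) :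
    0.945 ≤ c * ((1 + √5) / 4) + s * Real.sin (π / 5) := by
  obtain ⟨q1, q2, q3⟩ := q5
  have hS : 0.5877 ≤ Real.sin (π / 5) := by
    have h1 := Real.sin_sq_add_cos_sq (π / 5)
    rw [Real.cos_pi_div_five] at h1
    have : 0 ≤ Real.sin (π / 5) := Real.sin_nonneg_of_nonneg_of_le_pi (by positivity) (by linarith [Real.pi_pos])
    have h3 : Real.sin (π / 5) ^ 2 = (10 - 2 * √5) / 16 := by linear_combination h1 - q3 / 16
    by_contra hh
    push Not at hh
    nlinarith
  have hL : 0.292 + 2 * (0.9563 - c) ≤ s := by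
    apply le_of_sq_le_sq _ hs
    have : (0.292 + 2 * (0.9563 - c)) ^ 2 + c ^ 2 ≤ 1 := by nlinarith
    linarith
  have : 0.5877 * (0.292 + 2 * (0.9563 - c)) ≤ s * Real.sin (π / 5) := by
    rw [mul_comm s]
    apply mul_le_mul hS hL (by linarith) (by linarith)
  nlinarith

lemma fin5b (F : Frame Γ A B lam ((5 - √5) / 10)) (hlam : lam ^ 2 = rt 5) (hx : str A ^ 2 = ((3 + √5) / 2 : ℝ))
    (hX : fsq (P * A * P⁻¹) ≤ 2 * 1.0584) (hY : fsq (P * B * P⁻¹) ≤ 2 * 1.0584) :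
    PM (Subgroup.closure {A, B * A * B⁻¹}) B := by
  obtain ⟨q1, q2, q3⟩ := q5
  obtain ⟨h1, h2⟩ := cb_5b F hx hX hY
  have h3 : cw (rw' B) ≤ 0.9563 → Cw (rw' B) ≤ 2.13 := fun h => by
    refine F.bound (by linarith) (by norm_num) hx (by linarith) (by linarith) hX hY 1.14 _ _ (by norm_num) h
      ?_ ?_ <;> unfold _root_.Rg <;> nlinarith
  have main : ∀ B' : SL2C, Frame Γ A B' lam ((5 - √5) / 10) → (1 + √5) / 4 ≤ cw (rw' B') → Cw (rw' B') ≤ 2.168 →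
      (cw (rw' B') ≤ 0.9563 → Cw (rw' B') ≤ 2.13) → (Cw (rw' B') ≤ 2.01 ∨ 0.8091 < cw (rw' B')) →
      PM (Subgroup.closure {A, B' * A * B'⁻¹}) B' := by
    clear h1 h2 h3 hX hY F
    intro B F h0 h2 h3 hd
    rcases le_total 0.9563 (cw (rw' B)) with h | h
    · exact (F.case5b_ii hx h h2).elim
    set μ : ℂ := Complex.exp (((π / 5 : ℝ) : ℂ) * Complex.I) with hμ
    have hμ1 : ‖μ‖ = 1 := Complex.norm_exp_ofReal_mul_I _
    have hμ2 : μ ^ 2 = lam ^ 2 := by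
      rw [hlam, hμ, ← Complex.exp_nat_mul]; unfold rt; congr 1; push_cast; ring
    have hre : μ.re = (1 + √5) / 4 := by rw [hμ, Complex.exp_ofReal_mul_I_re, Real.cos_pi_div_five]
    have him : μ.im = Real.sin (π / 5) := by rw [hμ, Complex.exp_ofReal_mul_I_im]
    have hinv : μ⁻¹ = (starRingEnd ℂ) μ := by
      rw [Complex.inv_def, Complex.normSq_eq_norm_sq, hμ1]; simp
    have hμs : μ + μ⁻¹ = ((1 + √5) / 2 : ℝ) := by
      rw [hinv, Complex.add_conj, hre]; push_cast; ring
    have hcs := cw_im F.w0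
    have e : ∀ z : ℂ, ‖z‖ = 1 → cw (rw' B * z) = cw (rw' B) * z.re - (rw' B).im / ‖rw' B‖ * z.im := by
      intro z hz
      unfold cw
      rw [norm_mul, hz, mul_one, Complex.mul_re]; ring
    have hi1 : ‖μ⁻¹‖ = 1 := by rw [norm_inv, hμ1, inv_one]
    have hr : (μ⁻¹).re = (1 + √5) / 4 := by rw [hinv, Complex.conj_re, hre]
    have hi : (μ⁻¹).im = -Real.sin (π / 5) := by rw [hinv, Complex.conj_im, him]
    rcases le_total 0 ((rw' B).im / ‖rw' B‖) with hs | hs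
    · refine F.case5b_i hx μ hμ2 hμ1 hμs ?_ (h3 h) hd
      rw [e _ hi1, hr, hi]
      have := chord hcs hs h0 h
      linarith
    · refine PM.inv (F.inv.case5b_i (by rw [str_inv]; exact hx) μ⁻¹ ?_ hi1 ?_ ?_ (h3 h) hd)
      · rw [inv_pow, inv_pow, hμ2]
      · rw [inv_inv, add_comm]; exact hμs
      · rw [inv_inv, e _ hμ1, hre, him]
        have := chord (s := -((rw' B).im / ‖rw' B‖)) (by rw [neg_sq]; exact hcs) (by linarith) h0 h
        linarith
  rcases le_or_gt (cw (rw' B)) 0.8091 with h | h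
  · obtain ⟨j, j1, j2⟩ := F.rotate (by norm_num) hlam
    rw [cos5] at j1
    have := h1 h
    exact PM.rot j (main _ (F.rot j) j1 (by rw [j2]; linarith) (fun _ => by rw [j2]; linarith) (Or.inl (by rw [j2]; linarith)))
  · exact main _ F (by linarith) h2 h3 (Or.inr h)
end Frame

end

section

lemma fricke (f g : SL2C) : str (f * g * f⁻¹ * g⁻¹) =
    str f ^ 2 + str g ^ 2 + str (f * g) ^ 2 - str f * str g * str (f * g) - 2 := by
  have h1 := sl_det f
  have h2 := sl_det g
  simp only [str, sl_mul, sl_inv00, sl_inv01, sl_inv10, sl_inv11]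
  generalize f 0 0 = a at *; generalize f 0 1 = b at *; generalize f 1 0 = c at *; generalize f 1 1 = d at *
  generalize g 0 0 = x at *; generalize g 0 1 = y at *; generalize g 1 0 = z at *; generalize g 1 1 = t at *
  grind

lemma it_gen {Γ : Subgroup SL2C} (hΓ : DB Γ) (f g : SL2C) (hf : f ∈ Γ) (hg : g ∈ Γ) (β η m M1 M2 : ℝ)
    (hβ : str f ^ 2 - 4 = β) (hβ0 : β ≠ 0) (hη : η = β + 2) (hη0 : 0 < η) (E1 E2 : ℂ)
    (hE1 : E1 = str (f * g * f⁻¹ * g⁻¹) - 2 - 1 - β) (hE2 : E2 = E1 + η) (h1 : E1 ≠ 0) (h2 : E2 ≠ 0)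
    (hm1 : m ≤ η) (hm2 : m ≤ 1 - η) (hm0 : 0 ≤ m)
    (b1 : ‖E1‖ ^ 2 ≤ M1) (b2 : ‖E2‖ ^ 2 ≤ M2) (hM : M1 * M2 < m ^ 2) : False := by
  have hb : ‖E1 * E2‖ < m := by
    have : ‖E1 * E2‖ ^ 2 < m ^ 2 := by
      rw [norm_mul, mul_pow]
      refine lt_of_le_of_lt ?_ hM
      have := sq_nonneg ‖E1‖
      have := sq_nonneg ‖E2‖
      gcongr
      linarith
    exact lt_of_pow_lt_pow_left₀ 2 hm0 this
  have hn : ‖(η : ℂ)‖ = η := by rw [Complex.norm_real, Real.norm_of_nonneg hη0.le]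
  refine crit_it hΓ f g hf hg β (str (f * g * f⁻¹ * g⁻¹) - 2) E1 η hβ.symm rfl
    (by exact_mod_cast hβ0) (by rw [hη]; push_cast; ring) hE1 ?_ ?_ (Or.inl ?_)
  · rw [← hE2]; exact mul_ne_zero h1 h2
  · rw [← hE2, hn]; linarith
  · rw [← hE2, hn]; linarith

lemma str_g3b1 (a b c d l m k q w v : ℂ) (hl : l * m = 1) (h3 : l ^ 2 + m ^ 2 = -1) (hk : a * d = k)
   (hk' : k = (3 + q) / 6) (hq : q ^ 2 = 5)
   (hbc : b * c = k - 1) (hb : a = w * d) (hw : w * v = 1) (tf th tfh : ℂ)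
   (htf : tf = (a*l*d-b*m*c)*m + (c*l*(-b)+d*m*a)*l)
   (hth : th = l^3*a+m^3*d) 
   (htfh : tfh = (a*l*d-b*m*c)*m*l^3*a + (a*l*(-b)+b*m*a)*l*(m*c) + (c*l*d-d*m*c)*m*(l*b) + (c*l*(-b)+d*m*a)*l*m^3*d) :
   tf ^ 2 - 4 = (q - 5) / 2 ∧ 
   (q - 1) / 6 * (w + v - 1) = tf^2 + th^2 + tfh^2 - tf * th * tfh - 2 - 2 - 1 - (q-5)/2 := by
  have e1 : tf = (1 + q) / 2 := by rw [htf]; grind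
  have e2 : th = l^3 * (a+d) := by rw [hth]; grind
  obtain ⟨X, hX⟩ : ∃ X, X = k + (k-1)*(l^2-2*m^2) := ⟨_, rfl⟩
  obtain ⟨Y, hY⟩ : ∃ Y, Y = k + (k-1)*(m^2-2*l^2) := ⟨_, rfl⟩
  have e3 : tfh = l^3 * (X*a + Y*d) := by rw [htfh, hX, hY]; grind
  have e4 : (l^3)^2 = 1 := by clear hX hY htf hth htfh e1 e2 e3; grind
  have ha : a^2 = k * w := by linear_combination a * hb + w * hk
  have hd : d^2 = k * v := by linear_combination -d^2 * hw - v * d * hb + v * hk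
  have e5 : th ^ 2 = k * (w + v + 2) := by rw [e2]; linear_combination (a+d)^2*e4 + ha + hd + 2 * hk
  have e6 : tfh ^ 2 = X^2*(k*w) + Y^2*(k*v) + 2*X*Y*k := by
    rw [e3]; linear_combination (X*a+Y*d)^2*e4 + X^2*ha + Y^2*hd + 2*X*Y*hk
  have e7 : th * tfh = X*(k*w)+Y*(k*v)+(X+Y)*k := by
    rw [e2, e3]; linear_combination (a+d)*(X*a+Y*d)*e4 + X*ha + Y*hd + (X+Y)*hk
  refine ⟨by rw [e1]; linear_combination hq / 4, ?_⟩
  rw [mul_assoc tf, e7, e6, e5, e1]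
  have hun : l^2*m^2 = 1 := by linear_combination (l*m+1)*hl
  clear e7 e6 e5 e1 ha hd e2 e3 e4 hth htfh htf hk hbc hb hl
  generalize l^2 = u at *
  generalize m^2 = n at *
  grind
lemma str_g3b2 (a b c d l m k q w v : ℂ) (hl : l * m = 1) (h3 : l ^ 2 + m ^ 2 = -1) (hk : a * d = k)
   (hk' : k = (3 - q) / 6) (hq : q ^ 2 = 5)
   (hbc : b * c = k - 1) (hb : a = w * d) (hw : w * v = 1) (tf th tfh : ℂ)
   (htf : tf = (a*l*d-b*m*c)*l + (c*l*(-b)+d*m*a)*m)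
   (hth : th = a+d) 
   (htfh : tfh = (a*l*d-b*m*c)*l*a + (a*l*(-b)+b*m*a)*m*(m^2*c) + (c*l*d-d*m*c)*l*(l^2*b) + (c*l*(-b)+d*m*a)*m*d) :
   tf ^ 2 - 4 = (q - 5) / 2 ∧ 
   -((q - 1) / 6) * (w + v + 2) = tf^2 + th^2 + tfh^2 - tf * th * tfh - 2 - 2 - 1 - (q-5)/2 := by
  have e1 : tf = (1 + q) / 2 := by rw [htf]; grind
  obtain ⟨X, hX⟩ : ∃ X, X = l^2*k-(k-1)+(l^2-m^2)*(k-1) := ⟨_, rfl⟩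
  obtain ⟨Y, hY⟩ : ∃ Y, Y = m^2*k-(k-1)+(m^2-l^2)*(k-1) := ⟨_, rfl⟩
  have e3 : tfh = X*a + Y*d := by rw [htfh, hX, hY]; grind
  have ha : a^2 = k * w := by linear_combination a * hb + w * hk
  have hd : d^2 = k * v := by linear_combination -d^2 * hw - v * d * hb + v * hk
  have e5 : th ^ 2 = k * (w + v + 2) := by rw [hth]; linear_combination ha + hd + 2 * hk
  have e6 : tfh ^ 2 = X^2*(k*w) + Y^2*(k*v) + 2*X*Y*k := by
    rw [e3]; linear_combination X^2*ha + Y^2*hd + 2*X*Y*hk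
  have e7 : th * tfh = X*(k*w)+Y*(k*v)+(X+Y)*k := by
    rw [hth, e3]; linear_combination X*ha + Y*hd + (X+Y)*hk
  refine ⟨by rw [e1]; linear_combination hq / 4, ?_⟩
  rw [mul_assoc tf, e7, e6, e5, e1]
  have hun : l^2*m^2 = 1 := by linear_combination (l*m+1)*hl
  clear e7 e6 e5 e1 ha hd e3 hth htfh htf hk hbc hb hl
  generalize l^2 = u at *
  generalize m^2 = n at *
  grind


namespace Frame
variable {Γ : Subgroup SL2C} {A B P : SL2C} {lam : ℂ} {k2 : ℝ}

lemma lam3 (F : Frame Γ A B lam k2) (hx : str A ^ 2 = (1 : ℝ)) : lam ^ 2 + lam⁻¹ ^ 2 = -1 := by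
  have hlm : lam * lam⁻¹ = 1 := mul_inv_cancel₀ F.hl
  unfold str at hx
  rw [F.h00, F.h11] at hx
  push_cast at hx
  linear_combination hx - 2 * hlm

lemma zeta_one {w : ℂ} (hw : w ≠ 0) {u n : ℂ} (h : w + w⁻¹ - 1 = 0) (hun : u * n = 1) (h3 : u + n = -1) :
    w = -u ∨ w = -n := by
  have := mul_inv_cancel₀ hw
  have h1 : (w + u) * (w + n) = 0 := by linear_combination w * h - this + w * h3 + hun
  rcases mul_eq_zero.1 h1 with h | h
  · left; linear_combination h
  · right; linear_combination h

lemma kap : ((√5 - 1) / 6) ^ 2 ≤ 0.042443 := by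
  obtain ⟨q1, q2, q3⟩ := q5
  nlinarith

set_option maxHeartbeats 1000000 in
lemma case3b1 (F : Frame Γ A B lam ((3 + √5) / 6)) (hx : str A ^ 2 = (1 : ℝ)) (hc : 0.5 ≤ cw (rw' B))
    (hC : Cw (rw' B) ≤ 1.0384) : PM (Subgroup.closure {A, B * A * B⁻¹}) B := by
  obtain ⟨q1, q2, q3⟩ := q5
  have q3' : (√5 : ℂ) ^ 2 = 5 := by exact_mod_cast q3
  have hlm : lam * lam⁻¹ = 1 := mul_inv_cancel₀ F.hl
  have h3 := F.lam3 hx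
  have hk := F.hk
  have hbc := F.hbc
  have w0 := F.w0
  have hw : rw' B * (rw' B)⁻¹ = 1 := mul_inv_cancel₀ w0
  have hb := F.b01
  have hC1 := Cw_ge w0
  have hc1 := cw_le w0
  have hA := F.mA
  have hA' := F.mA'
  have hun : lam ^ 2 * lam⁻¹ ^ 2 = 1 := by linear_combination (lam * lam⁻¹ + 1) * hlm
  by_cases h1 : rw' B + (rw' B)⁻¹ - 1 = 0
  · rcases zeta_one w0 h1 hun h3 with hc | hc
    · refine pm_of_scalar (W := A⁻¹ * (B * A * B⁻¹)⁻¹ * (A⁻¹ * (B * A * B⁻¹)⁻¹)) (Subgroup.mul_mem _ (Subgroup.mul_mem _ (Subgroup.inv_mem _ hA) (Subgroup.inv_mem _ hA')) (Subgroup.mul_mem _ (Subgroup.inv_mem _ hA) (Subgroup.inv_mem _ hA'))) ?_ ?_ ?_ <;>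
      (simp only [sl_mul, sl_inv00, sl_inv01, sl_inv10, sl_inv11, F.h00, F.h11, F.h01, F.h10]) <;>
      rw [hc] at hb <;> push_cast at hk hbc <;>
      clear F hx hC w0 hC1 hc1 q1 q2 q3 hA hA' hw h1 hc <;>
      generalize lam⁻¹ = m at * <;>
      generalize (√5 : ℂ) = q at * <;> generalize B 0 0 = a at * <;> generalize B 0 1 = b at * <;>
      generalize B 1 0 = c at * <;> generalize B 1 1 = d at * <;> subst hb
      · grind
      · grind
      · grind
    · refine pm_of_scalar (W := A * (B * A * B⁻¹) * (A * (B * A * B⁻¹))) (Subgroup.mul_mem _ (Subgroup.mul_mem _ hA hA') (Subgroup.mul_mem _ hA hA')) ?_ ?_ ?_ <;>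
      (simp only [sl_mul, sl_inv00, sl_inv01, sl_inv10, sl_inv11, F.h00, F.h11, F.h01, F.h10]) <;>
      rw [hc] at hb <;> push_cast at hk hbc <;>
      clear F hx hC w0 hC1 hc1 q1 q2 q3 hA hA' hw h1 hc <;>
      generalize lam⁻¹ = m at * <;>
      generalize (√5 : ℂ) = q at * <;> generalize B 0 0 = a at * <;> generalize B 0 1 = b at * <;>
      generalize B 1 0 = c at * <;> generalize B 1 1 = d at * <;> subst hb
      · grind
      · grind
      · grind
  exfalso
  have hf : B * A * B⁻¹ * A⁻¹ ∈ Γ := Γ.mul_mem (Γ.mul_mem (Γ.mul_mem F.hB F.hA) (Γ.inv_mem F.hB)) (Γ.inv_mem F.hA)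
  have hg : A * A * B * A ∈ Γ := Γ.mul_mem (Γ.mul_mem (Γ.mul_mem F.hA F.hA) F.hB) F.hA
  obtain ⟨p1, p2⟩ := str_g3b1 (B 0 0) (B 0 1) (B 1 0) (B 1 1) lam lam⁻¹ (((3 + √5) / 6 : ℝ) : ℂ) √5 (rw' B) (rw' B)⁻¹ hlm h3 hk
    (by push_cast; ring) q3' hbc hb hw (str (B * A * B⁻¹ * A⁻¹)) (str (A * A * B * A)) (str (B * A * B⁻¹ * A⁻¹ * (A * A * B * A)))
    (by simp only [str, sl_mul, sl_inv00, sl_inv01, sl_inv10, sl_inv11, F.h00, F.h11, F.h01, F.h10]; ring)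
    (by simp only [str, sl_mul, sl_inv00, sl_inv01, sl_inv10, sl_inv11, F.h00, F.h11, F.h01, F.h10]; ring)
    (by
      simp only [str, sl_mul, sl_inv00, sl_inv01, sl_inv10, sl_inv11, F.h00, F.h11, F.h01, F.h10]
      generalize lam⁻¹ = m at *
      generalize B 0 0 = a at *; generalize B 0 1 = b at *; generalize B 1 0 = c at *; generalize B 1 1 = d at *
      clear hk hbc h3 hb
      grind)
  have κ0 : (((√5 - 1) / 6 : ℝ) : ℂ) ≠ 0 := by rw [Complex.ofReal_ne_zero]; intro h; linarith
  refine it_gen F.db _ _ hf hg ((√5 - 5) / 2) ((√5 - 1) / 2) 0.381 (0.042443 * 1.5) (0.042443 * 17) (by push_cast; exact p1)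
    (by intro h; linarith) (by ring) (by linarith)
    ((((√5 - 1) / 6 : ℝ) : ℂ) * (rw' B + (rw' B)⁻¹ - (1 : ℝ)))
    ((((√5 - 1) / 6 : ℝ) : ℂ) * (rw' B + (rw' B)⁻¹ - (-2 : ℝ))) ?_ ?_ ?_ ?_ (by linarith) (by linarith) (by norm_num)
    (norm_lin_le w0 _ _ kap ?_) (norm_lin_le w0 _ _ kap ?_) (by norm_num)
  · rw [fricke]; push_cast; exact p2
  · push_cast; ring
  · exact mul_ne_zero κ0 (by push_cast; exact h1)
  · refine mul_ne_zero κ0 fun h => ?_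
    have := zeta_re w0 h
    have : 0 ≤ Cw (rw' B) * cw (rw' B) := by apply mul_nonneg <;> linarith
    linarith
  · refine Nf_box (r0 := 1) (r1 := 1) (C0 := 1) (C1 := 1.0384) (c0 := 0.5) (c1 := 1) (by linarith) (by linarith) hC1 hC hc hc1 ?_ ?_ ?_ ?_ ?_ ?_ ?_ ?_ <;> norm_num [Nf]
  · refine Nf_box (r0 := -2) (r1 := -2) (C0 := 1) (C1 := 1.0384) (c0 := 0.5) (c1 := 1) (by linarith) (by linarith) hC1 hC hc hc1 ?_ ?_ ?_ ?_ ?_ ?_ ?_ ?_ <;> norm_num [Nf]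
end Frame

end

section
namespace Frame
variable {Γ : Subgroup SL2C} {A B P : SL2C} {lam : ℂ} {k2 : ℝ}
set_option maxHeartbeats 1000000 in
lemma case3b2 (F : Frame Γ A B lam ((3 - √5) / 6)) (hx : str A ^ 2 = (1 : ℝ)) (hc : 0.5 ≤ cw (-rw' B))
    (hC : Cw (rw' B) ≤ 1.565) : PM (Subgroup.closure {A, B * A * B⁻¹}) B := by
  obtain ⟨q1, q2, q3⟩ := q5
  have q3' : (√5 : ℂ) ^ 2 = 5 := by exact_mod_cast q3
  have hlm : lam * lam⁻¹ = 1 := mul_inv_cancel₀ F.hl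
  have h3 := F.lam3 hx
  have hk := F.hk
  have hbc := F.hbc
  have w0 := F.w0
  have w1 : -rw' B ≠ 0 := neg_ne_zero.2 w0
  have hw : rw' B * (rw' B)⁻¹ = 1 := mul_inv_cancel₀ w0
  have hb := F.b01
  rw [← Cw_neg] at hC
  have hC1 := Cw_ge w1
  have hc1 := cw_le w1
  have hA := F.mA
  have hA' := F.mA'
  by_cases h1 : rw' B = -1
  · refine pm_of_scalar (W := A * (B * A * B⁻¹) * A * (B * A * B⁻¹) * A) (Subgroup.mul_mem _ (Subgroup.mul_mem _ (Subgroup.mul_mem _ (Subgroup.mul_mem _ hA hA') hA) hA') hA) ?_ ?_ ?_ <;>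
      (simp only [sl_mul, sl_inv00, sl_inv01, sl_inv10, sl_inv11, F.h00, F.h11, F.h01, F.h10]) <;>
      rw [h1] at hb <;> push_cast at hk hbc <;>
      clear F hx hC w0 hC1 hc1 q1 q2 q3 hA hA' hw h1 hc <;>
      generalize lam⁻¹ = m at * <;>
      generalize (√5 : ℂ) = q at * <;> generalize B 0 0 = a at * <;> generalize B 0 1 = b at * <;>
      generalize B 1 0 = c at * <;> generalize B 1 1 = d at * <;> subst hb
    · grind
    · grind
    · grind
  exfalso
  have hf : B * A * B⁻¹ * A ∈ Γ := Γ.mul_mem (Γ.mul_mem (Γ.mul_mem F.hB F.hA) (Γ.inv_mem F.hB)) (F.hA)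
  have hg : A * B * A⁻¹ ∈ Γ := Γ.mul_mem (Γ.mul_mem F.hA F.hB) (Γ.inv_mem F.hA)
  obtain ⟨p1, p2⟩ := str_g3b2 (B 0 0) (B 0 1) (B 1 0) (B 1 1) lam lam⁻¹ (((3 - √5) / 6 : ℝ) : ℂ) √5 (rw' B) (rw' B)⁻¹ hlm h3 hk
    (by push_cast; ring) q3' hbc hb hw (str (B * A * B⁻¹ * A)) (str (A * B * A⁻¹)) (str (B * A * B⁻¹ * A * (A * B * A⁻¹)))
    (by simp only [str, sl_mul, sl_inv00, sl_inv01, sl_inv10, sl_inv11, F.h00, F.h11, F.h01, F.h10]; ring)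
    (by
      simp only [str, sl_mul, sl_inv00, sl_inv01, sl_inv10, sl_inv11, F.h00, F.h11, F.h01, F.h10]
      generalize lam⁻¹ = m at *
      generalize B 0 0 = a at *; generalize B 0 1 = b at *; generalize B 1 0 = c at *; generalize B 1 1 = d at *
      clear hk hbc h3 hb
      grind)
    (by
      simp only [str, sl_mul, sl_inv00, sl_inv01, sl_inv10, sl_inv11, F.h00, F.h11, F.h01, F.h10]
      generalize lam⁻¹ = m at *
      generalize B 0 0 = a at *; generalize B 0 1 = b at *; generalize B 1 0 = c at *; generalize B 1 1 = d at *
      clear hk hbc h3 hb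
      grind)
  have κ0 : (((√5 - 1) / 6 : ℝ) : ℂ) ≠ 0 := by rw [Complex.ofReal_ne_zero]; intro h; linarith
  have hi : (-rw' B)⁻¹ = -(rw' B)⁻¹ := by rw [inv_neg]
  refine it_gen F.db _ _ hf hg ((√5 - 5) / 2) ((√5 - 1) / 2) 0.381 (0.042443 * 4.55) (0.042443 * 17.1) (by push_cast; exact p1)
    (by intro h; linarith) (by ring) (by linarith)
    ((((√5 - 1) / 6 : ℝ) : ℂ) * (-rw' B + (-rw' B)⁻¹ - (2 : ℝ)))
    ((((√5 - 1) / 6 : ℝ) : ℂ) * (-rw' B + (-rw' B)⁻¹ - (-1 : ℝ))) ?_ ?_ ?_ ?_ (by linarith) (by linarith) (by norm_num)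
    (norm_lin_le w1 _ _ kap ?_) (norm_lin_le w1 _ _ kap ?_) (by norm_num)
  · rw [fricke, hi]; push_cast; linear_combination p2
  · push_cast; ring
  · refine mul_ne_zero κ0 fun h => h1 ?_
    rw [hi] at h
    push_cast at h
    have : (rw' B + 1) ^ 2 = 0 := by linear_combination -rw' B * h - hw
    have := pow_eq_zero_iff (two_ne_zero) |>.1 this
    linear_combination this
  · refine mul_ne_zero κ0 fun h => ?_
    have := zeta_re w1 h
    have : 0 ≤ Cw (-rw' B) * cw (-rw' B) := by apply mul_nonneg <;> linarith
    linarith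
  · refine Nf_box (r0 := 2) (r1 := 2) (C0 := 1) (C1 := 1.565) (c0 := 0.5) (c1 := 1) (by linarith) (by linarith) hC1 hC hc hc1 ?_ ?_ ?_ ?_ ?_ ?_ ?_ ?_ <;> norm_num [Nf]
  · refine Nf_box (r0 := -1) (r1 := -1) (C0 := 1) (C1 := 1.565) (c0 := 0.5) (c1 := 1) (by linarith) (by linarith) hC1 hC hc hc1 ?_ ?_ ?_ ?_ ?_ ?_ ?_ ?_ <;> norm_num [Nf]

lemma cos3 : Real.cos (π / (3 : ℕ)) = 1 / 2 := by push_cast; exact Real.cos_pi_div_three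

lemma fin3b1 (F : Frame Γ A B lam ((3 + √5) / 6)) (hlam : lam ^ 2 = rt 3) (hx : str A ^ 2 = (1 : ℝ))
    (hX : fsq (P * A * P⁻¹) ≤ 2 * 1.0168) (hY : fsq (P * B * P⁻¹) ≤ 2 * 1.0168) :
    PM (Subgroup.closure {A, B * A * B⁻¹}) B := by
  have h1 := cb_3b1 F hx hX hY
  obtain ⟨j, j1, j2⟩ := F.rotate (by norm_num) hlam
  rw [cos3] at j1
  exact PM.rot j ((F.rot j).case3b1 hx (by linarith) (by rw [j2]; exact h1))

lemma fin3b2 (F : Frame Γ A B lam ((3 - √5) / 6)) (hlam : lam ^ 2 = rt 3) (hx : str A ^ 2 = (1 : ℝ))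
    (hX : fsq (P * A * P⁻¹) ≤ 2 * 1.0168) (hY : fsq (P * B * P⁻¹) ≤ 2 * 1.0168) :
    PM (Subgroup.closure {A, B * A * B⁻¹}) B := by
  have h1 := cb_3b2 F hx hX hY
  obtain ⟨j, j1⟩ := exists_rot (neg_ne_zero.2 F.w0) 3 (by norm_num)
  rw [cos3] at j1
  refine PM.rot j ((F.rot j).case3b2 hx ?_ ?_)
  · rw [F.rot_w, hlam, ← neg_mul]; unfold rt; linarith
  · rw [F.rot_w, hlam, Cw_mul_unit _ (norm_rt_zpow 3 j)]; exact h1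
end Frame

end

section

lemma PM.neg {G : Subgroup SL2C} {X : SL2C} (h : PM G X) : PM G (-X) := by
  rcases h with h | h
  · right; rwa [neg_neg]
  · left; exact h

lemma PM.mul {G : Subgroup SL2C} {X Y : SL2C} (h : PM G X) (h' : PM G Y) : PM G (X * Y) := by
  rcases h with h | h <;> rcases h' with h' | h'
  · exact Or.inl (G.mul_mem h h')
  · right; have := G.mul_mem h h'; rwa [mul_neg] at this
  · right; have := G.mul_mem h h'; rwa [neg_mul] at this
  · left; have := G.mul_mem h h'; rwa [neg_mul_neg] at this

lemma sl_neg_inv (X : SL2C) : (-X)⁻¹ = -X⁻¹ := by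
  rw [inv_eq_iff_mul_eq_one]; simp

lemma PM.inv' {G : Subgroup SL2C} {X : SL2C} (h : PM G X) : PM G X⁻¹ := by
  rcases h with h | h
  · exact Or.inl (G.inv_mem h)
  · right; have := G.inv_mem h; rwa [sl_neg_inv] at this

/-- The extension of a group by an involution normalizing it. -/
def extE (G : Subgroup SL2C) (E : SL2C) (hE : ∀ g, PM G g → PM G (E * g * E⁻¹)) (hE2 : E * E = -1) :
    Subgroup SL2C where
  carrier := {x | PM G x ∨ PM G (x * E)}
  one_mem' := Or.inl (Or.inl G.one_mem)
  mul_mem' := by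
    have hi : E⁻¹ = -E := by
      rw [inv_eq_iff_mul_eq_one, mul_neg, hE2, neg_neg]
    rintro x y (h | h) (h' | h')
    · exact Or.inl (h.mul h')
    · right; rw [mul_assoc]; exact h.mul h'
    · right
      have := h.mul (hE y h')
      have e : x * E * (E * y * E⁻¹) = x * (E * E) * y * E⁻¹ := by group
      rw [e, hE2, hi] at this
      simpa using this
    · left
      have := (h.mul (hE _ h')).neg
      have e : -(x * E * (E * (y * E) * E⁻¹)) = -(x * (E * E) * y) := by group
      rw [e, hE2] at this
      simpa using this
  inv_mem' := by
    have hi : E⁻¹ = -E := by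
      rw [inv_eq_iff_mul_eq_one, mul_neg, hE2, neg_neg]
    rintro x (h | h)
    · exact Or.inl h.inv'
    · right
      have := (hE _ h.inv').neg
      have e : -(E * (x * E)⁻¹ * E⁻¹) = -(x⁻¹ * E⁻¹) := by group
      rw [e, hi] at this
      simpa using this

lemma neg_bd {g : SL2C} {r : ℝ} (h : ∀ i j, ‖g i j‖ ≤ r) : ∀ i j, ‖(-g) i j‖ ≤ r := by
  intro i j
  have : (-g) i j = - (g i j) := by simp
  rw [this, norm_neg]; exact h i j

lemma finPM {G : Subgroup SL2C} (h : DB G) (r : ℝ) : {g : SL2C | PM G g ∧ ∀ i j, ‖g i j‖ ≤ r}.Finite := by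
  refine ((h r).union ((h r).image (fun g => -g))).subset ?_
  rintro g ⟨hg | hg, hb⟩
  · exact Or.inl ⟨hg, hb⟩
  · exact Or.inr ⟨-g, ⟨hg, neg_bd hb⟩, by simp⟩

lemma extE_db {G : Subgroup SL2C} {E : SL2C} (hE : ∀ g, PM G g → PM G (E * g * E⁻¹)) (hE2 : E * E = -1)
    (h : DB G) : DB (extE G E hE hE2) := by
  intro r
  obtain ⟨s, hs⟩ := sl_exists_norm E
  refine ((finPM h r).union ((finPM h (2 * r * s)).image (fun g => g * E⁻¹))).subset ?_
  rintro g ⟨hg | hg, hb⟩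
  · exact Or.inl ⟨hg, hb⟩
  · exact Or.inr ⟨g * E, ⟨hg, sl_mul_norm_le g E hb hs⟩, by group⟩

lemma norm_closure {A B E : SL2C} (h1 : E * A * E⁻¹ = A⁻¹) (h2 : E * B * E⁻¹ = B⁻¹) :
    ∀ g, PM (Subgroup.closure {A, B}) g → PM (Subgroup.closure {A, B}) (E * g * E⁻¹) := by
  have key : ∀ g ∈ Subgroup.closure {A, B}, E * g * E⁻¹ ∈ Subgroup.closure {A, B} := by
    have : cj E (Subgroup.closure {A, B}) ≤ Subgroup.closure {A, B} := by
      rw [cj_closure, h1, h2, Subgroup.closure_le]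
      rintro x (rfl | rfl)
      · exact Subgroup.inv_mem _ (Subgroup.subset_closure (by simp))
      · exact Subgroup.inv_mem _ (Subgroup.subset_closure (by simp))
    exact fun g hg => this (mem_cj hg)
  rintro g (h | h)
  · exact Or.inl (key g h)
  · right; have := key _ h; simpa using this

namespace Frame
variable {Γ : Subgroup SL2C} {A B P : SL2C} {lam : ℂ} {k2 : ℝ}

lemma case3aI (F : Frame Γ A B lam (1 / 3)) (hx : str A ^ 2 = (1 : ℝ)) (hc : 0.5 ≤ cw (rw' B))
    (hC : Cw (rw' B) ≤ 1.189) : PM (Subgroup.closure {A, B * A * B⁻¹}) B := by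
  have hlm : lam * lam⁻¹ = 1 := mul_inv_cancel₀ F.hl
  have h3 := F.lam3 hx
  have hk := F.hk
  have hbc := F.hbc
  have w0 := F.w0
  have hw : rw' B * (rw' B)⁻¹ = 1 := mul_inv_cancel₀ w0
  have hb := F.b01
  have hC1 := Cw_ge w0
  have hc1 := cw_le w0
  have hA := F.mA
  have hA' := F.mA'
  push_cast at hk hbc
  have hun : lam ^ 2 * lam⁻¹ ^ 2 = 1 := by linear_combination (lam * lam⁻¹ + 1) * hlm
  by_cases h1 : rw' B + (rw' B)⁻¹ - 1 = 0
  · rcases zeta_one w0 h1 hun h3 with hc | hc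
    · refine pm_of_scalar (W := A⁻¹ * (B * A * B⁻¹)⁻¹) (Subgroup.mul_mem _ (Subgroup.inv_mem _ hA) (Subgroup.inv_mem _ hA')) ?_ ?_ ?_ <;>
      (simp only [sl_mul, sl_inv00, sl_inv01, sl_inv10, sl_inv11, F.h00, F.h11, F.h01, F.h10]) <;>
      rw [hc] at hb <;>
      clear F hx hC w0 hC1 hc1 hA hA' hw h1 hc <;>
      generalize lam⁻¹ = m at * <;>
      generalize B 0 0 = a at * <;> generalize B 0 1 = b at * <;>
      generalize B 1 0 = c at * <;> generalize B 1 1 = d at * <;> subst hb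
      · grind
      · grind
      · grind
    · refine pm_of_scalar (W := A * (B * A * B⁻¹)) (Subgroup.mul_mem _ hA hA') ?_ ?_ ?_ <;>
      (simp only [sl_mul, sl_inv00, sl_inv01, sl_inv10, sl_inv11, F.h00, F.h11, F.h01, F.h10]) <;>
      rw [hc] at hb <;>
      clear F hx hC w0 hC1 hc1 hA hA' hw h1 hc <;>
      generalize lam⁻¹ = m at * <;>
      generalize B 0 0 = a at * <;> generalize B 0 1 = b at * <;>
      generalize B 1 0 = c at * <;> generalize B 1 1 = d at * <;> subst hb
      · grind
      · grind
      · grind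
  exfalso
  have hc0 : B 1 0 ≠ 0 := by
    intro h; rw [h] at hbc; norm_num at hbc
  have hb0 : B 0 1 ≠ 0 := by
    intro h; rw [h] at hbc; norm_num at hbc
  obtain ⟨t, ht⟩ : ∃ t : ℂ, t ^ 2 = B 0 1 / B 1 0 := ⟨_, Complex.cpow_nat_inv_pow _ two_ne_zero⟩
  have ht0 : t ≠ 0 := by
    rintro rfl
    have : B 0 1 / B 1 0 ≠ 0 := div_ne_zero hb0 hc0
    exact this (by rw [← ht]; simp)
  have htt : t * t⁻¹ = 1 := mul_inv_cancel₀ ht0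
  have htb : B 0 1 = t ^ 2 * B 1 0 := by rw [ht]; field_simp
  obtain ⟨E, e00, e01, e10, e11⟩ : ∃ E : SL2C, E 0 0 = 0 ∧ E 0 1 = t ∧ E 1 0 = -t⁻¹ ∧ E 1 1 = 0 :=
    ⟨mkSL 0 t (-t⁻¹) 0 (by linear_combination htt), rfl, rfl, rfl, rfl⟩
  have hE2 : E * E = -1 := by
    apply sl_ext <;> simp [sl_mul, e00, e01, e10, e11, ht0]
  have E1 : E * A * E⁻¹ = A⁻¹ := by
    apply sl_ext <;> simp only [sl_mul, sl_inv00, sl_inv01, sl_inv10, sl_inv11, e00, e01, e10, e11, F.h00, F.h11, F.h01, F.h10]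
    · linear_combination lam⁻¹ * htt
    · ring
    · ring
    · linear_combination lam * htt
  have E2 : E * B * E⁻¹ = B⁻¹ := by
    apply sl_ext <;> simp only [sl_mul, sl_inv00, sl_inv01, sl_inv10, sl_inv11, e00, e01, e10, e11]
    · linear_combination B 1 1 * htt
    · linear_combination htb
    · linear_combination - t⁻¹^2 * htb - B 1 0 * (t * t⁻¹ + 1) * htt
    · linear_combination B 0 0 * htt
  have hdb : DB (Subgroup.closure {A, B}) := F.db.mono (by
    rw [Subgroup.closure_le]
    rintro x (rfl | rfl)
    · exact F.hA
    · exact F.hB)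
  have hN := norm_closure E1 E2
  have hD := extE_db hN hE2 hdb
  set D := extE _ E hN hE2 with hDdef
  have mA : A ∈ D := Or.inl (Or.inl (Subgroup.subset_closure (by simp)))
  have mB : B ∈ D := Or.inl (Or.inl (Subgroup.subset_closure (by simp)))
  have mE : E ∈ D := by
    right; rw [hE2]; right; simpa using Subgroup.one_mem _
  have hml : (lam⁻¹ - lam) ^ 2 = -3 := by linear_combination h3 - 2 * hlm
  have hs : (B 1 0 * t) ^ 2 = -2 / 3 := by linear_combination hbc - B 1 0 * htb
  have tf : str (B * E * A) = (B 1 0 * t) * (lam⁻¹ - lam) := by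
    simp only [str, sl_mul, e00, e01, e10, e11, F.h00, F.h11, F.h01, F.h10]
    linear_combination - t⁻¹ * lam * htb - lam * B 1 0 * t * htt
  have tfh : str (B * E * A * B) = (B 1 0 * t) * (lam⁻¹ - lam) * (B 0 0 + B 1 1) := by
    simp only [str, sl_mul, e00, e01, e10, e11, F.h00, F.h11, F.h01, F.h10]
    linear_combination - t⁻¹ * lam * (B 0 0 + B 1 1) * htb - lam * B 1 0 * t * (B 0 0 + B 1 1) * htt
  have tf2 : str (B * E * A) ^ 2 = 2 := by
    rw [tf, mul_pow, hml, hs]; norm_num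
  have ha : B 0 0 ^ 2 = 1 / 3 * rw' B := by linear_combination B 0 0 * hb + rw' B * hk
  have hd : B 1 1 ^ 2 = 1 / 3 * (rw' B)⁻¹ := by
    linear_combination -B 1 1 ^2 * hw - (rw' B)⁻¹ * B 1 1 * hb + (rw' B)⁻¹ * hk
  have hε : (((1 / 3 : ℝ) : ℂ) * (rw' B + (rw' B)⁻¹ - (1 : ℝ))) =
      str (B * E * A * B * (B * E * A)⁻¹ * B⁻¹) - 2 - 1 - (-2) := by
    rw [fricke, tfh, ← tf]
    have : str B = B 0 0 + B 1 1 := rfl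
    rw [this]
    push_cast
    linear_combination -tf2 - ha - hd - 2 * hk
  refine crit hD (B * E * A) B (D.mul_mem (D.mul_mem mB mE) mA) mB (-2) _
    (((1 / 3 : ℝ) : ℂ) * (rw' B + (rw' B)⁻¹ - (1 : ℝ))) 0 (by rw [tf2]; norm_num) rfl (by norm_num) (by norm_num)
    hε ?_ ?_ (Or.inr rfl)
  · refine mul_ne_zero (by norm_num) (by push_cast; exact h1)
  · rw [norm_zero, add_zero]
    have := norm_lin_le w0 (1 / 3) 1 (K := 1 / 9) (M := 3) (by norm_num) (by
      refine Nf_box (r0 := 1) (r1 := 1) (C0 := 1) (C1 := 1.189) (c0 := 0.5) (c1 := 1) (by linarith) (by linarith) hC1 hC hc hc1 ?_ ?_ ?_ ?_ ?_ ?_ ?_ ?_ <;> norm_num [Nf])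
    nlinarith [norm_nonneg (((1 / 3 : ℝ) : ℂ) * (rw' B + (rw' B)⁻¹ - (1 : ℝ)))]

lemma fin3aI (F : Frame Γ A B lam (1 / 3)) (hlam : lam ^ 2 = rt 3) (hx : str A ^ 2 = (1 : ℝ))
    (hX : fsq (P * A * P⁻¹) ≤ 2 * 1.0168) (hY : fsq (P * B * P⁻¹) ≤ 2 * 1.0168) :
    PM (Subgroup.closure {A, B * A * B⁻¹}) B := by
  have h1 := cb_3aI F hx hX hY
  obtain ⟨j, j1, j2⟩ := F.rotate (by norm_num) hlam
  rw [cos3] at j1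
  exact PM.rot j ((F.rot j).case3aI hx (by linarith) (by rw [j2]; exact h1))
end Frame

end

section

lemma Nf_cor' {r C c r0 r1 C1 c0 c1 M : ℝ} (hr0 : r0 ≤ r) (hr1 : r ≤ r1) (hC0 : 1 ≤ C) (hC1 : C ≤ C1)
    (hc0 : c0 ≤ c) (hc1 : c ≤ c1)
    (h : (Nf r0 1 c0 ≤ M ∧ Nf r0 1 c1 ≤ M ∧ Nf r0 C1 c0 ≤ M ∧ Nf r0 C1 c1 ≤ M) ∧
     Nf r1 1 c0 ≤ M ∧ Nf r1 1 c1 ≤ M ∧ Nf r1 C1 c0 ≤ M ∧ Nf r1 C1 c1 ≤ M) : Nf r C c ≤ M :=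
  Nf_box hr0 hr1 hC0 hC1 hc0 hc1 h.1.1 h.1.2.1 h.1.2.2.1 h.1.2.2.2 h.2.1 h.2.2.1 h.2.2.2.1 h.2.2.2.2

lemma Nf_cor1 {r C c C1 c0 c1 M : ℝ} (hC0 : 1 ≤ C) (hC1 : C ≤ C1)
    (hc0 : c0 ≤ c) (hc1 : c ≤ c1)
    (h : Nf r 1 c0 ≤ M ∧ Nf r 1 c1 ≤ M ∧ Nf r C1 c0 ≤ M ∧ Nf r C1 c1 ≤ M) : Nf r C c ≤ M :=
  Nf_cor' le_rfl le_rfl hC0 hC1 hc0 hc1 ⟨h, h⟩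

lemma boxes3 {r1 r2 C c : ℝ} (a1 : 1.927 ≤ r1) (b1 : r1 ≤ 1.92708) (a2 : -1.42708 ≤ r2) (b2 : r2 ≤ -1.427)
    (h0 : 1 ≤ C) (hc' : c ≤ 1)
    (hw : (0.5 ≤ c ∧ C ≤ 1.053) ∨ (0.6 ≤ c ∧ C ≤ 1.0612) ∨ (0.8 ≤ c ∧ C ≤ 1.0694)) :
    ∃ M1 M2 M3 M4 M5 X E : ℝ, Nf 1 C c ≤ M1 ∧ Nf (5 / 2) C c ≤ M2 ∧ Nf (-2) C c ≤ M3 ∧ Nf r1 C c ≤ M4 ∧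
      Nf r2 C c ≤ M5 ∧ (4 / 9) * M1 ≤ E ^ 2 ∧ (1024 / 59049) * (M1 * M2 * M3 * M4 * M5) ≤ X ^ 2 ∧
      0 ≤ X ∧ 0 ≤ E ∧ X < 1 ∧ E * (1 + X) < 1 := by
  have box : ∀ C1 c0 c1 : ℝ, ∀ M1 M2 M3 M4 M5 X E : ℝ, c0 ≤ c → c ≤ c1 → C ≤ C1 →
      (Nf 1 1 c0 ≤ M1 ∧ Nf 1 1 c1 ≤ M1 ∧ Nf 1 C1 c0 ≤ M1 ∧ Nf 1 C1 c1 ≤ M1) →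
      (Nf (5 / 2) 1 c0 ≤ M2 ∧ Nf (5 / 2) 1 c1 ≤ M2 ∧ Nf (5 / 2) C1 c0 ≤ M2 ∧ Nf (5 / 2) C1 c1 ≤ M2) →
      (Nf (-2) 1 c0 ≤ M3 ∧ Nf (-2) 1 c1 ≤ M3 ∧ Nf (-2) C1 c0 ≤ M3 ∧ Nf (-2) C1 c1 ≤ M3) →
      ((Nf 1.927 1 c0 ≤ M4 ∧ Nf 1.927 1 c1 ≤ M4 ∧ Nf 1.927 C1 c0 ≤ M4 ∧ Nf 1.927 C1 c1 ≤ M4) ∧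
       (Nf 1.92708 1 c0 ≤ M4 ∧ Nf 1.92708 1 c1 ≤ M4 ∧ Nf 1.92708 C1 c0 ≤ M4 ∧ Nf 1.92708 C1 c1 ≤ M4)) →
      ((Nf (-1.42708) 1 c0 ≤ M5 ∧ Nf (-1.42708) 1 c1 ≤ M5 ∧ Nf (-1.42708) C1 c0 ≤ M5 ∧ Nf (-1.42708) C1 c1 ≤ M5) ∧
       (Nf (-1.427) 1 c0 ≤ M5 ∧ Nf (-1.427) 1 c1 ≤ M5 ∧ Nf (-1.427) C1 c0 ≤ M5 ∧ Nf (-1.427) C1 c1 ≤ M5)) →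
      ((4 / 9) * M1 ≤ E ^ 2 ∧ (1024 / 59049) * (M1 * M2 * M3 * M4 * M5) ≤ X ^ 2 ∧
      0 ≤ X ∧ 0 ≤ E ∧ X < 1 ∧ E * (1 + X) < 1) →
      ∃ M1 M2 M3 M4 M5 X E : ℝ, Nf 1 C c ≤ M1 ∧ Nf (5 / 2) C c ≤ M2 ∧ Nf (-2) C c ≤ M3 ∧ Nf r1 C c ≤ M4 ∧
      Nf r2 C c ≤ M5 ∧ (4 / 9) * M1 ≤ E ^ 2 ∧ (1024 / 59049) * (M1 * M2 * M3 * M4 * M5) ≤ X ^ 2 ∧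
      0 ≤ X ∧ 0 ≤ E ∧ X < 1 ∧ E * (1 + X) < 1 :=
    fun C1 c0 c1 M1 M2 M3 M4 M5 X E h1 h2 h3 g1 g2 g3 g4 g5 g6 =>
      ⟨M1, M2, M3, M4, M5, X, E, Nf_cor1 h0 h3 h1 h2 g1, Nf_cor1 h0 h3 h1 h2 g2, Nf_cor1 h0 h3 h1 h2 g3,
        Nf_cor' a1 b1 h0 h3 h1 h2 g4, Nf_cor' a2 b2 h0 h3 h1 h2 g5, g6⟩
  rcases lt_or_ge c 0.52 with h0 | h0
  · exact box 1.053 0.5 0.52 0.3293 2.4203 9.8974 1.0905 6.6791 0.9982 0.3826 (by rcases hw with h | h | h <;> linarith [h.1, h.2]) (by linarith) (by rcases hw with h | h | h <;> linarith [h.1, h.2]) (by norm_num [Nf]) (by norm_num [Nf]) (by norm_num [Nf]) (by norm_num [Nf]) (by norm_num [Nf]) (by norm_num)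
  rcases lt_or_ge c 0.564 with h1 | h1
  · exact box 1.053 0.52 0.564 0.3321 2.2913 10.4588 1.0098 7.1344 0.9972 0.3842 (by linarith) (by linarith) (by rcases hw with h | h | h <;> linarith [h.1, h.2]) (by norm_num [Nf]) (by norm_num [Nf]) (by norm_num [Nf]) (by norm_num [Nf]) (by norm_num [Nf]) (by norm_num)
  rcases lt_or_ge c 0.6 with h2 | h2
  · exact box 1.053 0.564 0.6 0.3481 2.0188 10.9297 0.8434 7.5184 0.9191 0.3934 (by linarith) (by linarith) (by rcases hw with h | h | h <;> linarith [h.1, h.2]) (by norm_num [Nf]) (by norm_num [Nf]) (by norm_num [Nf]) (by norm_num [Nf]) (by norm_num [Nf]) (by norm_num)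
  rcases lt_or_ge c 0.65 with h3 | h3
  · exact box 1.0612 0.6 0.65 0.4355 1.8274 11.7129 0.7502 8.1687 0.9953 0.44 (by linarith) (by linarith) (by rcases hw with h | h | h <;> linarith [h.1, h.2]) (by norm_num [Nf]) (by norm_num [Nf]) (by norm_num [Nf]) (by norm_num [Nf]) (by norm_num [Nf]) (by norm_num)
  rcases lt_or_ge c 0.73 with h4 | h4
  · exact box 1.0612 0.65 0.73 0.5375 1.5468 12.8336 0.5912 9.0949 0.9975 0.4888 (by linarith) (by linarith) (by rcases hw with h | h | h <;> linarith [h.1, h.2]) (by norm_num [Nf]) (by norm_num [Nf]) (by norm_num [Nf]) (by norm_num [Nf]) (by norm_num [Nf]) (by norm_num)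
  rcases lt_or_ge c 0.8 with h5 | h5
  · exact box 1.0612 0.73 0.8 0.6688 1.1395 13.8563 0.3784 9.9473 0.8303 0.5453 (by linarith) (by linarith) (by rcases hw with h | h | h <;> linarith [h.1, h.2]) (by norm_num [Nf]) (by norm_num [Nf]) (by norm_num [Nf]) (by norm_num [Nf]) (by norm_num [Nf]) (by norm_num)
  rcases lt_or_ge c 0.84 with h6 | h6
  · exact box 1.0694 0.8 0.84 0.8037 0.8293 14.5833 0.2535 10.5612 0.6718 0.5977 (by linarith) (by linarith) (by rcases hw with h | h | h <;> linarith [h.1, h.2]) (by norm_num [Nf]) (by norm_num [Nf]) (by norm_num [Nf]) (by norm_num [Nf]) (by norm_num [Nf]) (by norm_num)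
  rcases lt_or_ge c 0.878 with h7 | h7
  · exact box 1.0694 0.84 0.878 0.9023 0.6724 15.1695 0.1862 11.0543 0.5732 0.6333 (by linarith) (by linarith) (by rcases hw with h | h | h <;> linarith [h.1, h.2]) (by norm_num [Nf]) (by norm_num [Nf]) (by norm_num [Nf]) (by norm_num [Nf]) (by norm_num [Nf]) (by norm_num)
  rcases lt_or_ge c 0.916 with h8 | h8
  · exact box 1.0694 0.878 0.916 1.0125 0.5536 15.7673 0.1341 11.5590 0.4875 0.6709 (by linarith) (by linarith) (by rcases hw with h | h | h <;> linarith [h.1, h.2]) (by norm_num [Nf]) (by norm_num [Nf]) (by norm_num [Nf]) (by norm_num [Nf]) (by norm_num [Nf]) (by norm_num)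
  rcases lt_or_ge c 0.954 with h9 | h9
  · exact box 1.0694 0.916 0.954 1.1341 0.4463 16.3766 0.0935 12.0752 0.4029 0.71 (by linarith) (by linarith) (by rcases hw with h | h | h <;> linarith [h.1, h.2]) (by norm_num [Nf]) (by norm_num [Nf]) (by norm_num [Nf]) (by norm_num [Nf]) (by norm_num [Nf]) (by norm_num)
  rcases lt_or_ge c 0.992 with h10 | h10
  · exact box 1.0694 0.954 0.992 1.2674 0.3505 16.9975 0.0645 12.6030 0.3263 0.7506 (by linarith) (by linarith) (by rcases hw with h | h | h <;> linarith [h.1, h.2]) (by norm_num [Nf]) (by norm_num [Nf]) (by norm_num [Nf]) (by norm_num [Nf]) (by norm_num [Nf]) (by norm_num)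
  exact box 1.0694 0.992 1 1.2969 0.2663 17.1297 0.0471 12.7156 0.2479 0.7593 (by linarith) (by linarith) (by rcases hw with h | h | h <;> linarith [h.1, h.2]) (by norm_num [Nf]) (by norm_num [Nf]) (by norm_num [Nf]) (by norm_num [Nf]) (by norm_num [Nf]) (by norm_num)

namespace Frame
variable {Γ : Subgroup SL2C} {A B P : SL2C} {lam : ℂ} {k2 : ℝ}

lemma tr3aII (a b c d l m z : ℂ) (hl : l * m = 1) (h3 : l ^ 2 + m ^ 2 = -1) (hk : a * d = 2 / 3) (hbc : b * c = -1 / 3)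
    (hz : a ^ 2 + d ^ 2 = 2 / 3 * z) (g h : ℂ)
    (hg : g = (a + d) ^ 3 - 3 * (a + d)) (hh : h = ((a + d) ^ 2 - 1) * (a ^ 2 + d ^ 2 + b * c * (l ^ 2 + m ^ 2)) - (a + d) ^ 2) :
    (a + d) ^ 2 - 4 + 2 = 2 / 3 * (z - 1) ∧
    4 / 27 * (z - 1) * (2 * z - 5) * (z + 2) = (a + d) ^ 2 + g ^ 2 + h ^ 2 - (a + d) * g * h - 2 - 2 - 1 - ((a + d) ^ 2 - 4) := by
  have hT : (a + d) ^ 2 = 2 / 3 * (z + 2) := by linear_combination hz + 2 * hk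
  rw [h3, hbc, hz, hT] at hh
  have h1 : g ^ 2 = 2 / 3 * (z + 2) * (2 / 3 * (z + 2) - 3) ^ 2 := by rw [hg, ← hT]; ring
  have h2 : (a + d) * g = 2 / 3 * (z + 2) * (2 / 3 * (z + 2) - 3) := by rw [hg, ← hT]; ring
  rw [h1, h2, hh, hT]
  constructor <;> ring

lemma case3aII (F : Frame Γ A B lam (2 / 3)) (hx : str A ^ 2 = (1 : ℝ))
    (hwin : (0.5 ≤ cw (rw' B) ∧ Cw (rw' B) ≤ 1.053) ∨ (0.6 ≤ cw (rw' B) ∧ Cw (rw' B) ≤ 1.0612) ∨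
      (0.8 ≤ cw (rw' B) ∧ Cw (rw' B) ≤ 1.0694)) :
    rw' B + (rw' B)⁻¹ = 1 ∨ rw' B + (rw' B)⁻¹ = (1 + 3 * √5) / 4 := by
  by_contra! hcon
  obtain ⟨n1, n2⟩ := hcon
  obtain ⟨q1, q2, q3⟩ := q5
  have q3' : (√5 : ℂ) ^ 2 = 5 := by exact_mod_cast q3
  have hlm : lam * lam⁻¹ = 1 := mul_inv_cancel₀ F.hl
  have h3 := F.lam3 hx
  have hk := F.hk
  have hbc := F.hbc
  have w0 := F.w0
  have hw : rw' B * (rw' B)⁻¹ = 1 := mul_inv_cancel₀ w0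
  have hb := F.b01
  have hdet := sl_det B
  have hC1 := Cw_ge w0
  have hc1 := cw_le w0
  have hc0 : 0.5 ≤ cw (rw' B) := by rcases hwin with h | h | h <;> linarith [h.1]
  have hC2 : Cw (rw' B) ≤ 1.0694 := by rcases hwin with h | h | h <;> linarith [h.2]
  push_cast at hk hbc
  have ha : B 0 0 ^ 2 = 2 / 3 * rw' B := by linear_combination B 0 0 * hb + rw' B * hk
  have hd : B 1 1 ^ 2 = 2 / 3 * (rw' B)⁻¹ := by
    linear_combination -B 1 1 ^2 * hw - (rw' B)⁻¹ * B 1 1 * hb + (rw' B)⁻¹ * hk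
  obtain ⟨p1, p2⟩ := tr3aII (B 0 0) (B 0 1) (B 1 0) (B 1 1) lam lam⁻¹ (rw' B + (rw' B)⁻¹) hlm h3 hk
    (by linear_combination hbc) (by linear_combination ha + hd) (str (A * (B * B * B) * A⁻¹)) (str (B * (A * (B * B * B) * A⁻¹)))
    (by
      rw [str_conj]
      simp only [str, sl_mul]
      clear F hx hwin n1 n2 hb hw ha hd hk hbc hC1 hC2 hc1 hc0 w0
      generalize B 0 0 = a at *; generalize B 0 1 = b at *; generalize B 1 0 = c at *; generalize B 1 1 = d at *
      grind)
    (by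
      simp only [str, sl_mul, sl_inv00, sl_inv01, sl_inv10, sl_inv11, F.h00, F.h11, F.h01, F.h10]
      clear F hx hwin n1 n2 hb hw ha hd hk hbc hC1 hC2 hc1 hc0 w0 h3
      generalize lam⁻¹ = m at *
      generalize B 0 0 = a at *; generalize B 0 1 = b at *; generalize B 1 0 = c at *; generalize B 1 1 = d at *
      grind)
  have hstr : str B = B 0 0 + B 1 1 := rfl
  set z := rw' B + (rw' B)⁻¹ with hz
  have hre : ∀ r : ℝ, z - r = 0 → r = 2 * Cw (rw' B) * cw (rw' B) := fun r h => zeta_re w0 h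
  have hpos : 0 < Cw (rw' B) * cw (rw' B) := by apply mul_pos <;> linarith
  have hle : Cw (rw' B) * cw (rw' B) ≤ 1.0694 := by nlinarith
  have z1 : z - (1 : ℝ) ≠ 0 := by push_cast; exact sub_ne_zero.2 n1
  have z2 : z - (5 / 2 : ℝ) ≠ 0 := fun h => by linarith [hre _ h]
  have z3 : z - (-2 : ℝ) ≠ 0 := fun h => by linarith [hre _ h]
  have z4 : z - ((1 + 3 * √5) / 4 : ℝ) ≠ 0 := by push_cast; exact sub_ne_zero.2 n2
  have z5 : z - ((1 - 3 * √5) / 4 : ℝ) ≠ 0 := fun h => by linarith [hre _ h]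
  have z6 : z - (4 : ℝ) ≠ 0 := fun h => by linarith [hre _ h]
  obtain ⟨M1, M2, M3, M4, M5, X, E, m1, m2, m3, m4, m5, hE, hX, X0, E0, X1, EX⟩ :=
    boxes3 (r1 := (1 + 3 * √5) / 4) (r2 := (1 - 3 * √5) / 4) (by linarith) (by linarith) (by linarith) (by linarith) hC1 hc1 hwin
  rw [← norm_add_inv w0, ← hz] at m1 m2 m3 m4 m5
  set x1 : ℂ := ((32 / 243 : ℝ) : ℂ) * (z - (1 : ℝ)) * (z - (5 / 2 : ℝ)) * (z - (-2 : ℝ)) * (z - ((1 + 3 * √5) / 4 : ℝ)) * (z - ((1 - 3 * √5) / 4 : ℝ)) with hx1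
  have hx1b : ‖x1‖ ≤ X := by
    refine le_of_sq_le_sq (le_trans ?_ hX) X0
    rw [hx1]
    simp only [norm_mul, mul_pow]
    rw [Complex.norm_real, Real.norm_eq_abs, sq_abs]
    have p1 := (sq_nonneg _).trans m1
    have p2 := (sq_nonneg _).trans m2
    have p3 := (sq_nonneg _).trans m3
    have p4 := (sq_nonneg _).trans m4
    calc _ ≤ (32 / 243 : ℝ) ^ 2 * M1 * M2 * M3 * M4 * M5 := by gcongr
      _ = _ := by ring
  set η : ℂ := ((2 / 3 : ℝ) : ℂ) * (z - (1 : ℝ)) with hη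
  have hηb : ‖η‖ ≤ E := by
    refine le_of_sq_le_sq (le_trans ?_ hE) E0
    rw [hη, norm_mul, mul_pow, Complex.norm_real, Real.norm_eq_abs, sq_abs]
    calc _ ≤ (2 / 3 : ℝ) ^ 2 * M1 := by gcongr
      _ = _ := by ring
  have hη0 : η ≠ 0 := mul_ne_zero (by norm_num) z1
  have key : (4 / 27 * (z - 1) * (2 * z - 5) * (z + 2)) * (4 / 27 * (z - 1) * (2 * z - 5) * (z + 2) + η) = η * x1 := by
    rw [hx1, hη]; push_cast
    linear_combination (4 / 81 * (z - 1) ^ 2 * (z - 5 / 2) * (z + 2)) * q3'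
  have hηn : 0 < ‖η‖ := norm_pos_iff.2 hη0
  refine crit_it F.db B (A * (B * B * B) * A⁻¹) F.hB
    (Γ.mul_mem (Γ.mul_mem F.hA (Γ.mul_mem (Γ.mul_mem F.hB F.hB) F.hB)) (Γ.inv_mem F.hA))
    _ _ (4 / 27 * (z - 1) * (2 * z - 5) * (z + 2)) η rfl rfl ?_ ?_ ?_ ?_ ?_ (Or.inl ?_)
  · rw [hstr]
    have : (B 0 0 + B 1 1) ^ 2 - 4 = 2 / 3 * (z - (4 : ℝ)) := by push_cast; linear_combination p1
    rw [this]
    exact mul_ne_zero (by norm_num) z6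
  · rw [hstr, hη]; push_cast; linear_combination -p1
  · rw [fricke, hstr]; exact p2
  · rw [key]
    refine mul_ne_zero hη0 ?_
    rw [hx1]
    exact mul_ne_zero (mul_ne_zero (mul_ne_zero (mul_ne_zero (mul_ne_zero (by norm_num) z1) z2) z3) z4) z5
  · rw [key, norm_mul]
    have : ‖η‖ * (1 + ‖x1‖) ≤ E * (1 + X) := by gcongr
    linarith
  · rw [key, norm_mul]
    nlinarith
end Frame

end

section
set_option linter.unusedSimpArgs false

lemma iso_of {H T : Type*} [Group H] [Group T] (a c : H) (α γ : T)
    (h1 : ∀ g : H, ((g, 1) : H × T) ∈ Subgroup.closure {(a, α), (c, γ)} → g = 1)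
    (h2 : ∀ τ : T, ((1, τ) : H × T) ∈ Subgroup.closure {(a, α), (c, γ)} → τ = 1)
    (hT : Subgroup.closure {α, γ} = (⊤ : Subgroup T)) :
    Nonempty (Subgroup.closure {a, c} ≃* T) := by
  set L : Subgroup (H × T) := Subgroup.closure {(a, α), (c, γ)} with hL
  have i1 : Function.Injective ((MonoidHom.fst H T).comp L.subtype) := by
    rw [injective_iff_map_eq_one]
    rintro ⟨⟨g, τ⟩, hg⟩ h
    have hg1 : g = 1 := h
    subst hg1
    have := h2 τ hg
    subst this
    rfl
  have i2 : Function.Injective ((MonoidHom.snd H T).comp L.subtype) := by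
    rw [injective_iff_map_eq_one]
    rintro ⟨⟨g, τ⟩, hg⟩ h
    have hg1 : τ = 1 := h
    subst hg1
    have := h1 g hg
    subst this
    rfl
  have r1 : ((MonoidHom.fst H T).comp L.subtype).range = Subgroup.closure {a, c} := by
    rw [MonoidHom.range_comp, Subgroup.range_subtype, hL, MonoidHom.map_closure, Set.image_pair]; rfl
  have r2 : ((MonoidHom.snd H T).comp L.subtype).range = ⊤ := by
    rw [MonoidHom.range_comp, Subgroup.range_subtype, hL, MonoidHom.map_closure, Set.image_pair, ← hT]; rfl
  have e1 := MonoidHom.ofInjective i1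
  have e2 := MonoidHom.ofInjective i2
  rw [r1] at e1
  rw [r2] at e2
  exact ⟨(e1.symm.trans e2).trans Subgroup.topEquiv⟩

lemma conj_stable {G : Type*} [Group G] (a c : G) (ha : a * a * a = 1) (hc : c * c = 1) (R : Set G)
    (ra : ∀ x ∈ R, a * x * a⁻¹ ∈ R) (rc : ∀ x ∈ R, c * x * c⁻¹ ∈ R) (g : G) (hg : g ∈ Subgroup.closure {a, c}) :
    ∀ x ∈ R, g * x * g⁻¹ ∈ R ∧ g⁻¹ * x * g ∈ R := by
  have ai : a⁻¹ = a * a := inv_eq_of_mul_eq_one_left ha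
  have ci : c⁻¹ = c := inv_eq_of_mul_eq_one_left hc
  induction hg using Subgroup.closure_induction with
  | mem y hy =>
    intro x hx
    rcases hy with rfl | hy
    · refine ⟨ra x hx, ?_⟩
      have := ra _ (ra x hx)
      rw [ai]
      convert this using 1
      rw [ai]
      have h4 : y * y * (y * y) = y := by rw [← mul_assoc, ha, one_mul]
      calc y * y * x * y = y * y * x * (y * y * (y * y)) := by rw [h4]
        _ = _ := by simp only [mul_assoc]
    · rw [Set.mem_singleton_iff] at hy
      subst hy
      exact ⟨rc x hx, by have := rc x hx; rwa [ci] at this ⊢⟩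
  | one => intro x hx; simpa using hx
  | mul y z _ _ hy hz =>
    intro x hx
    constructor
    · have := (hy _ (hz x hx).1).1
      convert this using 1; group
    · have := (hz _ (hy x hx).2).2
      convert this using 1; group
  | inv y _ hy => intro x hx; have := hy x hx; rw [inv_inv]; exact ⟨this.2, this.1⟩

lemma stab4 {G : Type*} [Group G] (a c : G) (ha : a * a * a = 1) (hc : c * c = 1)
    (h4 : a * c * (a * c) * (a * c) * (a * c) = 1) (g : G) (hg : g ∈ Subgroup.closure {a, c}) :
    g * (a * c) * g⁻¹ ∈ ({a * c, c * a, a⁻¹ * c * a⁻¹, c * a⁻¹, a⁻¹ * c, a * c * a} : Set G) := by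
  have ai : a⁻¹ = a * a := inv_eq_of_mul_eq_one_left ha
  have ci : c⁻¹ = c := inv_eq_of_mul_eq_one_left hc
  have aa : ∀ x, a * (a * (a * x)) = x := fun x => by rw [← mul_assoc, ← mul_assoc, ha, one_mul]
  have aa' : a * (a * a) = 1 := by rw [← mul_assoc, ha]
  have cc : ∀ x, c * (c * x) = x := fun x => by rw [← mul_assoc, hc, one_mul]
  have k : c * (a * (c * (a * c))) = a * (a * (c * (a * a))) := by
    have : c * (a * (c * (a * c))) = a⁻¹ * (a * c * (a * c) * (a * c) * (a * c)) * (c⁻¹ * a⁻¹) := by group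
    rw [this, h4, ci, ai]; simp only [mul_assoc, mul_one]
  have k' : c * (a * (a * (c * (a * (a * c))))) = a * (c * a) := by
    have h5 : c * (c * (a * (c * (a * c)))) * c = c * (a * (a * (c * (a * a)))) * c := by rw [k]
    simp only [mul_assoc, cc, hc, mul_one] at h5
    exact h5.symm
  refine (conj_stable a c ha hc _ ?_ ?_ g hg _ (by simp)).1
  · intro x hx
    simp only [Set.mem_insert_iff, Set.mem_singleton_iff, ai, ci, mul_assoc] at hx ⊢
    rcases hx with rfl | rfl | rfl | rfl | rfl | rfl <;> simp [mul_assoc, aa, aa', cc, hc]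
  · intro x hx
    simp only [Set.mem_insert_iff, Set.mem_singleton_iff, ai, ci, mul_assoc] at hx ⊢
    rcases hx with rfl | rfl | rfl | rfl | rfl | rfl <;> simp [mul_assoc, aa, aa', cc, hc, k, k']

lemma stab5 {G : Type*} [Group G] (a c : G) (ha : a * a * a = 1) (hc : c * c = 1)
    (h5 : a * c * (a * c) * (a * c) * (a * c) * (a * c) = 1) (g : G) (hg : g ∈ Subgroup.closure {a, c}) :
    g * (a * c) * g⁻¹ ∈ ({a * c, c * a, a⁻¹ * c * a⁻¹, c * a⁻¹ * c * a⁻¹ * c, a⁻¹ * c * a * c, c * a * c * a⁻¹,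
      c * a⁻¹, a⁻¹ * c, a * c * a, c * a * c * a * c, c * a⁻¹ * c * a, a * c * a⁻¹ * c} : Set G) := by
  have ai : a⁻¹ = a * a := inv_eq_of_mul_eq_one_left ha
  have ci : c⁻¹ = c := inv_eq_of_mul_eq_one_left hc
  have aa : ∀ x, a * (a * (a * x)) = x := fun x => by rw [← mul_assoc, ← mul_assoc, ha, one_mul]
  have aa' : a * (a * a) = 1 := by rw [← mul_assoc, ha]
  have cc : ∀ x, c * (c * x) = x := fun x => by rw [← mul_assoc, hc, one_mul]
  have k : a * (c * (a * (c * a))) = c * (a * (a * (c * (a * (a * c))))) := by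
    have : a * (c * (a * (c * a))) = (a * c * (a * c) * (a * c) * (a * c) * (a * c)) * (c⁻¹ * a⁻¹ * c⁻¹ * a⁻¹ * c⁻¹) := by group
    rw [this, h5, ci, ai]; simp only [mul_assoc, one_mul]
  have k1 : ∀ x, c * (a * (a * (c * (a * (a * (c * x)))))) = a * (c * (a * (c * (a * x)))) := by
    intro x
    have := congrArg (· * x) k
    simp only [mul_assoc] at this
    exact this.symm
  have k3 : c * (a * (c * (a * c))) = a * (a * (c * (a * (a * (c * (a * a)))))) := by
    have := congrArg (·⁻¹) k
    simp only [_root_.mul_inv_rev, ai, ci, mul_assoc, aa] at this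
    exact this.symm
  have k2 : ∀ x, c * (a * (c * (a * (c * x)))) = a * (a * (c * (a * (a * (c * (a * (a * x))))))) := by
    intro x
    have := congrArg (· * x) k3
    simpa only [mul_assoc] using this
  refine (conj_stable a c ha hc _ ?_ ?_ g hg _ (by simp)).1
  · intro x hx
    simp only [Set.mem_insert_iff, Set.mem_singleton_iff, ai, ci, mul_assoc] at hx ⊢
    rcases hx with rfl | rfl | rfl | rfl | rfl | rfl | rfl | rfl | rfl | rfl | rfl | rfl <;> simp [mul_assoc, aa, aa', cc, hc, k]
    all_goals simp [k1, k2, k3, aa, aa', cc, hc]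
  · intro x hx
    simp only [Set.mem_insert_iff, Set.mem_singleton_iff, ai, ci, mul_assoc] at hx ⊢
    rcases hx with rfl | rfl | rfl | rfl | rfl | rfl | rfl | rfl | rfl | rfl | rfl | rfl <;> simp [mul_assoc, aa, aa', cc, hc, k]

end

section

lemma one00 : (1 : SL2C) 0 0 = 1 := by simp
lemma one01 : (1 : SL2C) 0 1 = 0 := by simp
lemma one10 : (1 : SL2C) 1 0 = 0 := by simp
lemma one11 : (1 : SL2C) 1 1 = 1 := by simp
lemma neg_ap (X : SL2C) (i j : Fin 2) : (-X) i j = - X i j := by simp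

lemma scalar_pm {X : SL2C} (h01 : X 0 1 = 0) (h10 : X 1 0 = 0) (h : X 0 0 = X 1 1) : X = 1 ∨ X = -1 := by
  have hd := sl_det X
  have h2 : (X 0 0 - 1) * (X 0 0 + 1) = 0 := by rw [h01, ← h] at hd; linear_combination hd
  rcases mul_eq_zero.1 h2 with h3 | h3
  · left
    apply sl_ext
    · rw [one00]; linear_combination h3
    · rw [one01, h01]
    · rw [one10, h10]
    · rw [one11, ← h]; linear_combination h3
  · right
    apply sl_ext
    · rw [neg_ap, one00]; linear_combination h3
    · rw [neg_ap, one01, h01, neg_zero]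
    · rw [neg_ap, one10, h10, neg_zero]
    · rw [neg_ap, one11, ← h]; linear_combination h3

/-- Chebyshev-type polynomials giving the powers of a unimodular matrix. -/
def chU (t : ℂ) : ℕ → ℂ
  | 0 => 0
  | 1 => 1
  | (k + 2) => t * chU t (k + 1) - chU t k

lemma pw (M : SL2C) (k : ℕ) (i j : Fin 2) :
    (M ^ (k + 1)) i j = chU (str M) (k + 1) * M i j - chU (str M) k * (1 : SL2C) i j := by
  induction k generalizing i j with
  | zero => simp [chU]
  | succ k ih =>
    have hd := sl_det M
    rw [pow_succ, sl_mul, ih, ih, chU]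
    generalize chU (str M) (k + 1) = x
    generalize chU (str M) k = y
    unfold str
    fin_cases i <;> fin_cases j <;> simp only [Fin.zero_eta, Fin.mk_one, one00, one01, one10, one11]
    · linear_combination -x * hd
    · ring
    · ring
    · linear_combination -x * hd

lemma U_zero {M : SL2C} {k : ℕ} (h : M ^ (k + 1) = 1 ∨ M ^ (k + 1) = -1) (h1 : M ≠ 1) (h2 : M ≠ -1) :
    chU (str M) (k + 1) = 0 := by
  by_contra hU
  have key : ∀ s : ℂ, (∀ i j, (M ^ (k + 1)) i j = s * (1 : SL2C) i j) → False := by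
    intro s hs
    have a01 := pw M k 0 1
    have a10 := pw M k 1 0
    have a00 := pw M k 0 0
    have a11 := pw M k 1 1
    rw [hs] at a01 a10 a00 a11
    rw [one01] at a01
    rw [one10] at a10
    rw [one00] at a00
    rw [one11] at a11
    have e1 : chU (str M) (k + 1) * M 0 1 = 0 := by linear_combination -a01
    have e2 : chU (str M) (k + 1) * M 1 0 = 0 := by linear_combination -a10
    have e3 : chU (str M) (k + 1) * (M 0 0 - M 1 1) = 0 := by linear_combination a11 - a00
    have f1 := (mul_eq_zero.1 e1).resolve_left hU
    have f2 := (mul_eq_zero.1 e2).resolve_left hU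
    have f3 := (mul_eq_zero.1 e3).resolve_left hU
    rcases scalar_pm f1 f2 (sub_eq_zero.1 f3) with h | h
    · exact h1 h
    · exact h2 h
  rcases h with h | h
  · exact key 1 (fun i j => by rw [h, one_mul])
  · exact key (-1) (fun i j => by rw [h, neg_ap]; ring)

lemma pow_of_U {M : SL2C} {k : ℕ} (h : chU (str M) (k + 1) = 0) : M ^ (k + 1) = 1 ∨ M ^ (k + 1) = -1 := by
  apply scalar_pm
  · rw [pw, h, one01]; ring
  · rw [pw, h, one10]; ring
  · rw [pw, pw, h, one00, one11]; ring

lemma chU2 (t : ℂ) : chU t 2 = t := by simp [chU]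
lemma chU3 (t : ℂ) : chU t 3 = t ^ 2 - 1 := by simp only [chU]; ring
lemma chU4 (t : ℂ) : chU t 4 = t * (t ^ 2 - 2) := by simp [chU]; ring
lemma chU5 (t : ℂ) : chU t 5 = t ^ 4 - 3 * t ^ 2 + 1 := by simp [chU]; ring

/-- The projection to PSL(2,C). -/
def mkP : SL2C →* PSL2C := QuotientGroup.mk' (Subgroup.center SL2C)

lemma mem_center (X : SL2C) : X ∈ Subgroup.center SL2C ↔ X = 1 ∨ X = -1 := by
  constructor
  · intro h
    rw [Matrix.SpecialLinearGroup.mem_center_iff] at h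
    obtain ⟨r, _, hr⟩ := h
    have e : ∀ i j, X i j = (Matrix.scalar (Fin 2) r) i j := fun i j => by rw [hr]
    apply scalar_pm
    · rw [e]; simp
    · rw [e]; simp
    · rw [e, e]; simp
  · rintro (rfl | rfl)
    · exact Subgroup.one_mem _
    · rw [Subgroup.mem_center_iff]; intro g; simp

lemma mkP_one {X : SL2C} : mkP X = 1 ↔ X = 1 ∨ X = -1 := by
  rw [← mem_center]; exact QuotientGroup.eq_one_iff X

lemma mkP_neg (X : SL2C) : mkP (-X) = mkP X := by
  have : mkP (-1) = 1 := mkP_one.2 (Or.inr rfl)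
  have h : -X = -1 * X := by simp
  rw [h, map_mul, this, one_mul]

lemma mkP_eq {X Y : SL2C} : mkP X = mkP Y ↔ X = Y ∨ X = -Y := by
  constructor
  · intro h
    have : mkP (X * Y⁻¹) = 1 := by rw [map_mul, map_inv, h, mul_inv_cancel]
    rcases mkP_one.1 this with h | h
    · left; exact mul_inv_eq_one.1 h
    · right; rw [mul_inv_eq_iff_eq_mul] at h; rw [h]; simp
  · rintro (rfl | rfl)
    · rfl
    · rw [mkP_neg]

lemma mkP_surj (g : PSL2C) : ∃ X, mkP X = g := QuotientGroup.mk'_surjective _ g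

lemma psl_closure (A B : SL2C) : pslImage (Subgroup.closure {A, B}) = Subgroup.closure {mkP A, mkP B} := by
  unfold pslImage
  rw [MonoidHom.map_closure, Set.image_pair]; rfl

lemma mkP_pow_of_U {M : SL2C} {k : ℕ} (h : chU (str M) (k + 1) = 0) : mkP M ^ (k + 1) = 1 := by
  rw [← map_pow, mkP_one]; exact pow_of_U h

end

section

lemma comm_one {A C : SL2C} {l m : ℂ} (h00 : A 0 0 = l) (h11 : A 1 1 = m) (h01 : A 0 1 = 0) (h10 : A 1 0 = 0)
    (hlm : l * m = 1) (h3 : l ^ 2 + m ^ 2 = -1) (hq : C 0 1 ≠ 0) (hr : C 1 0 ≠ 0)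
    (ht : str (A * C) ≠ 0) {g : PSL2C} (h1 : g * (mkP A * mkP C) * g⁻¹ = mkP A * mkP C)
    (h2 : g * (mkP C * mkP A) * g⁻¹ = mkP C * mkP A) : g = 1 := by
  obtain ⟨G, rfl⟩ := mkP_surj g
  have key : ∀ M : SL2C, str M ≠ 0 → mkP G * mkP M * (mkP G)⁻¹ = mkP M → G * M = M * G := by
    intro M hM h
    rw [← map_mul, ← map_inv, ← map_mul, mkP_eq] at h
    rcases h with h | h
    · rw [mul_inv_eq_iff_eq_mul] at h; exact h
    · exfalso
      have := str_conj G M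
      rw [h] at this
      apply hM
      have e : str (-M) = - str M := by unfold str; rw [neg_ap, neg_ap]; ring
      rw [e] at this
      linear_combination -this / 2
  have ht' : str (C * A) ≠ 0 := by
    intro h; apply ht; rw [← h]; unfold str; simp only [sl_mul]; ring
  rw [← map_mul] at h1 h2
  have e1 := key _ ht h1
  have e2 := key _ ht' h2
  have f1 := congrArg (fun X : SL2C => X 0 0) e1
  have f2 := congrArg (fun X : SL2C => X 0 0) e2
  have f3 := congrArg (fun X : SL2C => X 0 1) e1
  simp only [sl_mul, h00, h11, h01, h10] at f1 f2 f3
  rw [mkP_one]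
  have hl0 : l ≠ 0 := left_ne_zero_of_mul_eq_one hlm
  have hm0 : m ≠ 0 := right_ne_zero_of_mul_eq_one hlm
  have l4 : l ^ 2 - m ^ 2 ≠ 0 := by
    intro h
    have e : l ^ 2 = -1 / 2 := by linear_combination (h3 + h) / 2
    have e' : m ^ 2 = -1 / 2 := by linear_combination (h3 - h) / 2
    have : l ^ 2 * m ^ 2 = 1 := by linear_combination (l * m + 1) * hlm
    rw [e, e'] at this; norm_num at this
  have y0 : G 0 1 = 0 := by
    have : (l ^ 2 - m ^ 2) * (G 0 1 * C 1 0) = 0 := by linear_combination l * f2 - m * f1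
    have := (mul_eq_zero.1 this).resolve_left l4
    exact (mul_eq_zero.1 this).resolve_right hr
  have z0 : G 1 0 = 0 := by
    rw [y0] at f1
    have : l * C 0 1 * G 1 0 = 0 := by linear_combination -f1
    exact (mul_eq_zero.1 this).resolve_left (mul_ne_zero hl0 hq)
  refine scalar_pm y0 z0 ?_
  rw [y0] at f3
  have : l * C 0 1 * (G 0 0 - G 1 1) = 0 := by linear_combination f3
  have := (mul_eq_zero.1 this).resolve_left (mul_ne_zero hl0 hq)
  linear_combination this

def al4 : Equiv.Perm (Fin 4) := finRotate 4 * Equiv.swap 0 1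

lemma top4 : Subgroup.closure {al4, Equiv.swap 0 1} = (⊤ : Subgroup (Equiv.Perm (Fin 4))) := by
  have h := Equiv.Perm.closure_cycle_adjacent_swap (σ := finRotate 4) isCycle_finRotate support_finRotate 0
  rw [eq_top_iff, ← h, Subgroup.closure_le]
  have hs : Equiv.swap 0 1 ∈ Subgroup.closure {al4, Equiv.swap 0 1} := Subgroup.subset_closure (by simp)
  have ha : al4 ∈ Subgroup.closure {al4, Equiv.swap 0 1} := Subgroup.subset_closure (by simp)
  intro x hx
  rcases hx with rfl | hx
  · have := mul_mem ha hs
    unfold al4 at this ⊢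
    simpa [mul_assoc] using this
  · rw [Set.mem_singleton_iff] at hx
    subst hx
    exact hs

lemma dec4 : ∀ τ : Equiv.Perm (Fin 4), τ * (al4 * Equiv.swap 0 1) * τ⁻¹ = al4 * Equiv.swap 0 1 →
    τ * (Equiv.swap 0 1 * al4) * τ⁻¹ = Equiv.swap 0 1 * al4 → τ = 1 := by decide

lemma prod_grp {H T : Type*} [Group H] [Group T] {a : H} {b : T} : ((a, b) : H × T)⁻¹ = (a⁻¹, b⁻¹) := rfl

lemma isoS4 {A C : SL2C} {l m : ℂ} (h00 : A 0 0 = l) (h11 : A 1 1 = m) (h01 : A 0 1 = 0) (h10 : A 1 0 = 0)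
    (hlm : l * m = 1) (h3 : l ^ 2 + m ^ 2 = -1) (hC : C 1 1 = - C 0 0) (hp : C 0 0 ^ 2 = -2 / 3) :
    Nonempty (pslImage (Subgroup.closure {A, C}) ≃* Equiv.Perm (Fin 4)) := by
  rw [psl_closure]
  have hd := sl_det C
  have hqr : C 0 1 * C 1 0 = -1 / 3 := by rw [hC] at hd; linear_combination -hd - hp
  have hq : C 0 1 ≠ 0 := fun h => by rw [h, zero_mul] at hqr; norm_num at hqr
  have hr : C 1 0 ≠ 0 := fun h => by rw [h, mul_zero] at hqr; norm_num at hqr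
  have hp0 : C 0 0 ≠ 0 := fun h => by rw [h] at hp; norm_num at hp
  have st : str (A * C) = (l - m) * C 0 0 := by unfold str; simp only [sl_mul, h00, h11, h01, h10, hC]; ring
  have st2 : str (A * C) ^ 2 = 2 := by
    rw [st]; linear_combination (l - m) ^ 2 * hp - 2 / 3 * h3 + 4 / 3 * hlm
  have st0 : str (A * C) ≠ 0 := fun h => by rw [h] at st2; norm_num at st2
  have pa : mkP A * mkP A * mkP A = 1 := by
    have : mkP A ^ 3 = 1 := mkP_pow_of_U (by
      rw [chU3]; unfold str; rw [h00, h11]; linear_combination h3 + 2 * hlm)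
    rw [← this, pow_three']
  have pc : mkP C * mkP C = 1 := by
    have : mkP C ^ 2 = 1 := mkP_pow_of_U (by rw [chU2]; unfold str; rw [hC]; ring)
    rw [← this, pow_two]
  have p4 : mkP A * mkP C * (mkP A * mkP C) * (mkP A * mkP C) * (mkP A * mkP C) = 1 := by
    have : mkP (A * C) ^ 4 = 1 := mkP_pow_of_U (by rw [chU4, st2]; ring)
    rw [← this, map_mul, pow_succ, pow_three']
  have t3 : al4 * al4 * al4 = 1 := by decide
  have t2 : Equiv.swap 0 1 * Equiv.swap 0 1 = (1 : Equiv.Perm (Fin 4)) := by decide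
  have t4 : al4 * Equiv.swap 0 1 * (al4 * Equiv.swap 0 1) * (al4 * Equiv.swap 0 1) * (al4 * Equiv.swap 0 1) = 1 := by decide
  have stab := stab4 ((mkP A, al4) : PSL2C × Equiv.Perm (Fin 4)) (mkP C, Equiv.swap 0 1)
    (by rw [Prod.mk_mul_mk, Prod.mk_mul_mk, pa, t3]; rfl)
    (by rw [Prod.mk_mul_mk, pc, t2]; rfl)
    (by simp only [Prod.mk_mul_mk]; rw [p4, t4]; rfl)
  have mA : ((mkP A, al4) : PSL2C × Equiv.Perm (Fin 4)) ∈ Subgroup.closure {(mkP A, al4), (mkP C, Equiv.swap 0 1)} :=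
    Subgroup.subset_closure (by simp)
  have l2 : l ^ 4 + l ^ 2 + 1 = 0 := by linear_combination l ^ 2 * h3 - (l * m + 1) * hlm
  have l1 : l ^ 2 ≠ 1 := fun h => by
    have e : l ^ 4 + l ^ 2 + 1 = 3 := by linear_combination (l ^ 2 + 2) * h
    rw [e] at l2; norm_num at l2
  have l1' : l ^ 2 ≠ -1 := fun h => by
    have e : l ^ 4 + l ^ 2 + 1 = 1 := by linear_combination l ^ 2 * h
    rw [e] at l2; norm_num at l2
  have hl0 : l ≠ 0 := left_ne_zero_of_mul_eq_one hlm
  apply iso_of _ _ al4 (Equiv.swap 0 1) ?_ ?_ top4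
  · have base : ∀ g : PSL2C, ((g, 1) : PSL2C × Equiv.Perm (Fin 4)) ∈ Subgroup.closure {(mkP A, al4), (mkP C, Equiv.swap 0 1)} →
        g * (mkP A * mkP C) * g⁻¹ = mkP A * mkP C := by
      intro g hg
      have := stab _ hg
      simp only [Prod.mk_mul_mk, prod_grp, Set.mem_insert_iff, Set.mem_singleton_iff, Prod.mk.injEq] at this
      rcases this with h | h | h | h | h | h
      · exact h.1
      all_goals exfalso; revert h; rintro ⟨-, h⟩; revert h; decide
    intro g hg
    have b1 := base g hg
    have b2 := base (mkP A * g * (mkP A)⁻¹) (by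
      have := mul_mem (mul_mem mA hg) (inv_mem mA)
      simpa [Prod.mk_mul_mk, prod_grp] using this)
    refine comm_one h00 h11 h01 h10 hlm h3 hq hr st0 b1 ?_
    have : mkP C * mkP A = (mkP A)⁻¹ * (mkP A * mkP C) * mkP A := by group
    rw [this]
    nth_rewrite 2 [← b2]
    group
  · have base : ∀ τ : Equiv.Perm (Fin 4), ((1, τ) : PSL2C × Equiv.Perm (Fin 4)) ∈ Subgroup.closure {(mkP A, al4), (mkP C, Equiv.swap 0 1)} →
        τ * (al4 * Equiv.swap 0 1) * τ⁻¹ = al4 * Equiv.swap 0 1 := by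
      intro τ hτ
      have := stab _ hτ
      simp only [Prod.mk_mul_mk, prod_grp, Set.mem_insert_iff, Set.mem_singleton_iff, Prod.mk.injEq, one_mul, inv_one, mul_one] at this
      simp only [← map_mul, ← map_inv, mkP_eq] at this
      rcases this with h | h | h | h | h | h
      · exact h.2
      all_goals
        exfalso
        rcases h with ⟨h | h, -⟩
        all_goals
          have f1 := congrArg (fun X : SL2C => X 0 0) h
          have f2 := congrArg (fun X : SL2C => X 0 1) h
          simp only [sl_mul, h00, h11, h01, h10, hC, neg_ap, sl_inv00, sl_inv01, sl_inv10, sl_inv11] at f1 f2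
          clear h stab mA pa pc p4 st st2 st0 hd h00 h11 h01 h10 hC
          generalize C 0 0 = p at *
          generalize C 0 1 = q at *
          grind
    intro g hg
    have b1 := base g hg
    have b2 := base (al4 * g * al4⁻¹) (by
      have := mul_mem (mul_mem mA hg) (inv_mem mA)
      simpa [Prod.mk_mul_mk, prod_grp] using this)
    refine dec4 g b1 ?_
    have : Equiv.swap 0 1 * al4 = al4⁻¹ * (al4 * Equiv.swap 0 1) * al4 := by group
    rw [this]
    nth_rewrite 2 [← b2]
    group

end

section

def al5 : alternatingGroup (Fin 5) := ⟨Equiv.swap 0 1 * Equiv.swap 1 2, Equiv.Perm.mem_alternatingGroup.2 (by decide)⟩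
def ga5 : alternatingGroup (Fin 5) := ⟨Equiv.swap 0 3 * Equiv.swap 1 4, Equiv.Perm.mem_alternatingGroup.2 (by decide)⟩

lemma t3_5 : al5 * al5 * al5 = 1 := by decide
lemma t2_5 : ga5 * ga5 = 1 := by decide
lemma t5_5 : al5 * ga5 * (al5 * ga5) * (al5 * ga5) * (al5 * ga5) * (al5 * ga5) = 1 := by
  set_option maxRecDepth 4000 in decide

lemma top5 : Subgroup.closure {al5, ga5} = (⊤ : Subgroup (alternatingGroup (Fin 5))) := by
  set K := Subgroup.closure {al5, ga5} with hK
  have ma : al5 ∈ K := Subgroup.subset_closure (by simp)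
  have mg : ga5 ∈ K := Subgroup.subset_closure (by simp)
  have o3 : orderOf al5 = 3 := by
    have : Fact (Nat.Prime 3) := ⟨by norm_num⟩
    exact orderOf_eq_prime (by rw [pow_three']; exact t3_5) (by decide)
  have o2 : orderOf ga5 = 2 := by
    have : Fact (Nat.Prime 2) := ⟨by norm_num⟩
    exact orderOf_eq_prime (by rw [pow_two]; exact t2_5) (by decide)
  have o5 : orderOf (al5 * ga5) = 5 := by
    have : Fact (Nat.Prime 5) := ⟨by norm_num⟩
    exact orderOf_eq_prime (by rw [pow_succ, pow_succ, pow_three']; exact t5_5) (by decide)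
  have d3 := Subgroup.orderOf_dvd_natCard K ma
  have d2 := Subgroup.orderOf_dvd_natCard K mg
  have d5 := Subgroup.orderOf_dvd_natCard K (mul_mem ma mg)
  rw [o3] at d3
  rw [o2] at d2
  rw [o5] at d5
  have hc : Nat.card (alternatingGroup (Fin 5)) = 60 := by
    rw [nat_card_alternatingGroup]; simp [Nat.factorial]
  have hi := K.card_mul_index
  rw [hc] at hi
  obtain ⟨k, hk⟩ : 30 ∣ Nat.card K := by omega
  rw [hk] at hi
  have hi' : k * K.index = 2 := by
    have : 30 * (k * K.index) = 60 := by rw [← hi]; ring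
    omega
  have h2 : K.index ∣ 2 := Dvd.intro_left k hi'
  rcases (Nat.dvd_prime Nat.prime_two).1 h2 with h | h
  · exact Subgroup.index_eq_one.1 h
  · have hn : K.Normal := Subgroup.normal_of_index_eq_two h
    rcases hn.eq_bot_or_eq_top with h' | h'
    · exfalso
      rw [h'] at ma
      revert ma
      rw [Subgroup.mem_bot]
      decide
    · exact h'

lemma isoA5 {A C : SL2C} {l m : ℂ} (h00 : A 0 0 = l) (h11 : A 1 1 = m) (h01 : A 0 1 = 0) (h10 : A 1 0 = 0)
    (hlm : l * m = 1) (h3 : l ^ 2 + m ^ 2 = -1) (hC : C 1 1 = - C 0 0)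
    (hs : str (A * C) ^ 4 - 3 * str (A * C) ^ 2 + 1 = 0) :
    Nonempty (pslImage (Subgroup.closure {A, C}) ≃* alternatingGroup (Fin 5)) := by
  rw [psl_closure]
  have hd := sl_det C
  have st : str (A * C) = (l - m) * C 0 0 := by unfold str; simp only [sl_mul, h00, h11, h01, h10, hC]; ring
  have st2 : str (A * C) ^ 2 = -3 * C 0 0 ^ 2 := by
    rw [st]; linear_combination C 0 0 ^ 2 * h3 - 2 * C 0 0 ^ 2 * hlm
  have hqr : C 0 1 * C 1 0 ≠ 0 := by
    intro h
    have e : C 0 0 ^ 2 = -1 := by rw [hC] at hd; linear_combination -hd - h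
    rw [e] at st2
    have : str (A * C) ^ 4 - 3 * str (A * C) ^ 2 + 1 = 1 := by linear_combination str (A * C) ^ 2 * st2
    rw [this] at hs; norm_num at hs
  have hq := left_ne_zero_of_mul hqr
  have hr := right_ne_zero_of_mul hqr
  have st0 : str (A * C) ≠ 0 := fun h => by rw [h] at hs; norm_num at hs
  have pa : mkP A * mkP A * mkP A = 1 := by
    have : mkP A ^ 3 = 1 := mkP_pow_of_U (by
      rw [chU3]; unfold str; rw [h00, h11]; linear_combination h3 + 2 * hlm)
    rw [← this, pow_three']
  have pc : mkP C * mkP C = 1 := by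
    have : mkP C ^ 2 = 1 := mkP_pow_of_U (by rw [chU2]; unfold str; rw [hC]; ring)
    rw [← this, pow_two]
  have p5 : mkP A * mkP C * (mkP A * mkP C) * (mkP A * mkP C) * (mkP A * mkP C) * (mkP A * mkP C) = 1 := by
    have : mkP (A * C) ^ 5 = 1 := mkP_pow_of_U (by rw [chU5]; exact hs)
    rw [← this, map_mul, pow_succ, pow_succ, pow_three']
  have stab := stab5 ((mkP A, al5) : PSL2C × alternatingGroup (Fin 5)) (mkP C, ga5)
    (by rw [Prod.mk_mul_mk, Prod.mk_mul_mk, pa, t3_5]; rfl)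
    (by rw [Prod.mk_mul_mk, pc, t2_5]; rfl)
    (by simp only [Prod.mk_mul_mk]; rw [p5, t5_5]; rfl)
  set L := Subgroup.closure {((mkP A, al5) : PSL2C × alternatingGroup (Fin 5)), (mkP C, ga5)} with hL
  have mA : ((mkP A, al5) : PSL2C × alternatingGroup (Fin 5)) ∈ L := Subgroup.subset_closure (by simp)
  have base : ∀ g : PSL2C, ((g, 1) : PSL2C × alternatingGroup (Fin 5)) ∈ L →
      g * (mkP A * mkP C) * g⁻¹ = mkP A * mkP C := by
    intro g hg
    have := stab _ hg
    simp only [Prod.mk_mul_mk, prod_grp, Set.mem_insert_iff, Set.mem_singleton_iff, Prod.mk.injEq] at this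
    rcases this with h | h | h | h | h | h | h | h | h | h | h | h
    · exact h.1
    all_goals exfalso; revert h; rintro ⟨-, h⟩; revert h; decide
  have k1 : ∀ g : PSL2C, ((g, 1) : PSL2C × alternatingGroup (Fin 5)) ∈ L → g = 1 := by
    intro g hg
    have b1 := base g hg
    have b2 := base (mkP A * g * (mkP A)⁻¹) (by
      have := mul_mem (mul_mem mA hg) (inv_mem mA)
      simpa [Prod.mk_mul_mk, prod_grp] using this)
    refine comm_one h00 h11 h01 h10 hlm h3 hq hr st0 b1 ?_
    have : mkP C * mkP A = (mkP A)⁻¹ * (mkP A * mkP C) * mkP A := by group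
    rw [this]
    nth_rewrite 2 [← b2]
    group
  apply iso_of _ _ al5 ga5 k1 ?_ top5
  have hsurj : ∀ ρ : alternatingGroup (Fin 5), ∃ h : PSL2C, (h, ρ) ∈ L := by
    intro ρ
    have hρ : ρ ∈ Subgroup.map (MonoidHom.snd PSL2C (alternatingGroup (Fin 5))) L := by
      rw [hL, MonoidHom.map_closure, Set.image_pair]
      change ρ ∈ Subgroup.closure {al5, ga5}
      rw [top5]; trivial
    obtain ⟨⟨h, r⟩, hx, hr⟩ := hρ
    have : r = ρ := hr
    subst this
    exact ⟨h, hx⟩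
  let K : Subgroup (alternatingGroup (Fin 5)) := L.comap (MonoidHom.inr PSL2C (alternatingGroup (Fin 5)))
  have hK : ∀ τ, τ ∈ K ↔ ((1, τ) : PSL2C × alternatingGroup (Fin 5)) ∈ L := fun τ => Iff.rfl
  have hn : K.Normal := by
    constructor
    intro τ hτ ρ
    rw [hK] at hτ ⊢
    obtain ⟨h, hh⟩ := hsurj ρ
    have := mul_mem (mul_mem hh hτ) (inv_mem hh)
    simpa [Prod.mk_mul_mk, prod_grp] using this
  rcases hn.eq_bot_or_eq_top with h | h
  · intro τ hτ
    rw [← hK, h] at hτ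
    exact Subgroup.mem_bot.1 hτ
  · exfalso
    have h1 : ((1, al5) : PSL2C × alternatingGroup (Fin 5)) ∈ L := by rw [← hK, h]; trivial
    have h2 : ((mkP A, 1) : PSL2C × alternatingGroup (Fin 5)) ∈ L := by
      have := mul_mem mA (inv_mem h1)
      simpa [Prod.mk_mul_mk, prod_grp] using this
    have h4 := k1 _ h2
    rw [mkP_one] at h4
    rcases h4 with h4 | h4
    · have e0 : l = 1 := by rw [← h00, h4, one00]
      have e1 : m = 1 := by rw [← h11, h4, one11]
      rw [e0, e1] at h3; norm_num at h3
    · have e0 : l = -1 := by rw [← h00, h4, neg_ap, one00]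
      have e1 : m = -1 := by rw [← h11, h4, neg_ap, one11]
      rw [e0, e1] at h3; norm_num at h3

end

section

lemma closure_le_pair {G : Type*} [Group G] {a b c d : G} (h1 : a ∈ Subgroup.closure {c, d}) (h2 : b ∈ Subgroup.closure {c, d}) :
    Subgroup.closure {a, b} ≤ Subgroup.closure {c, d} := by
  rw [Subgroup.closure_le]
  rintro x (rfl | hx)
  · exact h1
  · rw [Set.mem_singleton_iff] at hx; subst hx; exact h2

lemma mem_l {G : Type*} [Group G] (a b : G) : a ∈ Subgroup.closure {a, b} := Subgroup.subset_closure (by simp)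
lemma mem_r {G : Type*} [Group G] (a b : G) : b ∈ Subgroup.closure {a, b} := Subgroup.subset_closure (by simp)

lemma closure_rot {G : Type*} [Group G] (a b : G) (j : ℤ) : Subgroup.closure {a, b * a ^ j} = Subgroup.closure {a, b} := by
  apply le_antisymm
  · exact closure_le_pair (mem_l a b) (mul_mem (mem_r a b) (zpow_mem (mem_l a b) j))
  · refine closure_le_pair (mem_l _ _) ?_
    have := mul_mem (mem_r a (b * a ^ j)) (zpow_mem (mem_l a (b * a ^ j)) (-j))
    simpa using this

lemma closure_linv {G : Type*} [Group G] (a b : G) : Subgroup.closure {a⁻¹, b} = Subgroup.closure {a, b} := by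
  apply le_antisymm
  · exact closure_le_pair (inv_mem (mem_l a b)) (mem_r a b)
  · refine closure_le_pair ?_ (mem_r _ _)
    have := inv_mem (mem_l a⁻¹ b)
    simpa using this

lemma genA5 {A B : SL2C} {l m : ℂ} (h00 : A 0 0 = l) (h11 : A 1 1 = m) (h01 : A 0 1 = 0) (h10 : A 1 0 = 0)
    (hlm : l * m = 1) (h3 : l ^ 2 + m ^ 2 = -1) (hB : str B ^ 4 - 3 * str B ^ 2 + 1 = 0)
    (hz : str (B * A * B) = 0) :
    Nonempty (pslImage (Subgroup.closure {A, B}) ≃* alternatingGroup (Fin 5)) := by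
  have hd := sl_det B
  have e1 : str (A * B) * str B = str A := by
    have : str (B * A * B) = str (A * B) * str B - str A := by
      unfold str; simp only [sl_mul, h00, h11, h01, h10]; linear_combination -(l + m) * hd
    rw [hz] at this; linear_combination -this
  have e2 : str (A * B) ^ 2 * str B ^ 2 = 1 := by
    have : str A ^ 2 = 1 := by unfold str; rw [h00, h11]; linear_combination h3 + 2 * hlm
    rw [← this, ← e1]; ring
  have e3 : str (A * B) ^ 4 - 3 * str (A * B) ^ 2 + 1 = 0 := by
    linear_combination str (A * B) ^ 4 * hB + (3 * str (A * B) ^ 2 - str (A * B) ^ 2 * str B ^ 2 - 1) * e2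
  have e4 : str (A * (B * A * B)) = str (A * B) ^ 2 - 2 := by
    unfold str; simp only [sl_mul, h00, h11, h01, h10]; linear_combination -2 * hd - 2 * (B 0 0 * B 1 1 - B 0 1 * B 1 0) * hlm
  have iso := isoA5 (C := B * A * B) h00 h11 h01 h10 hlm h3
    (by unfold str at hz; linear_combination hz)
    (by rw [e4]; linear_combination (str (A * B) ^ 4 - 5 * str (A * B) ^ 2 + 5) * e3)
  have h5 : (mkP A * mkP B) ^ 5 = 1 := by
    rw [← map_mul]; exact mkP_pow_of_U (by rw [chU5]; exact e3)
  have : pslImage (Subgroup.closure {A, B}) = pslImage (Subgroup.closure {A, B * A * B}) := by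
    rw [psl_closure, psl_closure, map_mul, map_mul]
    generalize mkP A = a at *
    generalize mkP B = b at *
    apply le_antisymm
    · refine closure_le_pair (mem_l _ _) ?_
      have hm := mul_mem (inv_mem (mem_l a (b * a * b))) (pow_mem (mul_mem (mem_l a (b * a * b)) (mem_r a (b * a * b))) 3)
      convert hm using 1
      have : (a * (b * a * b)) = (a * b) ^ 2 := by rw [pow_two]; simp only [mul_assoc]
      rw [this, ← pow_mul, pow_succ, h5, one_mul, inv_mul_cancel_left]
    · exact closure_le_pair (mem_l _ _) (mul_mem (mul_mem (mem_r _ _) (mem_l _ _)) (mem_r _ _))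
  rw [this]; exact iso

namespace Frame
variable {Γ : Subgroup SL2C} {A B P : SL2C} {lam : ℂ} {k2 : ℝ}

lemma fin3aII' (F : Frame Γ A B lam (2 / 3)) (hx : str A ^ 2 = (1 : ℝ))
    (h : rw' B + (rw' B)⁻¹ = 1 ∨ rw' B + (rw' B)⁻¹ = (1 + 3 * √5) / 4) :
    Nonempty (pslImage (Subgroup.closure {A, B}) ≃* Equiv.Perm (Fin 4)) ∨
    Nonempty (pslImage (Subgroup.closure {A, B}) ≃* alternatingGroup (Fin 5)) := by
  have h3 := F.lam3 hx
  have hlm : lam * lam⁻¹ = 1 := mul_inv_cancel₀ F.hl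
  rcases h with h | h
  · left
    have key : ∃ j : ℤ, rw' (B * A ^ j) = -1 := by
      rcases zeta_one F.w0 (u := lam ^ 2) (n := lam⁻¹ ^ 2) (by rw [h]; ring) (by rw [← mul_pow, hlm, one_pow]) h3 with h | h
      · refine ⟨-1, ?_⟩
        rw [F.rot_w, h, _root_.zpow_neg_one, neg_mul, mul_inv_cancel₀ (pow_ne_zero 2 F.hl)]
      · refine ⟨1, ?_⟩
        rw [F.rot_w, h, zpow_one, neg_mul, ← mul_pow, mul_comm, hlm, one_pow]
    obtain ⟨j, hj⟩ := key
    rw [← closure_rot A B j]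
    have F' := F.rot j
    have hb := F'.b01
    have hk := F'.hk
    generalize B * A ^ j = C at *
    rw [hj] at hb
    push_cast at hk
    exact isoS4 F'.h00 F'.h11 F'.h01 F'.h10 hlm h3 (by rw [hb]; ring)
      (by linear_combination - hk + C 0 0 * hb)
  · right
    have hs := F.s2
    have q5c : (√5 : ℂ) ^ 2 = 5 := by exact_mod_cast q5.2.2
    rw [h] at hs
    push_cast at hs
    have hs' : str B ^ 2 = (3 + √5) / 2 := by unfold str; rw [hs]; ring
    have hB : str B ^ 4 - 3 * str B ^ 2 + 1 = 0 := by
      linear_combination (str B ^ 2 + (3 + √5) / 2 - 3) * hs' + q5c / 4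
    have hk := F.hk
    have hbc := F.hbc
    push_cast at hk hbc
    have hz : str (B * A * B) * str (B * A⁻¹ * B) = 0 := by
      unfold str
      simp only [sl_mul, sl_inv00, sl_inv01, sl_inv10, sl_inv11, F.h00, F.h11, F.h01, F.h10]
      clear F hx h hs' hB
      generalize (√5 : ℂ) = q at *
      generalize lam⁻¹ = n at *
      generalize B 0 0 = a at *
      generalize B 0 1 = b at *
      generalize B 1 0 = c at *
      generalize B 1 1 = d at *
      grind
    rcases mul_eq_zero.1 hz with hz | hz
    · exact genA5 F.h00 F.h11 F.h01 F.h10 hlm h3 hB hz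
    · rw [← closure_linv]
      refine genA5 (l := lam⁻¹) (m := lam) ?_ ?_ ?_ ?_ (by rw [mul_comm, hlm]) (by rw [add_comm]; exact h3) hB hz
      · rw [sl_inv00, F.h11]
      · rw [sl_inv11, F.h00]
      · rw [sl_inv01, F.h01, neg_zero]
      · rw [sl_inv10, F.h10, neg_zero]

lemma fin3aII (F : Frame Γ A B lam (2 / 3)) (hlam : lam ^ 2 = rt 3) (hx : str A ^ 2 = (1 : ℝ))
    (hX : fsq (P * A * P⁻¹) ≤ 2 * 1.0168) (hY : fsq (P * B * P⁻¹) ≤ 2 * 1.0168) :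
    Nonempty (pslImage (Subgroup.closure {A, B}) ≃* Equiv.Perm (Fin 4)) ∨
    Nonempty (pslImage (Subgroup.closure {A, B}) ≃* alternatingGroup (Fin 5)) := by
  obtain ⟨h1, h2, h3⟩ := cb_3aII F hx hX hY
  rcases le_total (cw (rw' B)) 0.6 with h | h
  · obtain ⟨j, j1, j2⟩ := F.rotate (by norm_num) hlam
    rw [cos3] at j1
    rw [← closure_rot A B j]
    exact (F.rot j).fin3aII' hx ((F.rot j).case3aII hx (Or.inl ⟨by linarith, by rw [j2]; exact h1 h⟩))
  · rcases le_total (cw (rw' B)) 0.8 with h' | h'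
    · exact F.fin3aII' hx (F.case3aII hx (Or.inr (Or.inl ⟨h, h2 h'⟩)))
    · exact F.fin3aII' hx (F.case3aII hx (Or.inr (Or.inr ⟨h', h3⟩)))

end Frame

end

section

lemma t3_le : tOf 3 ≤ 1.0168 := by
  obtain ⟨q1, q2, q3⟩ := q5
  change (2 * √(8 + 2 * √5) - (1 + √5)) / (6 - √5) ≤ 1.0168
  rw [div_le_iff₀ (by linarith)]
  have : √(8 + 2 * √5) ≤ 3.531615 := Real.sqrt_le_iff.2 ⟨by norm_num, by nlinarith⟩
  linarith

lemma t4_le : tOf 4 ≤ 1.0603 := by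
  have h3 : √3 ≤ 1.7321 := Real.sqrt_le_iff.2 ⟨by norm_num, by norm_num⟩
  change (√(6 + 2 * √3) - √3) / (3 - √3) ≤ 1.0603
  rw [div_le_iff₀ (by linarith)]
  have : √(6 + 2 * √3) ≤ 3.07644 := Real.sqrt_le_iff.2 ⟨by norm_num, by nlinarith⟩
  linarith

lemma t5_le : tOf 5 ≤ 1.0584 := by
  change t5 ≤ 1.0584
  unfold t5
  split_ifs with h
  · obtain ⟨h1, h2⟩ := h.choose_spec
    set t := h.choose
    by_contra! hc
    obtain ⟨q1, q2, q3⟩ := q5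
    have hcos : Real.cos (π / 5) ^ 2 = (3 + √5) / 8 := by
      rw [Real.cos_pi_div_five]; linear_combination q3 / 16
    rw [hcos] at h2
    have hs : (1.2419 : ℝ) ≤ √((t + 1) * (t + 1 - 2 * ((3 + √5) / 8))) := by
      apply Real.le_sqrt_of_sq_le
      have : (2.0584 : ℝ) * 0.749375 ≤ (t + 1) * (t + 1 - 2 * ((3 + √5) / 8)) := by
        apply mul_le_mul <;> linarith
      refine le_trans (by norm_num) this
    have e1 : (1.0584 : ℝ) * 0.4038875 ≤ t * (t - (3 + √5) / 8) := by
      apply mul_le_mul <;> linarith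
    have e2 : (0.0584 : ℝ) * 1.2419 ≤ (t - 1) * √((t + 1) * (t + 1 - 2 * ((3 + √5) / 8))) := by
      apply mul_le_mul <;> linarith
    linarith
  · norm_num

end

section

lemma exists_lam {n : ℕ} {x : ℂ} (hx : x ^ 2 = ((2 * Real.cos (π / n)) ^ 2 : ℝ)) :
    ∃ lam : ℂ, lam ≠ 0 ∧ lam + lam⁻¹ = x ∧ lam ^ 2 = rt n := by
  set e : ℂ := Complex.exp ((π / n : ℝ) * Complex.I) with he
  have h0 : e ≠ 0 := Complex.exp_ne_zero _
  have h2 : e ^ 2 = rt n := by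
    rw [he, ← Complex.exp_nat_mul]
    unfold rt
    congr 1
    push_cast
    ring
  have h1 : e + e⁻¹ = ((2 * Real.cos (π / n) : ℝ) : ℂ) := by
    rw [he, ← Complex.exp_neg]
    push_cast
    rw [Complex.two_cos]
    congr 2
    ring
  have h3 : (x - (2 * Real.cos (π / n) : ℝ)) * (x + (2 * Real.cos (π / n) : ℝ)) = 0 := by
    push_cast at hx ⊢
    linear_combination hx
  rcases mul_eq_zero.1 h3 with h | h
  · exact ⟨e, h0, by rw [h1]; linear_combination -h, h2⟩
  · exact ⟨-e, neg_ne_zero.2 h0, by rw [inv_neg]; linear_combination -h1 - h, by rw [neg_sq, h2]⟩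

lemma mkFrame {Γ : Subgroup SL2C} (db : DB Γ) {A B : SL2C} (hA : A ∈ Γ) (hB : B ∈ Γ) {lam : ℂ} (hl : lam ≠ 0)
    (htr : lam + lam⁻¹ = str A) (h4 : 4 - str A ^ 2 ≠ 0) {k2 : ℝ} (k0 : 0 < k2)
    (hk : (k2 : ℂ) * (4 - str A ^ 2) = str (A * B * A⁻¹ * B⁻¹) + 2 - str A ^ 2) :
    ∃ P, Frame (cj P Γ) (P * A * P⁻¹) (P * B * P⁻¹) lam k2 := by
  have hlm := mul_inv_cancel₀ hl
  have hne : lam ≠ lam⁻¹ := by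
    intro h
    apply h4
    rw [← htr, ← h]
    rw [← h] at hlm
    linear_combination -4 * hlm
  obtain ⟨P, h1⟩ := exists_diag A lam hl htr hne
  have e : str (A * B * A⁻¹ * B⁻¹) = str ((P * A * P⁻¹) * (P * B * P⁻¹) * (P * A * P⁻¹)⁻¹ * (P * B * P⁻¹)⁻¹) := by
    rw [← str_conj P]
    congr 1
    group
  have hd := sl_det (P * B * P⁻¹)
  rw [e] at hk
  have hA' := mem_cj (P := P) hA
  have hB' := mem_cj (P := P) hB
  rw [← str_conj P A] at hk h4
  refine ⟨P, ?_⟩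
  generalize P * A * P⁻¹ = X at *
  generalize P * B * P⁻¹ = Y at *
  obtain ⟨h00, h11, h01, h10⟩ := h1
  refine ⟨db.cj P, hA', hB', hl, ?_, ?_, ?_, ?_, k0, ?_⟩
  · assumption
  · assumption
  · assumption
  · assumption
  · apply mul_right_cancel₀ h4
    rw [hk]
    unfold str
    simp only [sl_mul, sl_inv00, sl_inv01, sl_inv10, sl_inv11, h00, h01, h10, h11]
    generalize lam⁻¹ = n at *
    clear hk e h4 db hA' hB' hA hB h00 h11 h01 h10 hne htr
    generalize Y 0 0 = a at *
    generalize Y 0 1 = b at *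
    generalize Y 1 0 = c at *
    generalize Y 1 1 = d at *
    grind

lemma PM.back {P A B : SL2C} (h : PM (Subgroup.closure {P * A * P⁻¹, (P * B * P⁻¹) * (P * A * P⁻¹) * (P * B * P⁻¹)⁻¹}) (P * B * P⁻¹)) :
    PM (Subgroup.closure {A, B * A * B⁻¹}) B := by
  have e : (P * B * P⁻¹) * (P * A * P⁻¹) * (P * B * P⁻¹)⁻¹ = P * (B * A * B⁻¹) * P⁻¹ := by group
  rw [e, ← cj_closure] at h
  rcases h with h | h
  · left
    obtain ⟨y, hy, hh⟩ := h
    have : P * y * P⁻¹ = P * B * P⁻¹ := hh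
    have : y = B := by simpa using this
    rw [this] at hy; exact hy
  · right
    obtain ⟨y, hy, hh⟩ := h
    have : P * y * P⁻¹ = -(P * B * P⁻¹) := hh
    have : P * y * P⁻¹ = P * (-B) * P⁻¹ := by rw [this]; simp
    have : y = -B := mul_left_cancel (mul_right_cancel this)
    rw [this] at hy; exact hy

lemma iso_back (P A B : SL2C) {T : Type*} [Group T] (h : Nonempty (pslImage (Subgroup.closure {P * A * P⁻¹, P * B * P⁻¹}) ≃* T)) :
    Nonempty (pslImage (Subgroup.closure {A, B}) ≃* T) := by
  obtain ⟨e⟩ := h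
  have : pslImage (Subgroup.closure {P * A * P⁻¹, P * B * P⁻¹}) = (pslImage (Subgroup.closure {A, B})).map (MulAut.conj (mkP P)).toMonoidHom := by
    rw [psl_closure, psl_closure, MonoidHom.map_closure, Set.image_pair]
    simp
  rw [this] at e
  exact ⟨(Subgroup.equivMapOfInjective _ _ (MulAut.conj (mkP P)).injective).trans e⟩

lemma fsq_back (C P A : SL2C) : fsq (C * A * C⁻¹) = fsq ((C * P⁻¹) * (P * A * P⁻¹) * (C * P⁻¹)⁻¹) := by
  congr 1; group

lemma psl_PM {A B : SL2C} (h : PM (Subgroup.closure {A, B * A * B⁻¹}) B) :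
    pslImage (Subgroup.closure {A, B}) = pslImage (Subgroup.closure {A, B * A * B⁻¹}) := by
  apply le_antisymm
  · rw [psl_closure]
    have hB : mkP B ∈ pslImage (Subgroup.closure {A, B * A * B⁻¹}) := by
      rcases h with h | h
      · exact ⟨B, h, rfl⟩
      · exact ⟨-B, h, mkP_neg B⟩
    rw [psl_closure] at hB ⊢
    exact closure_le_pair (mem_l _ _) hB
  · unfold pslImage
    apply Subgroup.map_mono
    exact closure_le_pair (mem_l _ _) (mul_mem (mul_mem (mem_r _ _) (mem_l _ _)) (inv_mem (mem_r _ _)))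

end

section

lemma a4_ord : ∀ g : Equiv.Perm (Fin 4), Equiv.Perm.sign g = 1 → g ^ 2 = 1 ∨ g ^ 3 = 1 := by decide +kernel
lemma s4_ord : ∀ g : Equiv.Perm (Fin 4), g ^ 2 = 1 ∨ g ^ 3 = 1 ∨ g ^ 4 = 1 := by decide +kernel
lemma a5_ord : ∀ g : Equiv.Perm (Fin 5), Equiv.Perm.sign g = 1 → g ^ 2 = 1 ∨ g ^ 3 = 1 ∨ g ^ 5 = 1 := by
  decide +kernel

lemma a4_nc : ∃ g h : alternatingGroup (Fin 4), g * h ≠ h * g :=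
  ⟨⟨c[0, 1, 2], Equiv.Perm.mem_alternatingGroup.2 (by decide +kernel)⟩,
    ⟨c[1, 2, 3], Equiv.Perm.mem_alternatingGroup.2 (by decide +kernel)⟩, by decide +kernel⟩
lemma s4_nc : ∃ g h : Equiv.Perm (Fin 4), g * h ≠ h * g :=
  ⟨c[0, 1, 2], c[1, 2, 3], by decide +kernel⟩
lemma a5_nc : ∃ g h : alternatingGroup (Fin 5), g * h ≠ h * g :=
  ⟨⟨c[0, 1, 2], Equiv.Perm.mem_alternatingGroup.2 (by decide +kernel)⟩,
    ⟨c[1, 2, 3], Equiv.Perm.mem_alternatingGroup.2 (by decide +kernel)⟩, by decide +kernel⟩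

lemma pow_of_iso {G : Subgroup SL2C} {T : Type*} [Group T] (e : pslImage G ≃* T) {X : SL2C} (hX : X ∈ G) {k : ℕ}
    (h : (e ⟨mkP X, X, hX, rfl⟩) ^ k = 1) : X ^ k = 1 ∨ X ^ k = -1 := by
  rw [← map_pow, map_eq_one_iff e e.injective] at h
  have := congrArg Subtype.val h
  rw [← mkP_one, map_pow]
  exact this

lemma nc_of_iso {A A' : SL2C} {T : Type*} [Group T] (e : pslImage (Subgroup.closure {A, A'}) ≃* T)
    (hT : ∃ g h : T, g * h ≠ h * g) : mkP A' ∉ Subgroup.zpowers (mkP A) := by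
  intro hm
  obtain ⟨g, h, hgh⟩ := hT
  have hle : pslImage (Subgroup.closure {A, A'}) ≤ Subgroup.zpowers (mkP A) := by
    rw [psl_closure]
    rw [Subgroup.closure_le]
    rintro x (rfl | rfl)
    · exact Subgroup.mem_zpowers _
    · exact hm
  apply hgh
  apply e.symm.injective
  rw [map_mul, map_mul]
  apply Subtype.ext
  obtain ⟨i, hi⟩ := hle (e.symm g).2
  obtain ⟨j, hj⟩ := hle (e.symm h).2
  simp only [Subgroup.coe_mul]
  rw [← hi, ← hj]
  exact (Commute.refl (mkP A)).zpow_zpow i j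

lemma ne_of_nc {A A' : SL2C} (h : mkP A' ∉ Subgroup.zpowers (mkP A)) :
    (A * A' ≠ 1 ∧ A * A' ≠ -1) ∧ (A * A'⁻¹ ≠ 1 ∧ A * A'⁻¹ ≠ -1) := by
  have h1 : mkP (A * A') ≠ 1 := by
    intro hh
    apply h
    rw [map_mul] at hh
    rw [(eq_inv_of_mul_eq_one_right hh)]
    exact inv_mem (Subgroup.mem_zpowers _)
  have h2 : mkP (A * A'⁻¹) ≠ 1 := by
    intro hh
    apply h
    rw [map_mul, map_inv, mul_inv_eq_one] at hh
    rw [← hh]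
    exact (Subgroup.mem_zpowers _)
  rw [Ne, mkP_one, not_or] at h1 h2
  exact ⟨h1, h2⟩

lemma re2 {M : SL2C} (h : M ^ 2 = 1 ∨ M ^ 2 = -1) (h1 : M ≠ 1 ∧ M ≠ -1) : ∃ r : ℝ, str M = r ∧ r = 0 := by
  have := U_zero (k := 1) h h1.1 h1.2
  rw [show 1 + 1 = 2 from rfl, chU2] at this
  exact ⟨0, by rw [this]; simp, rfl⟩

lemma re3 {M : SL2C} (h : M ^ 3 = 1 ∨ M ^ 3 = -1) (h1 : M ≠ 1 ∧ M ≠ -1) :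
    ∃ r : ℝ, str M = r ∧ (r = 1 ∨ r = -1) := by
  have := U_zero (k := 2) h h1.1 h1.2
  rw [show 2 + 1 = 3 from rfl, chU3] at this
  have : (str M - 1) * (str M + 1) = 0 := by linear_combination this
  rcases mul_eq_zero.1 this with h | h
  · exact ⟨1, by push_cast; linear_combination h, Or.inl rfl⟩
  · exact ⟨-1, by push_cast; linear_combination h, Or.inr rfl⟩

lemma re4 {M : SL2C} (h : M ^ 4 = 1 ∨ M ^ 4 = -1) (h1 : M ≠ 1 ∧ M ≠ -1) :
    ∃ r : ℝ, str M = r ∧ (r = 0 ∨ r = √2 ∨ r = -√2) := by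
  have := U_zero (k := 3) h h1.1 h1.2
  rw [show 3 + 1 = 4 from rfl, chU4] at this
  have hs : ((√2 : ℝ) : ℂ) ^ 2 = 2 := by norm_cast; rw [Real.sq_sqrt (by norm_num)]; 
  rcases mul_eq_zero.1 this with h | h
  · exact ⟨0, by push_cast; exact h, Or.inl rfl⟩
  have : (str M - (√2 : ℝ)) * (str M + (√2 : ℝ)) = 0 := by linear_combination h - hs
  rcases mul_eq_zero.1 this with h | h
  · exact ⟨√2, by linear_combination h, Or.inr (Or.inl rfl)⟩
  · exact ⟨-√2, by push_cast; linear_combination h, Or.inr (Or.inr rfl)⟩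

lemma re5 {M : SL2C} (h : M ^ 5 = 1 ∨ M ^ 5 = -1) (h1 : M ≠ 1 ∧ M ≠ -1) :
    ∃ r : ℝ, str M = r ∧ (r = (1 + √5) / 2 ∨ r = -((1 + √5) / 2) ∨ r = (√5 - 1) / 2 ∨ r = -((√5 - 1) / 2)) := by
  have := U_zero (k := 4) h h1.1 h1.2
  rw [show 4 + 1 = 5 from rfl, chU5] at this
  have hs : ((√5 : ℝ) : ℂ) ^ 2 = 5 := by norm_cast; rw [Real.sq_sqrt (by norm_num)]; 
  have : ((str M - (((1 + √5) / 2 : ℝ) : ℂ)) * (str M + (((1 + √5) / 2 : ℝ) : ℂ))) *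
      ((str M - (((√5 - 1) / 2 : ℝ) : ℂ)) * (str M + (((√5 - 1) / 2 : ℝ) : ℂ))) = 0 := by
    push_cast
    generalize ((√5 : ℝ) : ℂ) = q at *
    generalize str M = m at *
    clear h h1
    grind
  rcases mul_eq_zero.1 this with h | h <;> rcases mul_eq_zero.1 h with h | h
  · exact ⟨(1 + √5) / 2, by linear_combination h, Or.inl rfl⟩
  · exact ⟨-((1 + √5) / 2), by rw [Complex.ofReal_neg]; linear_combination h, Or.inr (Or.inl rfl)⟩
  · exact ⟨(√5 - 1) / 2, by linear_combination h, Or.inr (Or.inr (Or.inl rfl))⟩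
  · exact ⟨-((√5 - 1) / 2), by rw [Complex.ofReal_neg]; linear_combination h, Or.inr (Or.inr (Or.inr rfl))⟩

/-- Possible values of the traces of non-central elements. -/
def Tr4 (r : ℝ) : Prop := r = 0 ∨ r = 1 ∨ r = -1 ∨ r = √2 ∨ r = -√2
/-- Possible values of the traces of non-central elements in the icosahedral case. -/
def Tr5 (r : ℝ) : Prop := r = 0 ∨ r = 1 ∨ r = -1 ∨
  r = (1 + √5) / 2 ∨ r = -((1 + √5) / 2) ∨ r = (√5 - 1) / 2 ∨ r = -((√5 - 1) / 2)

lemma tr4_of {M : SL2C} (h : (M ^ 2 = 1 ∨ M ^ 2 = -1) ∨ (M ^ 3 = 1 ∨ M ^ 3 = -1) ∨ (M ^ 4 = 1 ∨ M ^ 4 = -1))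
    (h1 : M ≠ 1 ∧ M ≠ -1) : ∃ r : ℝ, str M = r ∧ Tr4 r := by
  unfold Tr4
  rcases h with h | h | h
  · obtain ⟨r, a, b⟩ := re2 h h1; exact ⟨r, a, by tauto⟩
  · obtain ⟨r, a, b⟩ := re3 h h1; exact ⟨r, a, by tauto⟩
  · obtain ⟨r, a, b⟩ := re4 h h1; exact ⟨r, a, by tauto⟩

lemma tr5_of {M : SL2C} (h : (M ^ 2 = 1 ∨ M ^ 2 = -1) ∨ (M ^ 3 = 1 ∨ M ^ 3 = -1) ∨ (M ^ 5 = 1 ∨ M ^ 5 = -1))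
    (h1 : M ≠ 1 ∧ M ≠ -1) : ∃ r : ℝ, str M = r ∧ Tr5 r := by
  unfold Tr5
  rcases h with h | h | h
  · obtain ⟨r, a, b⟩ := re2 h h1; exact ⟨r, a, by tauto⟩
  · obtain ⟨r, a, b⟩ := re3 h h1; exact ⟨r, a, by tauto⟩
  · obtain ⟨r, a, b⟩ := re5 h h1; exact ⟨r, a, by tauto⟩

/-- The possible pairs (tr²(A), tr[A,B]). -/
def Pairs (w z : ℝ) : Prop :=
  (w = 1 ∧ (z = 1 ∨ z = 0 ∨ z = (1 + √5) / 2 ∨ z = (1 - √5) / 2)) ∨ (w = 2 ∧ z = 1) ∨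
  (w = (3 + √5) / 2 ∧ (z = (1 + √5) / 2 ∨ z = 1)) ∨ (w = (3 - √5) / 2 ∧ (z = 1 ∨ z = (1 - √5) / 2))

lemma pairs4 {x y z : ℝ} (hx0 : x ≠ 0) (hx : Tr4 x) (hy : Tr4 y) (hz : Tr4 z) (h : y + z = x ^ 2) :
    Pairs (x ^ 2) z := by
  have hw : x ^ 2 = 1 ∨ x ^ 2 = 2 := by
    rcases hx with h | h | h | h | h
    · exact absurd h hx0
    · left; rw [h]; norm_num
    · left; rw [h]; norm_num
    · right; rw [h, Real.sq_sqrt (by norm_num)]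
    · right; rw [h, neg_sq, Real.sq_sqrt (by norm_num)]
  have b1 : (1.4 : ℝ) < √2 := Real.lt_sqrt_of_sq_lt (by norm_num)
  have b2 : √2 < (1.5 : ℝ) := (Real.sqrt_lt' (by norm_num)).2 (by norm_num)
  unfold Pairs
  rcases hw with w | w <;> rw [w] at h ⊢ <;> rcases hy with rfl | rfl | rfl | rfl | rfl <;>
    rcases hz with rfl | rfl | rfl | rfl | rfl <;> first | (exfalso; linarith) | norm_num

lemma pairs5 {x y z : ℝ} (hx0 : x ≠ 0) (hx : Tr5 x) (hy : Tr5 y) (hz : Tr5 z) (h : y + z = x ^ 2) :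
    Pairs (x ^ 2) z := by
  obtain ⟨b1, b2, b3⟩ := q5
  have hw : x ^ 2 = 1 ∨ x ^ 2 = (3 + √5) / 2 ∨ x ^ 2 = (3 - √5) / 2 := by
    rcases hx with h | h | h | h | h | h | h
    · exact absurd h hx0
    · left; rw [h]; norm_num
    · left; rw [h]; norm_num
    · right; left; rw [h]; linarith
    · right; left; rw [h]; linarith
    · right; right; rw [h]; linarith
    · right; right; rw [h]; linarith
  have n1 : -((√5 - 1) / 2) = (1 - √5) / 2 := by ring
  unfold Pairs
  rcases hw with w | w | w <;> rw [w] at h ⊢ <;> rcases hy with rfl | rfl | rfl | rfl | rfl | rfl | rfl <;>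
    rcases hz with rfl | rfl | rfl | rfl | rfl | rfl | rfl <;> first | (exfalso; linarith) | simp [n1]

lemma tr_ident (A A' : SL2C) (h : str A' = str A) : str (A * A') + str (A * A'⁻¹) = str A ^ 2 := by
  have e : str A ^ 2 = str A * str A' := by rw [h, pow_two]
  rw [e]
  unfold str
  simp only [sl_mul, sl_inv00, sl_inv01, sl_inv10, sl_inv11]
  ring

lemma pairs_of (A B : SL2C) (h0 : str A ≠ 0) (hA1 : A ≠ 1 ∧ A ≠ -1)
    (hiso : Nonempty (↥(pslImage (Subgroup.closure {A, B * A * B⁻¹})) ≃*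
              ↥(alternatingGroup (Fin 4))) ∨
        Nonempty (↥(pslImage (Subgroup.closure {A, B * A * B⁻¹})) ≃* Equiv.Perm (Fin 4)) ∨
        Nonempty (↥(pslImage (Subgroup.closure {A, B * A * B⁻¹})) ≃*
              ↥(alternatingGroup (Fin 5)))) :
    ∃ x z : ℝ, str A = x ∧ str (A * B * A⁻¹ * B⁻¹) = z ∧ Pairs (x ^ 2) z := by
  have e0 : A * B * A⁻¹ * B⁻¹ = A * (B * A * B⁻¹)⁻¹ := by group
  rw [e0]
  have hs : str (B * A * B⁻¹) = str A := str_conj B A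
  generalize B * A * B⁻¹ = A' at *
  have id := tr_ident A A' hs
  have m1 : A ∈ Subgroup.closure {A, A'} := mem_l _ _
  have m2 : A * A' ∈ Subgroup.closure {A, A'} := mul_mem m1 (mem_r _ _)
  have m3 : A * A'⁻¹ ∈ Subgroup.closure {A, A'} := mul_mem m1 (inv_mem (mem_r _ _))
  have fin (T : ℝ → Prop) (hT : ∀ X ∈ Subgroup.closure {A, A'}, (X ≠ 1 ∧ X ≠ -1) → ∃ r : ℝ, str X = r ∧ T r)
      (hnc : mkP A' ∉ Subgroup.zpowers (mkP A)) (hP : ∀ x y z : ℝ, x ≠ 0 → T x → T y → T z → y + z = x ^ 2 → Pairs (x ^ 2) z) :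
      ∃ x z : ℝ, str A = x ∧ str (A * A'⁻¹) = z ∧ Pairs (x ^ 2) z := by
    obtain ⟨n2, n3⟩ := ne_of_nc hnc
    obtain ⟨x, hx, tx⟩ := hT _ m1 hA1
    obtain ⟨y, hy, ty⟩ := hT _ m2 n2
    obtain ⟨z, hz, tz⟩ := hT _ m3 n3
    refine ⟨x, z, hx, hz, hP x y z ?_ tx ty tz ?_⟩
    · rintro rfl; apply h0; rw [hx]; simp
    · rw [hx, hy, hz] at id; exact_mod_cast id
  rcases hiso with he | he | he
  · obtain ⟨e⟩ := he
    refine fin Tr4 (fun X hX h1 => tr4_of ?_ h1) (nc_of_iso e a4_nc) (fun x y z a b c d f => pairs4 a b c d f)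
    rcases a4_ord (e ⟨mkP X, X, hX, rfl⟩).1 (e ⟨mkP X, X, hX, rfl⟩).2 with h | h
    · exact Or.inl (pow_of_iso e hX (Subtype.ext h))
    · exact Or.inr (Or.inl (pow_of_iso e hX (Subtype.ext h)))
  · obtain ⟨e⟩ := he
    refine fin Tr4 (fun X hX h1 => tr4_of ?_ h1) (nc_of_iso e s4_nc) (fun x y z a b c d f => pairs4 a b c d f)
    rcases s4_ord (e ⟨mkP X, X, hX, rfl⟩) with h | h | h
    · exact Or.inl (pow_of_iso e hX h)
    · exact Or.inr (Or.inl (pow_of_iso e hX h))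
    · exact Or.inr (Or.inr (pow_of_iso e hX h))
  · obtain ⟨e⟩ := he
    refine fin Tr5 (fun X hX h1 => tr5_of ?_ h1) (nc_of_iso e a5_nc) (fun x y z a b c d f => pairs5 a b c d f)
    rcases a5_ord (e ⟨mkP X, X, hX, rfl⟩).1 (e ⟨mkP X, X, hX, rfl⟩).2 with h | h | h
    · exact Or.inl (pow_of_iso e hX (Subtype.ext h))
    · exact Or.inr (Or.inl (pow_of_iso e hX (Subtype.ext h)))
    · exact Or.inr (Or.inr (pow_of_iso e hX (Subtype.ext h)))

end

section

lemma frame_get {Γ : Subgroup SL2C} (db : DB Γ) {A B : SL2C} (hA : A ∈ Γ) (hB : B ∈ Γ) (m : ℕ) {w z k2 : ℝ}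
    (hx : str A ^ 2 = (w : ℝ)) (hw : w = (2 * Real.cos (π / m)) ^ 2) (h4 : w < 4)
    (hz : str (A * B * A⁻¹ * B⁻¹) = z) (k0 : 0 < k2) (hk : k2 * (4 - w) = z + 2 - w) (C : SL2C) :
    ∃ lam P Q, Frame (cj P Γ) (P * A * P⁻¹) (P * B * P⁻¹) lam k2 ∧ lam ^ 2 = rt m ∧
      str (P * A * P⁻¹) ^ 2 = (w : ℝ) ∧ fsq (Q * (P * A * P⁻¹) * Q⁻¹) = fsq (C * A * C⁻¹) ∧
      fsq (Q * (P * B * P⁻¹) * Q⁻¹) = fsq (C * B * C⁻¹) := by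
  obtain ⟨lam, hl, htr, hl2⟩ := exists_lam (n := m) (x := str A) (by rw [hx, hw])
  have h4' : 4 - str A ^ 2 ≠ 0 := by
    rw [hx]
    have : (4 - w : ℝ) ≠ 0 := by linarith
    exact_mod_cast this
  obtain ⟨P, F⟩ := mkFrame db hA hB hl htr h4' k0 (by rw [hx, hz]; exact_mod_cast hk)
  refine ⟨lam, P, C * P⁻¹, F, hl2, by rw [str_conj, hx], (fsq_back C P A).symm, (fsq_back C P B).symm⟩

lemma w5 : ((3 + √5) / 2 : ℝ) = (2 * Real.cos (π / (5 : ℕ))) ^ 2 := by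
  rw [Frame.cos5]; obtain ⟨_, _, h⟩ := q5; linarith

lemma w4 : (2 : ℝ) = (2 * Real.cos (π / (4 : ℕ))) ^ 2 := by
  push_cast; rw [Real.cos_pi_div_four, mul_pow, div_pow, Real.sq_sqrt (by norm_num)]; norm_num

lemma w3 : (1 : ℝ) = (2 * Real.cos (π / (3 : ℕ))) ^ 2 := by
  rw [Frame.cos3]; norm_num

lemma core5 {Γ : Subgroup SL2C} (db : DB Γ) {A B : SL2C} (hA : A ∈ Γ) (hB : B ∈ Γ) {z : ℝ}
    (hx : str A ^ 2 = ((3 + √5) / 2 : ℝ)) (hz : str (A * B * A⁻¹ * B⁻¹) = z) (h : z = (1 + √5) / 2 ∨ z = 1)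
    {C : SL2C} (h1 : fsq (C * A * C⁻¹) ≤ 2 * 1.0584) (h2 : fsq (C * B * C⁻¹) ≤ 2 * 1.0584) :
    PM (Subgroup.closure {A, B * A * B⁻¹}) B := by
  obtain ⟨a, b, c⟩ := q5
  rcases h with h | h
  · obtain ⟨lam, P, Q, F, hl, hs, e1, e2⟩ := frame_get db hA hB 5 (k2 := (5 + √5) / 10) hx w5 (by linarith) hz
      (by linarith) (by rw [h]; linarith) C
    exact PM.back (F.fin5a hl hs (by rw [e1]; exact h1) (by rw [e2]; exact h2))
  · obtain ⟨lam, P, Q, F, hl, hs, e1, e2⟩ := frame_get db hA hB 5 (k2 := (5 - √5) / 10) hx w5 (by linarith) hz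
      (by linarith) (by rw [h]; linarith) C
    exact PM.back (F.fin5b hl hs (by rw [e1]; exact h1) (by rw [e2]; exact h2))

lemma core4 {Γ : Subgroup SL2C} (db : DB Γ) {A B : SL2C} (hA : A ∈ Γ) (hB : B ∈ Γ) {z : ℝ}
    (hx : str A ^ 2 = (2 : ℝ)) (hz : str (A * B * A⁻¹ * B⁻¹) = z) (h : z = 1)
    {C : SL2C} (h1 : fsq (C * A * C⁻¹) ≤ 2 * 1.0603) (h2 : fsq (C * B * C⁻¹) ≤ 2 * 1.0603) :
    PM (Subgroup.closure {A, B * A * B⁻¹}) B := by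
  obtain ⟨lam, P, Q, F, hl, hs, e1, e2⟩ := frame_get db hA hB 4 (k2 := 1 / 2) hx w4 (by linarith) hz
      (by linarith) (by rw [h]; linarith) C
  exact PM.back (F.fin4 hl hs (by rw [e1]; exact h1) (by rw [e2]; exact h2))

lemma core3 {Γ : Subgroup SL2C} (db : DB Γ) {A B : SL2C} (hA : A ∈ Γ) (hB : B ∈ Γ) {z : ℝ}
    (hx : str A ^ 2 = (1 : ℝ)) (hz : str (A * B * A⁻¹ * B⁻¹) = z)
    (h : z = 0 ∨ z = (1 + √5) / 2 ∨ z = (1 - √5) / 2)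
    {C : SL2C} (h1 : fsq (C * A * C⁻¹) ≤ 2 * 1.0168) (h2 : fsq (C * B * C⁻¹) ≤ 2 * 1.0168) :
    PM (Subgroup.closure {A, B * A * B⁻¹}) B := by
  obtain ⟨a, b, c⟩ := q5
  rcases h with h | h | h
  · obtain ⟨lam, P, Q, F, hl, hs, e1, e2⟩ := frame_get db hA hB 3 (k2 := 1 / 3) hx w3 (by linarith) hz
      (by linarith) (by rw [h]; linarith) C
    exact PM.back (F.fin3aI hl hs (by rw [e1]; exact h1) (by rw [e2]; exact h2))
  · obtain ⟨lam, P, Q, F, hl, hs, e1, e2⟩ := frame_get db hA hB 3 (k2 := (3 + √5) / 6) hx w3 (by linarith) hz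
      (by linarith) (by rw [h]; linarith) C
    exact PM.back (F.fin3b1 hl hs (by rw [e1]; exact h1) (by rw [e2]; exact h2))
  · obtain ⟨lam, P, Q, F, hl, hs, e1, e2⟩ := frame_get db hA hB 3 (k2 := (3 - √5) / 6) hx w3 (by linarith) hz
      (by linarith) (by rw [h]; linarith) C
    exact PM.back (F.fin3b2 hl hs (by rw [e1]; exact h1) (by rw [e2]; exact h2))

lemma core3' {Γ : Subgroup SL2C} (db : DB Γ) {A B : SL2C} (hA : A ∈ Γ) (hB : B ∈ Γ) {z : ℝ}
    (hx : str A ^ 2 = (1 : ℝ)) (hz : str (A * B * A⁻¹ * B⁻¹) = z) (h : z = 1)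
    {C : SL2C} (h1 : fsq (C * A * C⁻¹) ≤ 2 * 1.0168) (h2 : fsq (C * B * C⁻¹) ≤ 2 * 1.0168) :
    Nonempty (pslImage (Subgroup.closure {A, B}) ≃* Equiv.Perm (Fin 4)) ∨
      Nonempty (pslImage (Subgroup.closure {A, B}) ≃* alternatingGroup (Fin 5)) := by
  obtain ⟨lam, P, Q, F, hl, hs, e1, e2⟩ := frame_get db hA hB 3 (k2 := 2 / 3) hx w3 (by linarith) hz
      (by linarith) (by rw [h]; linarith) C
  rcases F.fin3aII hl hs (by rw [e1]; exact h1) (by rw [e2]; exact h2) with h | h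
  · exact Or.inl (iso_back P A B h)
  · exact Or.inr (iso_back P A B h)

lemma sq_entries (A : SL2C) (i j : Fin 2) : (A ^ 2) i j = str A * A i j - (1 : SL2C) i j := by
  have := pw A 1 i j
  simpa [chU] using this

lemma str_sq (A : SL2C) : str (A ^ 2) = str A ^ 2 - 2 := by
  have h0 := sq_entries A 0 0
  have h1 := sq_entries A 1 1
  rw [one00] at h0
  rw [one11] at h1
  unfold str at *
  rw [h0, h1]; ring

lemma str_comm_sq (A B : SL2C) : str (A ^ 2 * B * (A ^ 2)⁻¹ * B⁻¹) =
    str A ^ 2 * str (A * B * A⁻¹ * B⁻¹) - 2 * str A ^ 2 + 2 := by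
  have h0 := sq_entries A 0 0
  have h1 := sq_entries A 1 1
  have h2 := sq_entries A 0 1
  have h3 := sq_entries A 1 0
  rw [one00] at h0
  rw [one11] at h1
  rw [one01] at h2
  rw [one10] at h3
  have d1 := sl_det A
  have d2 := sl_det B
  unfold str at *
  simp only [sl_mul, sl_inv00, sl_inv01, sl_inv10, sl_inv11, h0, h1, h2, h3]
  clear h0 h1 h2 h3
  generalize A 0 0 = a at *
  generalize A 0 1 = b at *
  generalize A 1 0 = c at *
  generalize A 1 1 = d at *
  generalize B 0 0 = e at *
  generalize B 0 1 = f at *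
  generalize B 1 0 = g at *
  generalize B 1 1 = h at *
  grind

lemma fsq_ge (X : SL2C) : 2 ≤ fsq X := by
  have hd := sl_det X
  have h : ‖X 0 0 * X 1 1 - X 0 1 * X 1 0‖ = 1 := by rw [hd]; simp
  have h1 := norm_sub_le (X 0 0 * X 1 1) (X 0 1 * X 1 0)
  rw [h, norm_mul, norm_mul] at h1
  unfold fsq
  nlinarith [sq_nonneg (‖X 0 0‖ - ‖X 1 1‖), sq_nonneg (‖X 0 1‖ - ‖X 1 0‖)]

lemma norm_aux (u : ℂ) (x : ℝ) : ‖(x : ℂ) * u - 1‖ ^ 2 = x ^ 2 * ‖u‖ ^ 2 - 2 * x * u.re + 1 := by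
  rw [← Complex.normSq_eq_norm_sq, ← Complex.normSq_eq_norm_sq, Complex.normSq_apply, Complex.normSq_apply]
  simp
  ring

lemma fsq_sq {X : SL2C} {x : ℝ} (hx : str X = x) : fsq (X ^ 2) = 2 + x ^ 2 * (fsq X - 2) := by
  have h0 := sq_entries X 0 0
  have h1 := sq_entries X 1 1
  have h2 := sq_entries X 0 1
  have h3 := sq_entries X 1 0
  rw [one00] at h0
  rw [one11] at h1
  rw [one01] at h2
  rw [one10] at h3
  unfold fsq
  rw [h0, h1, h2, h3, hx, norm_aux, norm_aux, sub_zero, sub_zero, norm_mul, norm_mul, mul_pow, mul_pow]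
  have : X.1 0 0 + X.1 1 1 = x := hx
  have := congrArg Complex.re this
  simp only [Complex.add_re, Complex.ofReal_re] at this
  rw [Complex.norm_real, Real.norm_eq_abs, sq_abs]
  linear_combination (-2 * x) * this

lemma order3 {A : SL2C} {n : ℕ} (hn : 3 ≤ n) (hA : IsEllipticOfOrder A n) (h : str A ^ 2 = 1) : n = 3 := by
  by_contra hne
  have h3 : A ^ 3 = 1 ∨ A ^ 3 = -1 := pow_of_U (k := 2) (by rw [show 2 + 1 = 3 from rfl, chU3, h, sub_self])
  have := hA.2 3 (by omega) (by omega)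
  tauto

lemma ell_ne {A : SL2C} {n : ℕ} (hn : 3 ≤ n) (hA : IsEllipticOfOrder A n) : A ≠ 1 ∧ A ≠ -1 := by
  have := hA.2 1 le_rfl (by omega)
  simpa using this

lemma ell_tr {A : SL2C} {n : ℕ} (hn : 3 ≤ n) (hA : IsEllipticOfOrder A n) : str A ≠ 0 := by
  intro h
  have h3 : A ^ 2 = 1 ∨ A ^ 2 = -1 := pow_of_U (k := 1) (by rw [show 1 + 1 = 2 from rfl, chU2, h])
  have := hA.2 2 (by omega) (by omega)
  tauto

lemma order4 {A : SL2C} {n : ℕ} (hn : 3 ≤ n) (hA : IsEllipticOfOrder A n) (h : str A ^ 2 = 2) : n = 4 := by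
  by_contra hne
  have h4 : A ^ 4 = 1 ∨ A ^ 4 = -1 := pow_of_U (k := 3) (by rw [show 3 + 1 = 4 from rfl, chU4, h]; ring)
  have hle : n ≤ 4 := by
    by_contra hlt
    have := hA.2 4 (by omega) (by omega)
    tauto
  obtain rfl : n = 3 := by omega
  obtain ⟨a, b⟩ := ell_ne hn hA
  have := U_zero (k := 2) hA.1 a b
  rw [show 2 + 1 = 3 from rfl, chU3, h] at this
  norm_num at this

lemma order5 {A : SL2C} {n : ℕ} {w : ℝ} (hn : 3 ≤ n) (hA : IsEllipticOfOrder A n) (h : str A ^ 2 = (w : ℝ))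
    (hw : w ^ 2 - 3 * w + 1 = 0) : n = 5 := by
  by_contra hne
  have hw' : (w : ℂ) ^ 2 - 3 * w + 1 = 0 := by exact_mod_cast hw
  have h4 : A ^ 5 = 1 ∨ A ^ 5 = -1 := pow_of_U (k := 4) (by
    rw [show 4 + 1 = 5 from rfl, chU5, h, show str A ^ 4 = (str A ^ 2) ^ 2 by ring, h, hw'])
  have hle : n ≤ 5 := by
    by_contra hlt
    have := hA.2 5 (by omega) (by omega)
    tauto
  obtain ⟨a, b⟩ := ell_ne hn hA
  have h0 := ell_tr hn hA
  obtain rfl | rfl : n = 3 ∨ n = 4 := by omega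
  · have := U_zero (k := 2) hA.1 a b
    rw [show 2 + 1 = 3 from rfl, chU3, h] at this
    have : w - 1 = 0 := by exact_mod_cast this
    obtain rfl : w = 1 := by linarith
    norm_num at hw
  · have := U_zero (k := 3) hA.1 a b
    rw [show 3 + 1 = 4 from rfl, chU4, h] at this
    have := (mul_eq_zero.1 this).resolve_left h0
    have : w - 2 = 0 := by exact_mod_cast this
    obtain rfl : w = 2 := by linarith
    norm_num at hw

lemma PM.sq {A B : SL2C} (h : PM (Subgroup.closure {A ^ 2, B * A ^ 2 * B⁻¹}) B) :
    PM (Subgroup.closure {A, B * A * B⁻¹}) B := by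
  have hle : Subgroup.closure {A ^ 2, B * A ^ 2 * B⁻¹} ≤ Subgroup.closure {A, B * A * B⁻¹} := by
    apply closure_le_pair
    · exact pow_mem (mem_l _ _) 2
    · have : B * A ^ 2 * B⁻¹ = (B * A * B⁻¹) ^ 2 := by rw [conj_pow]
      rw [this]
      exact pow_mem (mem_r _ _) 2
  exact h.imp (fun h => hle h) (fun h => hle h)

end


/-- Theorem 4.1: if `⟨A, B·A·B⁻¹⟩` projects to `A₄`, `S₄` or `A₅` in `PSL(2,ℂ)`,
then either `⟨A,B⟩` does as well, or the displacement bound `c(n)` holds strictly. -/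
theorem margulis_elliptic_group_case (A B : SL2C) (n : ℕ) (hn : 3 ≤ n)
    (hd : IsDiscreteSubgroup (Subgroup.closure {A, B}))
    (hA : IsEllipticOfOrder A n)
    (hiso : Nonempty (↥(pslImage (Subgroup.closure {A, B * A * B⁻¹})) ≃*
              ↥(alternatingGroup (Fin 4))) ∨
        Nonempty (↥(pslImage (Subgroup.closure {A, B * A * B⁻¹})) ≃* Equiv.Perm (Fin 4)) ∨
        Nonempty (↥(pslImage (Subgroup.closure {A, B * A * B⁻¹})) ≃*
              ↥(alternatingGroup (Fin 5)))) :
    (Nonempty (↥(pslImage (Subgroup.closure {A, B})) ≃* ↥(alternatingGroup (Fin 4))) ∨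
        Nonempty (↥(pslImage (Subgroup.closure {A, B})) ≃* Equiv.Perm (Fin 4)) ∨
        Nonempty (↥(pslImage (Subgroup.closure {A, B})) ≃* ↥(alternatingGroup (Fin 5)))) ∨
      ∀ C : SL2C,
        max (fnorm ((C * A * C⁻¹ : SL2C) : Matrix (Fin 2) (Fin 2) ℂ) ^ 2)
      (fnorm ((C * B * C⁻¹ : SL2C) : Matrix (Fin 2) (Fin 2) ℂ) ^ 2) > 2 * tOf n := by
  by_cases hall : ∀ C : SL2C,
        max (fnorm ((C * A * C⁻¹ : SL2C) : Matrix (Fin 2) (Fin 2) ℂ) ^ 2)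
      (fnorm ((C * B * C⁻¹ : SL2C) : Matrix (Fin 2) (Fin 2) ℂ) ^ 2) > 2 * tOf n
  · exact Or.inr hall
  left
  push Not at hall
  obtain ⟨C, hC⟩ := hall
  rw [fnorm_sq, fnorm_sq, max_le_iff] at hC
  obtain ⟨h1, h2⟩ := hC
  have db := db_of_discrete hd
  have mA : A ∈ Subgroup.closure {A, B} := mem_l _ _
  have mB : B ∈ Subgroup.closure {A, B} := mem_r _ _
  obtain ⟨x, z, hx, hz, hp⟩ := pairs_of A B (ell_tr hn hA) (ell_ne hn hA) hiso
  have hx2 : str A ^ 2 = ((x ^ 2 : ℝ) : ℂ) := by rw [hx]; push_cast; rfl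
  have fin : PM (Subgroup.closure {A, B * A * B⁻¹}) B → _ := fun h => by
    rw [← psl_PM h] at hiso
    exact hiso
  obtain ⟨q1, q2, q3⟩ := q5
  rcases hp with ⟨hw, hzz⟩ | ⟨hw, hzz⟩ | ⟨hw, hzz⟩ | ⟨hw, hzz⟩
  · rw [hw] at hx2
    obtain rfl := order3 hn hA (by rw [hx2]; simp)
    have b1 := h1.trans (mul_le_mul_of_nonneg_left t3_le zero_le_two)
    have b2 := h2.trans (mul_le_mul_of_nonneg_left t3_le zero_le_two)
    rcases hzz with h | h
    · exact Or.inr (core3' db mA mB hx2 hz h b1 b2)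
    · exact fin (core3 db mA mB hx2 hz h b1 b2)
  · rw [hw] at hx2
    obtain rfl := order4 hn hA (by rw [hx2]; simp)
    have b1 := h1.trans (mul_le_mul_of_nonneg_left t4_le zero_le_two)
    have b2 := h2.trans (mul_le_mul_of_nonneg_left t4_le zero_le_two)
    exact fin (core4 db mA mB hx2 hz hzz b1 b2)
  · rw [hw] at hx2
    obtain rfl := order5 hn hA hx2 (by linarith)
    have b1 := h1.trans (mul_le_mul_of_nonneg_left t5_le zero_le_two)
    have b2 := h2.trans (mul_le_mul_of_nonneg_left t5_le zero_le_two)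
    exact fin (core5 db mA mB hx2 hz hzz b1 b2)
  · have hx2' := hx2
    rw [hw] at hx2'
    obtain rfl := order5 hn hA hx2' (by linarith)
    have b1 := h1.trans (mul_le_mul_of_nonneg_left t5_le zero_le_two)
    have b2 := h2.trans (mul_le_mul_of_nonneg_left t5_le zero_le_two)
    have s1 : str (A ^ 2) ^ 2 = ((3 + √5) / 2 : ℝ) := by
      rw [str_sq, hx2']
      norm_cast
      linarith
    have s2 : str (A ^ 2 * B * (A ^ 2)⁻¹ * B⁻¹) = ((x ^ 2 * z - 2 * x ^ 2 + 2 : ℝ) : ℂ) := by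
      rw [str_comm_sq, hx2, hz]
      push_cast
      ring
    have s3 : x ^ 2 * z - 2 * x ^ 2 + 2 = (1 + √5) / 2 ∨ x ^ 2 * z - 2 * x ^ 2 + 2 = 1 := by
      rw [hw]
      rcases hzz with h | h
      · left; rw [h]; linarith
      · right; rw [h]; linarith
    have s4 : fsq (C * A ^ 2 * C⁻¹) ≤ 2 * 1.0584 := by
      rw [← conj_pow, fsq_sq (x := x) (by rw [str_conj, hx]), hw]
      have := fsq_ge (C * A * C⁻¹)
      nlinarith
    exact fin (PM.sq (core5 db (pow_mem mA 2) mB s1 s2 s3 s4 b2))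


end
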